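/- Let u ∈ L^∞(ℝⁿ×(0,T); ℝⁿ) be a mild solution of the Navier–Stokes equations with initial datum u₀ ∈ L^∞(ℝⁿ;ℝⁿ). Then for all integers k, l ≥ 0 the functions t^{k/2+l} ∇_x^k ∂_t^l u are bounded on ℝⁿ×(0,T), and there exist constants ε(k,l) > 0 and C(k,l) (depending also on n) such that, with T' = min(T, ε(k,l) ‖u₀‖_{L^∞(ℝⁿ)}^{−2}), one has ‖t^{k/2+l} ∇_x^k ∂_t^l u‖_{L^∞(ℝⁿ×(0,T'))} ≤ C(k,l) ‖u₀‖_{L^∞(ℝⁿ)}. -/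

import Mathlib

open MeasureTheory Real Filter Topology

noncomputable section

/-- Euclidean space ℝⁿ. -/
abbrev Euc (n : ℕ) := EuclideanSpace ℝ (Fin n)

/-- The heat kernel Γ(x,t) = (4πt)^{-n/2} exp(-|x|²/(4t)). -/
noncomputable def heatKer (n : ℕ) (x : Euc n) (t : ℝ) : ℝ :=
  (4 * π * t) ^ (-(n : ℝ) / 2) * Real.exp (-‖x‖ ^ 2 / (4 * t))

/-- The fundamental solution G of the Laplacian on ℝⁿ (n ≥ 2). -/
noncomputable def lapFund (n : ℕ) (x : Euc n) : ℝ :=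
  if n = 2 then (2 * π)⁻¹ * Real.log ‖x‖
  else -((((n : ℝ) - 2) * (2 * π ^ ((n : ℝ) / 2) / Real.Gamma ((n : ℝ) / 2)))⁻¹) *
      ‖x‖ ^ (2 - (n : ℝ))

/-- The generating function Φ(x,t) = ∫_{ℝⁿ} G(y) Γ(x-y,t) dy. -/
noncomputable def genPhi (n : ℕ) (x : Euc n) (t : ℝ) : ℝ :=
  ∫ y : Euc n, lapFund n y * heatKer n (x - y) t

/-- Spatial partial derivative ∂f/∂x_i of a scalar function on ℝⁿ. -/
noncomputable def pd (n : ℕ) (i : Fin n) (f : Euc n → ℝ) (x : Euc n) : ℝ :=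
  fderiv ℝ f x (EuclideanSpace.single i 1)

/-- The Laplacian of a scalar function on ℝⁿ. -/
noncomputable def lap (n : ℕ) (f : Euc n → ℝ) (x : Euc n) : ℝ :=
  ∑ i : Fin n, pd n i (pd n i f) x

/-- The Oseen kernel K_{ij} = (-δ_{ij}Δ + ∂²/∂x_i∂x_j)Φ. -/
noncomputable def Kmat (n : ℕ) (i j : Fin n) (x : Euc n) (t : ℝ) : ℝ :=
  (if i = j then -(lap n (fun y => genPhi n y t) x) else 0)
    + pd n i (pd n j (fun y => genPhi n y t)) x

/-- The kernel K_{ijk} = ∂K_{ij}/∂x_k. -/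
noncomputable def Kten (n : ℕ) (i j k : Fin n) (x : Euc n) (t : ℝ) : ℝ :=
  pd n k (fun y => Kmat n i j y t) x

/-- Mild solution of the Navier–Stokes equations on ℝⁿ × (t₀,t₁) with initial datum u₀:
u_i(x,t) = ∫ Γ(x-y,t-t₀) u₀ᵢ(y) dy - ∫_{t₀}^t ∫ K_{ijk}(x-y,t-s) u_k u_j dy ds. -/
def IsMildNS (n : ℕ) (t₀ t₁ : ℝ) (u₀ : Euc n → Euc n) (u : Euc n → ℝ → Euc n) : Prop :=
  ∀ x : Euc n, ∀ t : ℝ, t ∈ Set.Ioo t₀ t₁ → ∀ i : Fin n,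
    u x t i = (∫ y : Euc n, heatKer n (x - y) (t - t₀) * u₀ y i)
      - ∫ s in Set.Ioo t₀ t, ∫ y : Euc n,
          ∑ j : Fin n, ∑ k : Fin n, Kten n i j k (x - y) (t - s) * u y s k * u y s j

/-- Spatial partial derivative for functions on space-time ℝⁿ × ℝ. -/
noncomputable def pdx (n : ℕ) (i : Fin n) (g : Euc n × ℝ → ℝ) (p : Euc n × ℝ) : ℝ :=
  fderiv ℝ g p (EuclideanSpace.single i 1, 0)

/-- Time derivative for functions on space-time ℝⁿ × ℝ. -/
noncomputable def pdt (n : ℕ) (g : Euc n × ℝ → ℝ) (p : Euc n × ℝ) : ℝ :=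
  fderiv ℝ g p (0, 1)

/-- Spatial Laplacian for functions on space-time ℝⁿ × ℝ. -/
noncomputable def lapx (n : ℕ) (g : Euc n × ℝ → ℝ) (p : Euc n × ℝ) : ℝ :=
  ∑ i : Fin n, pdx n i (pdx n i g) p

/-- The algebra of bounded measurable real functions, with the supremum norm. -/
def bddMeas (Q : Type*) [MeasurableSpace Q] : Subalgebra ℝ (lp (fun _ : Q => ℝ) (⊤ : ENNReal)) where
  carrier := {f | Measurable (f : Q → ℝ)}
  mul_mem' {f g} hf hg := by
    simpa only [Set.mem_ofPred_eq, lp.infty_coeFn_mul] using Measurable.mul hf hg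
  add_mem' {f g} hf hg := by
    simpa only [Set.mem_ofPred_eq, lp.coeFn_add] using Measurable.add hf hg
  algebraMap_mem' r := by
    have : ((algebraMap ℝ (lp (fun _ : Q => ℝ) (⊤ : ENNReal)) r : lp (fun _ : Q => ℝ) (⊤ : ENNReal)) : Q → ℝ)
        = fun _ => r := rfl
    simp only [Set.mem_ofPred_eq, this]
    exact measurable_const

/-- The type of bounded measurable real functions. -/
def BM (Q : Type*) [MeasurableSpace Q] : Type _ := bddMeas Q

namespace BM

variable {Q : Type*} [MeasurableSpace Q]

instance : NormedCommRing (BM Q) := inferInstanceAs (NormedCommRing (bddMeas Q))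

instance : NormedAlgebra ℝ (BM Q) := inferInstanceAs (NormedAlgebra ℝ (bddMeas Q))

instance : NormedAddCommGroup (BM Q) := inferInstance

instance : NormedSpace ℝ (BM Q) := inferInstance

/-- The underlying function of a bounded measurable function. -/
def fn (f : BM Q) (q : Q) : ℝ := (f.1 : lp (fun _ : Q => ℝ) (⊤ : ENNReal)) q

theorem measurable_fn (f : BM Q) : Measurable f.fn := f.2

theorem abs_fn_le (f : BM Q) (q : Q) : |f.fn q| ≤ ‖f‖ :=
  lp.norm_apply_le_norm ENNReal.top_ne_zero f.1 q

@[ext] theorem ext_fn {f g : BM Q} (h : ∀ q, f.fn q = g.fn q) : f = g :=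
  Subtype.ext (lp.ext (funext h))

theorem norm_le {f : BM Q} {C : ℝ} (hC : 0 ≤ C) (h : ∀ q, |f.fn q| ≤ C) : ‖f‖ ≤ C :=
  lp.norm_le_of_forall_le hC h

/-- Build a bounded measurable function from its values. -/
def mk' (f : Q → ℝ) (hf : Measurable f) (C : ℝ) (hC : ∀ q, |f q| ≤ C) : BM Q :=
  ⟨⟨f, memℓp_infty ⟨C, by rintro _ ⟨q, rfl⟩; exact hC q⟩⟩, hf⟩

@[simp] theorem mk'_fn (f : Q → ℝ) (hf : Measurable f) (C : ℝ) (hC : ∀ q, |f q| ≤ C) (q : Q) :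
    (mk' f hf C hC).fn q = f q := rfl

@[simp] theorem add_fn (f g : BM Q) (q : Q) : (f + g).fn q = f.fn q + g.fn q := rfl
@[simp] theorem sub_fn (f g : BM Q) (q : Q) : (f - g).fn q = f.fn q - g.fn q := rfl
@[simp] theorem zero_fn (q : Q) : (0 : BM Q).fn q = 0 := rfl
@[simp] theorem one_fn (q : Q) : (1 : BM Q).fn q = 1 := rfl
@[simp] theorem mul_fn (f g : BM Q) (q : Q) : (f * g).fn q = f.fn q * g.fn q := rfl
@[simp] theorem smul_fn (c : ℝ) (f : BM Q) (q : Q) : (c • f).fn q = c * f.fn q := rfl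

/-- Evaluation at a point, as a continuous linear functional. -/
def eval (q : Q) : BM Q →L[ℝ] ℝ :=
  LinearMap.mkContinuous
    { toFun := fun f => f.fn q, map_add' := fun _ _ => rfl, map_smul' := fun _ _ => rfl } 1
    (fun f => (abs_fn_le f q).trans_eq (one_mul _).symm)

@[simp] theorem sum_fn {ι : Type*} (s : Finset ι) (f : ι → BM Q) (q : Q) :
    (∑ i ∈ s, f i).fn q = ∑ i ∈ s, (f i).fn q := by
  exact map_sum (eval q) f s

instance : CompleteSpace (BM Q) := by
  have hc : IsClosed ((bddMeas Q : Subalgebra ℝ (lp (fun _ : Q => ℝ) (⊤ : ENNReal))) :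
      Set (lp (fun _ : Q => ℝ) (⊤ : ENNReal))) := by
    refine IsSeqClosed.isClosed ?_
    intro f g hf hg
    refine measurable_of_tendsto_metrizable (f := fun n => (f n : Q → ℝ)) hf ?_
    rw [tendsto_pi_nhds]
    intro q
    exact ((lp.lipschitzWith_one_eval (E := fun _ : Q => ℝ) ⊤ q).continuous.tendsto g).comp hg
  exact hc.completeSpace_coe

end BM

section KernelOperator

variable {Q Q' Ω : Type*} [MeasurableSpace Q] [MeasurableSpace Q'] [MeasurableSpace Ω]

/-- A measurable kernel dominated, uniformly in the output variable, by an integrable function. -/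
def GoodKer (ν : Measure Ω) (k : Q → Ω → ℝ) : Prop :=
  Measurable (Function.uncurry k) ∧
    ∃ G : Ω → ℝ, Integrable G ν ∧ (∀ z, 0 ≤ G z) ∧ ∀ q z, |k q z| ≤ G z

theorem GoodKer.integrable_mul {ν : Measure Ω} {k : Q → Ω → ℝ} (hk : GoodKer ν k)
    {Θ : Q × Ω → Q'} (hΘ : Measurable Θ) (f : BM Q') (q : Q) :
    Integrable (fun z => k q z * f.fn (Θ (q, z))) ν := by
  obtain ⟨hm, G, hG, hG0, hb⟩ := hk
  refine (hG.mul_const ‖f‖).mono' ?_ (ae_of_all _ fun z => ?_)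
  · exact ((hm.comp measurable_prodMk_left).mul
      (f.measurable_fn.comp (hΘ.comp measurable_prodMk_left))).aestronglyMeasurable
  · rw [norm_mul]
    exact mul_le_mul (hb q z) (f.abs_fn_le _) (abs_nonneg _) (hG0 z)

theorem abs_integral_mul_le_of_le {R : Type*} {ν : Measure Ω} {k : R → Ω → ℝ} {G : Ω → ℝ}
    (hG : Integrable G ν) (hb : ∀ q z, |k q z| ≤ G z) (Θ : R × Ω → Q') (f : BM Q') (q : R) :
    |∫ z, k q z * f.fn (Θ (q, z)) ∂ν| ≤ (∫ z, G z ∂ν) * ‖f‖ := by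
  rw [← integral_mul_const]
  refine norm_integral_le_of_norm_le (G := ℝ) (hG.mul_const ‖f‖) (ae_of_all _ fun z => ?_)
  rw [norm_mul]
  exact mul_le_mul (hb q z) (f.abs_fn_le _) (abs_nonneg _) ((abs_nonneg _).trans (hb q z))

open Classical in
/-- The integral operator `f ↦ (q ↦ ∫ k q z * f (Θ (q, z)) ∂ν)` on bounded measurable
functions (zero if the kernel is not good). -/
def kerOp (ν : Measure Ω) [SFinite ν] (Θ : Q × Ω → Q') (hΘ : Measurable Θ) (k : Q → Ω → ℝ) :
    BM Q' →L[ℝ] BM Q :=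
  if hk : GoodKer ν k then
    LinearMap.mkContinuous
      { toFun := fun f => BM.mk' (fun q => ∫ z, k q z * f.fn (Θ (q, z)) ∂ν)
          (StronglyMeasurable.measurable (StronglyMeasurable.integral_prod_right'
            (f := fun z : Q × Ω => k z.1 z.2 * f.fn (Θ z))
            (hk.1.mul (f.measurable_fn.comp hΘ)).stronglyMeasurable))
          ((∫ z, hk.2.choose z ∂ν) * ‖f‖)
          (abs_integral_mul_le_of_le hk.2.choose_spec.1 hk.2.choose_spec.2.2 Θ f)
        map_add' := fun f g => by
          ext q
          simp only [BM.mk'_fn, BM.add_fn]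
          rw [← integral_add (hk.integrable_mul hΘ f q) (hk.integrable_mul hΘ g q)]
          simp only [mul_add]
        map_smul' := fun c f => by
          ext q
          simp only [BM.mk'_fn, BM.smul_fn, RingHom.id_apply]
          rw [← integral_const_mul]
          simp only [mul_left_comm] }
      (∫ z, hk.2.choose z ∂ν) (fun f => BM.norm_le
        (mul_nonneg (integral_nonneg hk.2.choose_spec.2.1) (norm_nonneg f))
        (abs_integral_mul_le_of_le hk.2.choose_spec.1 hk.2.choose_spec.2.2 Θ f))
  else 0

variable {ν : Measure Ω} {Θ : Q × Ω → Q'} {hΘ : Measurable Θ}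

theorem kerOp_fn [SFinite ν] {k : Q → Ω → ℝ} (hk : GoodKer ν k) (f : BM Q') (q : Q) :
    (kerOp ν Θ hΘ k f).fn q = ∫ z, k q z * f.fn (Θ (q, z)) ∂ν := by
  rw [kerOp, dif_pos hk]
  rfl

theorem norm_kerOp_le [SFinite ν] {k : Q → Ω → ℝ} (hm : Measurable (Function.uncurry k)) {G : Ω → ℝ}
    (hG : Integrable G ν) (hG0 : ∀ z, 0 ≤ G z) (hb : ∀ q z, |k q z| ≤ G z) :
    ‖kerOp ν Θ hΘ k‖ ≤ ∫ z, G z ∂ν := by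
  refine ContinuousLinearMap.opNorm_le_bound _ (integral_nonneg hG0) fun f => ?_
  refine BM.norm_le (mul_nonneg (integral_nonneg hG0) (norm_nonneg f)) fun q => ?_
  rw [kerOp_fn ⟨hm, G, hG, hG0, hb⟩]
  exact abs_integral_mul_le_of_le hG hb Θ f q

theorem GoodKer.add {k l : Q → Ω → ℝ} (hk : GoodKer ν k) (hl : GoodKer ν l) :
    GoodKer ν (fun q z => k q z + l q z) := by
  obtain ⟨hm, G, hG, hG0, hb⟩ := hk
  obtain ⟨hm', G', hG', hG0', hb'⟩ := hl
  exact ⟨hm.add hm', fun z => G z + G' z, hG.add hG', fun z => add_nonneg (hG0 z) (hG0' z),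
    fun q z => (abs_add_le _ _).trans (add_le_add (hb q z) (hb' q z))⟩

theorem GoodKer.const_mul {k : Q → Ω → ℝ} (hk : GoodKer ν k) (c : ℝ) :
    GoodKer ν (fun q z => c * k q z) := by
  obtain ⟨hm, G, hG, hG0, hb⟩ := hk
  refine ⟨hm.const_mul c, fun z => |c| * G z, hG.const_mul _,
    fun z => mul_nonneg (abs_nonneg _) (hG0 z), fun q z => ?_⟩
  rw [abs_mul]
  exact mul_le_mul_of_nonneg_left (hb q z) (abs_nonneg _)

theorem kerOp_add [SFinite ν] {k l : Q → Ω → ℝ} (hk : GoodKer ν k) (hl : GoodKer ν l) :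
    kerOp ν Θ hΘ (fun q z => k q z + l q z) = kerOp ν Θ hΘ k + kerOp ν Θ hΘ l := by
  ext f q
  rw [kerOp_fn (hk.add hl), add_apply, BM.add_fn, kerOp_fn hk, kerOp_fn hl,
    ← integral_add (hk.integrable_mul hΘ f q) (hl.integrable_mul hΘ f q)]
  simp only [add_mul]

theorem kerOp_const_mul [SFinite ν] {k : Q → Ω → ℝ} (hk : GoodKer ν k) (c : ℝ) :
    kerOp ν Θ hΘ (fun q z => c * k q z) = c • kerOp ν Θ hΘ k := by
  ext f q
  rw [kerOp_fn (hk.const_mul c), smul_apply, BM.smul_fn, kerOp_fn hk,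
    ← integral_const_mul]
  simp only [mul_assoc]

theorem kerOp_sub [SFinite ν] {k l : Q → Ω → ℝ} (hk : GoodKer ν k) (hl : GoodKer ν l) :
    kerOp ν Θ hΘ (fun q z => k q z - l q z) = kerOp ν Θ hΘ k - kerOp ν Θ hΘ l := by
  have hkl : GoodKer ν (fun q z => k q z - l q z) := by
    simpa only [sub_eq_add_neg, neg_one_mul] using hk.add (hl.const_mul (-1))
  ext f q
  rw [kerOp_fn hkl, sub_apply, BM.sub_fn, kerOp_fn hk, kerOp_fn hl,
    ← integral_sub (hk.integrable_mul hΘ f q) (hl.integrable_mul hΘ f q)]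
  simp only [sub_mul]

end KernelOperator

section SmoothKernel

variable {P Q Q' Ω : Type*} [NormedAddCommGroup P] [NormedSpace ℝ P]
  [MeasurableSpace Q] [MeasurableSpace Q'] [MeasurableSpace Ω]

/-- A family of kernels depending smoothly on a parameter `p`, all of whose parameter derivatives
are dominated on `V` by integrable functions. -/
structure SmoothKer (ν : Measure Ω) (V : Set P) (κ : P → Q → Ω → ℝ) : Prop where
  meas : ∀ p, Measurable (Function.uncurry (κ p))
  smooth : ∀ q z, ContDiff ℝ ((⊤ : ℕ∞) : WithTop ℕ∞) (fun p => κ p q z)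
  bound : ∀ m : ℕ, ∃ G : Ω → ℝ, Integrable G ν ∧ (∀ z, 0 ≤ G z) ∧
    ∀ p ∈ V, ∀ q z, ‖iteratedFDeriv ℝ m (fun p => κ p q z) p‖ ≤ G z

namespace SmoothKer

variable {ν : Measure Ω} {V : Set P} {κ : P → Q → Ω → ℝ}

theorem goodKer (h : SmoothKer ν V κ) {p : P} (hp : p ∈ V) : GoodKer ν (κ p) := by
  obtain ⟨G, hG, hG0, hb⟩ := h.bound 0
  refine ⟨h.meas p, G, hG, hG0, fun q z => ?_⟩
  simpa using hb p hp q z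

theorem differentiable (h : SmoothKer ν V κ) (q : Q) (z : Ω) :
    Differentiable ℝ (fun p => κ p q z) := (h.smooth q z).differentiable (by simp)

/-- Directional derivatives of a smooth kernel in the parameter form a smooth kernel. -/
theorem dirDeriv (h : SmoothKer ν V κ) (v : P) :
    SmoothKer ν V (fun p q z => fderiv ℝ (fun p => κ p q z) p v) where
  meas p := by
    refine measurable_of_tendsto_metrizable
      (f := fun (n : ℕ) (x : Q × Ω) => ((n : ℝ)) • (κ (p + ((n : ℝ))⁻¹ • v) x.1 x.2 - κ p x.1 x.2))
      (fun n => ?_) ?_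
    · simp only [smul_eq_mul]
      exact ((h.meas (p + ((n : ℝ))⁻¹ • v)).sub (h.meas p)).const_mul (n : ℝ)
    · rw [tendsto_pi_nhds]
      intro x
      refine (h.differentiable x.1 x.2 p).hasFDerivAt.lim v ?_
      exact tendsto_norm_atTop_atTop.comp tendsto_natCast_atTop_atTop
  smooth q z := by
    have := (h.smooth q z).fderiv_right (m := ((⊤ : ℕ∞) : WithTop ℕ∞)) (by simp)
    exact this.clm_apply contDiff_const
  bound m := by
    obtain ⟨G, hG, hG0, hb⟩ := h.bound (m + 1)
    refine ⟨fun z => ‖v‖ * G z, hG.const_mul _, fun z => mul_nonneg (norm_nonneg _) (hG0 z),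
      fun p hp q z => ?_⟩
    have hc := (h.smooth q z).fderiv_right (m := ((⊤ : ℕ∞) : WithTop ℕ∞)) (by simp)
    refine (norm_iteratedFDeriv_clm_apply_const (n := m) hc.contDiffAt
      (by exact_mod_cast le_top)).trans ?_
    rw [norm_iteratedFDeriv_fderiv]
    exact mul_le_mul_of_nonneg_left (hb p hp q z) (norm_nonneg _)

variable [SFinite ν] {Θ : Q × Ω → Q'} (hΘ : Measurable Θ)

/-- The derivative of the operator family defined by a smooth kernel. -/
theorem exists_deriv (h : SmoothKer ν V κ) {p : P} (hp : p ∈ V) :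
    ∃ L : P →L[ℝ] (BM Q' →L[ℝ] BM Q),
      ∀ v, L v = kerOp ν Θ hΘ (fun q z => fderiv ℝ (fun p => κ p q z) p v) := by
  obtain ⟨G, hG, hG0, hb⟩ := h.bound 1
  refine ⟨LinearMap.mkContinuous
    { toFun := fun v => kerOp ν Θ hΘ (fun q z => fderiv ℝ (fun p => κ p q z) p v)
      map_add' := fun v w => ?_
      map_smul' := fun c v => ?_ } (∫ z, G z ∂ν) fun v => ?_, fun v => rfl⟩
  · simp only [map_add]
    exact kerOp_add ((h.dirDeriv v).goodKer hp) ((h.dirDeriv w).goodKer hp)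
  · simp only [map_smul, smul_eq_mul]
    exact kerOp_const_mul ((h.dirDeriv v).goodKer hp) c
  · rw [← integral_mul_const]
    refine norm_kerOp_le (hΘ := hΘ) ((h.dirDeriv v).meas p) (hG.mul_const _)
      (fun z => mul_nonneg (hG0 z) (norm_nonneg v)) fun q z => ?_
    refine ((fderiv ℝ (fun p => κ p q z) p).le_opNorm v).trans ?_
    refine mul_le_mul_of_nonneg_right ?_ (norm_nonneg v)
    rw [← norm_iteratedFDeriv_one]
    exact hb p hp q z

theorem taylor_le {f : P → ℝ} (hf : ContDiff ℝ ((⊤ : ℕ∞) : WithTop ℕ∞) f) {C : ℝ} {p p' : P}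
    {r : ℝ} (hC : ∀ x ∈ Metric.ball p r, ‖iteratedFDeriv ℝ 2 f x‖ ≤ C)
    (hp' : p' ∈ Metric.ball p r) :
    |f p' - f p - fderiv ℝ f p (p' - p)| ≤ C * ‖p' - p‖ * ‖p' - p‖ := by
  have hd : Differentiable ℝ f := hf.differentiable (by simp)
  have hd2 : Differentiable ℝ (fderiv ℝ f) :=
    (hf.fderiv_right (m := ((⊤ : ℕ∞) : WithTop ℕ∞)) (by simp)).differentiable (by simp)
  have hp : p ∈ Metric.closedBall p ‖p' - p‖ := by simp
  have hp2 : p' ∈ Metric.closedBall p ‖p' - p‖ := by simp [dist_eq_norm]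
  have hsub : Metric.closedBall p ‖p' - p‖ ⊆ Metric.ball p r :=
    Metric.closedBall_subset_ball (by rwa [← dist_eq_norm, ← Metric.mem_ball])
  refine (convex_closedBall p ‖p' - p‖).norm_image_sub_le_of_norm_hasFDerivWithin_le'
    (fun x _ => (hd x).hasFDerivAt.hasFDerivWithinAt) (fun x hx => ?_) hp hp2
  have h2 := (convex_closedBall p ‖p' - p‖).norm_image_sub_le_of_norm_fderiv_le (𝕜 := ℝ)
    (f := fderiv ℝ f) (C := C) (fun x _ => hd2 x) (fun y hy => by
      rw [← norm_iteratedFDeriv_one, norm_iteratedFDeriv_fderiv]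
      exact hC y (hsub hy)) hp hx
  refine h2.trans (mul_le_mul_of_nonneg_left ?_ ?_)
  · simpa [dist_eq_norm] using hx
  · exact (norm_nonneg _).trans (hC p (hsub hp))

theorem hasFDerivAt_kerOp (h : SmoothKer ν V κ) (hV : IsOpen V) {p : P} (hp : p ∈ V)
    {L : P →L[ℝ] (BM Q' →L[ℝ] BM Q)}
    (hL : ∀ v, L v = kerOp ν Θ hΘ (fun q z => fderiv ℝ (fun p => κ p q z) p v)) :
    HasFDerivAt (fun p => kerOp ν Θ hΘ (κ p)) L p := by
  obtain ⟨G, hG, hG0, hb⟩ := h.bound 2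
  obtain ⟨r, hr, hball⟩ := Metric.isOpen_iff.1 hV p hp
  refine HasFDerivAt.of_isLittleO ?_
  have hO : (fun x' => kerOp ν Θ hΘ (κ x') - kerOp ν Θ hΘ (κ p) - L (x' - p))
      =O[𝓝 p] fun x' => ‖x' - p‖ * ‖x' - p‖ := by
    refine Asymptotics.IsBigO.of_bound (∫ z, G z ∂ν) ?_
    filter_upwards [Metric.ball_mem_nhds p hr] with x' hx'
    have hx'V := hball hx'
    have hg := h.goodKer hp
    have hg' := h.goodKer hx'V
    have hgd := (h.dirDeriv (x' - p)).goodKer hp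
    have hgs : GoodKer ν (fun q z => κ x' q z - κ p q z) := by
      simpa only [sub_eq_add_neg, neg_one_mul] using hg'.add (hg.const_mul (-1))
    rw [hL, ← kerOp_sub hg' hg, ← kerOp_sub hgs hgd, norm_mul, norm_norm, ← integral_mul_const]
    refine norm_kerOp_le (((h.meas _).sub (h.meas _)).sub ((h.dirDeriv _).meas _))
      (hG.mul_const _) (fun z => mul_nonneg (hG0 z) (by positivity)) fun q z => ?_
    rw [← mul_assoc]
    exact taylor_le (h.smooth q z) (fun x hx => hb x (hball hx) q z) hx'
  refine hO.trans_isLittleO ?_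
  have h1 : (fun x' : P => ‖x' - p‖) =o[𝓝 p] fun _ => (1 : ℝ) := by
    rw [Asymptotics.isLittleO_one_iff]
    have : Continuous fun x' : P => ‖x' - p‖ := by fun_prop
    simpa using this.tendsto p
  simpa using h1.mul_isBigO (Asymptotics.isBigO_norm_left.2
    (Asymptotics.isBigO_refl (fun x' : P => x' - p) (𝓝 p))).norm_right

/-- The operator family defined by a smooth kernel is smooth in operator norm. -/
theorem contDiffOn_kerOp [FiniteDimensional ℝ P] (h : SmoothKer ν V κ) (hV : IsOpen V) :
    ContDiffOn ℝ ((⊤ : ℕ∞) : WithTop ℕ∞) (fun p => kerOp ν Θ hΘ (κ p)) V := by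
  rw [contDiffOn_infty]
  intro m
  induction m generalizing κ with
  | zero =>
    rw [CharP.cast_eq_zero, contDiffOn_zero]
    intro p hp
    obtain ⟨L, hL⟩ := h.exists_deriv hΘ hp
    exact (h.hasFDerivAt_kerOp hΘ hV hp hL).continuousAt.continuousWithinAt
  | succ m ih =>
    rw [Nat.cast_succ, contDiffOn_succ_iff_fderiv_of_isOpen hV]
    refine ⟨fun p hp => ?_, by simp, ?_⟩
    · obtain ⟨L, hL⟩ := h.exists_deriv hΘ hp
      exact (h.hasFDerivAt_kerOp hΘ hV hp hL).differentiableAt.differentiableWithinAt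
    · rw [contDiffOn_clm_apply]
      intro v
      refine (ih (h.dirDeriv v)).congr fun p hp => ?_
      obtain ⟨L, hL⟩ := h.exists_deriv hΘ hp
      rw [(h.hasFDerivAt_kerOp hΘ hV hp hL).fderiv, hL]

end SmoothKer

end SmoothKernel

section GaussianKernel

theorem hasTemperateGrowth_fderiv {E F : Type*} [NormedAddCommGroup E] [NormedSpace ℝ E]
    [NormedAddCommGroup F] [NormedSpace ℝ F] {f : E → F} (hf : f.HasTemperateGrowth) :
    (fderiv ℝ f).HasTemperateGrowth := by
  refine ⟨hf.1.fderiv_right (by simp), fun m => ?_⟩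
  obtain ⟨k, C, h⟩ := hf.2 (m + 1)
  exact ⟨k, C, fun x => by rw [norm_iteratedFDeriv_fderiv]; exact h x⟩

/-- The exponent `-α²|η|²/4` of the Gaussian kernels. -/
def gaussExp (n : ℕ) (x : ℝ × Euc n) : ℝ := -(x.1 ^ 2 * ‖x.2‖ ^ 2 / 4)

theorem gaussExp_hasTemperateGrowth (n : ℕ) : (gaussExp n).HasTemperateGrowth := by
  have h1 : (fun x : ℝ × Euc n => x.1).HasTemperateGrowth :=
    (ContinuousLinearMap.fst ℝ ℝ (Euc n)).hasTemperateGrowth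
  have h2 : (fun x : ℝ × Euc n => x.2).HasTemperateGrowth :=
    (ContinuousLinearMap.snd ℝ ℝ (Euc n)).hasTemperateGrowth
  have h3 : (fun x : ℝ × Euc n => ‖x.2‖ ^ 2).HasTemperateGrowth := by
    convert (innerSL ℝ (E := Euc n)).bilinear_hasTemperateGrowth h2 h2 using 2 with x
    exact (real_inner_self_eq_norm_sq _).symm
  have h4 := ((h1.pow 2).mul h3).mul (Function.HasTemperateGrowth.const (-(1 / 4) : ℝ))
  refine Eq.mp (congrArg _ (funext fun x => ?_)) h4
  simp only [gaussExp, Pi.mul_apply, Pi.pow_apply]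
  ring

theorem exists_exp_le (j : ℕ) : ∃ C : ℝ, 0 ≤ C ∧ ∀ s : ℝ, 0 ≤ s →
    (1 + s) ^ j * Real.exp (-(s ^ 2 / 16)) ≤ C := by
  have hc : Continuous fun s : ℝ => (1 + s) ^ j * Real.exp (-(s ^ 2 / 16)) := by fun_prop
  have h1 : Tendsto (fun s : ℝ => (1 + s) ^ j * Real.exp (-(1 + s))) atTop (𝓝 0) :=
    (Real.tendsto_pow_mul_exp_neg_atTop_nhds_zero j).comp
      (tendsto_atTop_add_const_left _ 1 tendsto_id)
  have h2 : ∀ᶠ s : ℝ in atTop, (1 + s) ^ j * Real.exp (-(s ^ 2 / 16)) ≤ 1 := by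
    filter_upwards [h1.eventually (ge_mem_nhds (zero_lt_one)), eventually_ge_atTop (17 : ℝ)]
      with s hs hs'
    refine le_trans (mul_le_mul_of_nonneg_left (Real.exp_le_exp.2 ?_) (by positivity)) hs
    nlinarith
  obtain ⟨R, hR⟩ := eventually_atTop.1 h2
  obtain ⟨C, hC⟩ := (isCompact_Icc (a := (0 : ℝ)) (b := max R 0)).exists_bound_of_continuousOn
    hc.continuousOn
  refine ⟨max C 1, by positivity, fun s hs => ?_⟩
  rcases le_total R s with h | h
  · exact (hR s h).trans (le_max_right _ _)
  · exact ((le_abs_self _).trans (hC s ⟨hs, h.trans (le_max_left _ _)⟩)).trans (le_max_left _ _)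

theorem gauss_decay_zero (n : ℕ) {F : Type*} [NormedAddCommGroup F] [NormedSpace ℝ F]
    {M : ℝ × Euc n → F} (hM : M.HasTemperateGrowth) :
    ∃ C : ℝ, 0 ≤ C ∧ ∀ x : ℝ × Euc n, x.1 ∈ Set.Ioo (1 / 2 : ℝ) 2 →
      ‖Real.exp (gaussExp n x) • M x‖ ≤ C * ((1 + ‖x.2‖) ^ (n + 1))⁻¹ := by
  obtain ⟨k, C, h⟩ := hM.2 0
  obtain ⟨C', hC', h'⟩ := exists_exp_le (k + (n + 1))
  refine ⟨max C 0 * 3 ^ k * C', by positivity, fun x hx => ?_⟩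
  have hM0 : ‖M x‖ ≤ max C 0 * (3 ^ k * (1 + ‖x.2‖) ^ k) := by
    rw [← mul_pow]
    have h1 := h x
    rw [norm_iteratedFDeriv_zero] at h1
    refine h1.trans (mul_le_mul (le_max_left _ _) (pow_le_pow_left₀ (by positivity) ?_ _)
      (by positivity) (by positivity))
    have h3 : |x.1| ≤ 2 := abs_le.2 ⟨by linarith [hx.1], hx.2.le⟩
    have h2 : ‖x‖ ≤ 2 + ‖x.2‖ := by
      rw [Prod.norm_def]
      exact max_le (by rw [Real.norm_eq_abs]; linarith [norm_nonneg x.2]) (by linarith)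
    linarith [norm_nonneg x.2]
  have hE : Real.exp (gaussExp n x) ≤ Real.exp (-(‖x.2‖ ^ 2 / 16)) := by
    refine Real.exp_le_exp.2 ?_
    rw [gaussExp]
    have : (1 / 4 : ℝ) ≤ x.1 ^ 2 := by nlinarith [hx.1]
    nlinarith [mul_le_mul_of_nonneg_right this (sq_nonneg ‖x.2‖)]
  rw [norm_smul, Real.norm_eq_abs, abs_of_pos (Real.exp_pos _)]
  have hfin := h' ‖x.2‖ (norm_nonneg _)
  rw [le_mul_inv_iff₀ (by positivity)]
  calc Real.exp (gaussExp n x) * ‖M x‖ * (1 + ‖x.2‖) ^ (n + 1)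
      ≤ Real.exp (-(‖x.2‖ ^ 2 / 16)) * (max C 0 * (3 ^ k * (1 + ‖x.2‖) ^ k))
          * (1 + ‖x.2‖) ^ (n + 1) := by gcongr
    _ = max C 0 * 3 ^ k * ((1 + ‖x.2‖) ^ (k + (n + 1)) * Real.exp (-(‖x.2‖ ^ 2 / 16))) := by ring
    _ ≤ _ := by gcongr

theorem contDiff_gauss (n : ℕ) {F : Type*} [NormedAddCommGroup F] [NormedSpace ℝ F]
    {M : ℝ × Euc n → F} (hM : M.HasTemperateGrowth) :
    ContDiff ℝ ((⊤ : ℕ∞) : WithTop ℕ∞) (fun x => Real.exp (gaussExp n x) • M x) :=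
  (gaussExp_hasTemperateGrowth n).1.exp.smul hM.1

theorem gauss_decay (n m : ℕ) {F : Type} [NormedAddCommGroup F] [NormedSpace ℝ F]
    {M : ℝ × Euc n → F} (hM : M.HasTemperateGrowth) :
    ∃ C : ℝ, 0 ≤ C ∧ ∀ x : ℝ × Euc n, x.1 ∈ Set.Ioo (1 / 2 : ℝ) 2 →
      ‖iteratedFDeriv ℝ m (fun x => Real.exp (gaussExp n x) • M x) x‖
        ≤ C * ((1 + ‖x.2‖) ^ (n + 1))⁻¹ := by
  induction m generalizing F with
  | zero => simpa only [norm_iteratedFDeriv_zero] using gauss_decay_zero n hM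
  | succ m ih =>
    have hφ := gaussExp_hasTemperateGrowth n
    have hT := ((ContinuousLinearMap.smulRightL ℝ (ℝ × Euc n) F).bilinear_hasTemperateGrowth
      (hasTemperateGrowth_fderiv hφ) hM).add (hasTemperateGrowth_fderiv hM)
    have hd : fderiv ℝ (fun x => Real.exp (gaussExp n x) • M x) =
        fun x => Real.exp (gaussExp n x) • (((fun x => ContinuousLinearMap.smulRightL ℝ (ℝ × Euc n) F
          (fderiv ℝ (gaussExp n) x) (M x)) + fderiv ℝ M) x) := by
      ext1 x
      have h1 : DifferentiableAt ℝ (gaussExp n) x := (hφ.1.differentiable (by simp)) x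
      have h2 : DifferentiableAt ℝ M x := (hM.1.differentiable (by simp)) x
      rw [fderiv_fun_smul h1.exp h2, fderiv_exp h1]
      refine ContinuousLinearMap.ext fun v => ?_
      simp [smul_smul, add_comm]
    obtain ⟨C, hC, h⟩ := ih hT
    refine ⟨C, hC, fun x hx => ?_⟩
    rw [← norm_iteratedFDeriv_fderiv, hd]
    exact h x hx

theorem integrable_japanese (n : ℕ) :
    Integrable (fun ξ : Euc n => ((1 + ‖ξ‖) ^ (n + 1))⁻¹) := by
  have h := integrable_one_add_norm (E := Euc n) (μ := volume) (r := (n : ℝ) + 1) (by simp)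
  refine h.congr (ae_of_all _ fun ξ => ?_)
  simp only
  rw [rpow_neg (by positivity), ← Real.rpow_natCast]
  simp

theorem japanese_shift_le (n : ℕ) {ξ h : Euc n} {b : ℝ} (hb : |b| ≤ 1) (hh : ‖h‖ ≤ 1) :
    ((1 + ‖ξ + b • h‖) ^ (n + 1))⁻¹ ≤ 2 ^ (n + 1) * ((1 + ‖ξ‖) ^ (n + 1))⁻¹ := by
  rw [← inv_inv ((2 : ℝ) ^ (n + 1)), ← mul_inv]
  refine inv_anti₀ (by positivity) ?_
  rw [inv_mul_le_iff₀ (by positivity), ← mul_pow]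
  refine pow_le_pow_left₀ (by positivity) ?_ _
  have h1 : ‖ξ‖ ≤ ‖ξ + b • h‖ + ‖b • h‖ := by
    simpa using norm_sub_le (ξ + b • h) (b • h)
  have h2 : ‖b • h‖ ≤ 1 := by
    rw [norm_smul]
    exact mul_le_one₀ hb (norm_nonneg _) hh
  linarith [norm_nonneg (ξ + b • h)]

theorem norm_iteratedFDeriv_comp_affine_le {E F G : Type*} [NormedAddCommGroup E] [NormedSpace ℝ E]
    [NormedAddCommGroup F] [NormedSpace ℝ F] [NormedAddCommGroup G] [NormedSpace ℝ G]
    {f : F → G} (hf : ContDiff ℝ ((⊤ : ℕ∞) : WithTop ℕ∞) f) (L : E →L[ℝ] F) (c : F) (m : ℕ) (p : E) :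
    ‖iteratedFDeriv ℝ m (fun p => f (L p + c)) p‖ ≤ ‖iteratedFDeriv ℝ m f (L p + c)‖ * ‖L‖ ^ m := by
  have hf' : ContDiff ℝ ((⊤ : ℕ∞) : WithTop ℕ∞) (fun x => f (x + c)) :=
    hf.comp (contDiff_id.add contDiff_const)
  have := L.iteratedFDeriv_comp_right hf' p (i := m) (by exact_mod_cast le_top)
  have h2 : (fun p => f (L p + c)) = (fun x => f (x + c)) ∘ L := rfl
  rw [h2, this, iteratedFDeriv_comp_add_right]
  refine (ContinuousMultilinearMap.norm_compContinuousLinearMap_le _ _).trans ?_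
  simp

variable {Q Z : Type*} [MeasurableSpace Q] [MeasurableSpace Z]

/-- Parameter domain of the Gaussian kernels. -/
def parDom (n : ℕ) : Set (Euc n × ℝ) := Metric.ball 0 1 ×ˢ Set.Ioo (1 / 2) 2

theorem isOpen_parDom (n : ℕ) : IsOpen (parDom n) := Metric.isOpen_ball.prod isOpen_Ioo

/-- The Gaussian kernel with amplitude `M`, weight `W` and shift coefficient `b`. -/
def gaussKer (n : ℕ) (M : ℝ × Euc n → ℝ) (W b : Q → Z → ℝ) (p : Euc n × ℝ) (q : Q)
    (z : Z × Euc n) : ℝ :=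
  W q z.1 * (Real.exp (gaussExp n (p.2, z.2 + b q z.1 • p.1)) * M (p.2, z.2 + b q z.1 • p.1))

theorem gaussKer_smoothKer (n : ℕ) {M : ℝ × Euc n → ℝ} (hM : M.HasTemperateGrowth)
    {ζ : Measure Z} [SFinite ζ] {W b : Q → Z → ℝ} (hW : Measurable (Function.uncurry W))
    (hb : Measurable (Function.uncurry b)) (hb1 : ∀ q z, |b q z| ≤ 1) {W₀ : Z → ℝ}
    (hW₀ : Integrable W₀ ζ) (hle : ∀ q z, |W q z| ≤ W₀ z) :
    SmoothKer (ζ.prod volume) (parDom n) (gaussKer n M W b) where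
  meas p := by
    have hc : Measurable fun x => Real.exp (gaussExp n x) * M x :=
      (contDiff_gauss n hM).continuous.measurable
    have hq : Measurable fun x : Q × (Z × Euc n) => (x.1, x.2.1) := by fun_prop
    have h1 : Measurable fun x : Q × (Z × Euc n) => (p.2, x.2.2 + b x.1 x.2.1 • p.1) :=
      measurable_const.prodMk (measurable_snd.snd.add ((hb.comp hq).smul_const p.1))
    exact (hW.comp hq).mul (hc.comp h1)
  smooth q z := by
    refine contDiff_const.mul ((contDiff_gauss n hM).comp ?_)
    fun_prop
  bound m := by
    obtain ⟨C, hC, h⟩ := gauss_decay n m hM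
    refine ⟨fun z => max (W₀ z.1) 0 * (C * 2 ^ (n + 1) * ((1 + ‖z.2‖) ^ (n + 1))⁻¹),
      (hW₀.pos_part).mul_prod ((integrable_japanese n).const_mul _), fun z => by positivity,
      fun p hp q z => ?_⟩
    have hp1 : ‖p.1‖ ≤ 1 := by simpa using (Metric.mem_ball.1 hp.1).le
    let L : Euc n × ℝ →L[ℝ] ℝ × Euc n := (ContinuousLinearMap.snd ℝ (Euc n) ℝ).prod
      (b q z.1 • ContinuousLinearMap.fst ℝ (Euc n) ℝ)
    have hL : ‖L‖ ≤ 1 := by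
      refine ContinuousLinearMap.opNorm_le_bound _ zero_le_one fun v => ?_
      rw [one_mul]
      refine max_le (norm_snd_le v) ?_
      change ‖b q z.1 • v.1‖ ≤ ‖v‖
      rw [norm_smul]
      exact (mul_le_of_le_one_left (norm_nonneg _) (hb1 q z.1)).trans (norm_fst_le v)
    have hLp : ∀ p : Euc n × ℝ, (p.2, z.2 + b q z.1 • p.1) = L p + (0, z.2) := fun p =>
      Prod.ext (add_zero _).symm (add_comm _ _)
    have hf := contDiff_gauss n hM
    have hfun : (fun p => gaussKer n M W b p q z) = fun p => W q z.1 •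
        (fun x => Real.exp (gaussExp n x) • M x) (L p + (0, z.2)) := by
      ext p
      simp only [gaussKer, hLp, smul_eq_mul]
    have hfL : ContDiff ℝ ((⊤ : ℕ∞) : WithTop ℕ∞)
        (fun p => (fun x => Real.exp (gaussExp n x) • M x) (L p + (0, z.2))) :=
      hf.comp (L.contDiff.add contDiff_const)
    rw [hfun, iteratedFDeriv_const_smul_apply' (hfL.contDiffAt.of_le (by exact_mod_cast le_top)),
      norm_smul, Real.norm_eq_abs]
    refine mul_le_mul ((hle q z.1).trans (le_max_left _ _)) ?_ (norm_nonneg _) (by positivity)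
    refine (norm_iteratedFDeriv_comp_affine_le hf L (0, z.2) m p).trans ?_
    rw [← hLp]
    refine (mul_le_of_le_one_right (norm_nonneg _) (pow_le_one₀ (norm_nonneg _) hL)).trans ?_
    refine (h _ hp.2).trans ?_
    rw [mul_assoc]
    exact mul_le_mul_of_nonneg_left (japanese_shift_le n (hb1 q z.1) hp1) hC

end GaussianKernel

section Volterra

theorem norm_gaussKer_le (n : ℕ) {M : ℝ × Euc n → ℝ} (hM : M.HasTemperateGrowth) :
    ∃ C : ℝ, 0 ≤ C ∧ ∀ {Q Z : Type} {W b : Q → Z → ℝ} {W₀ : Z → ℝ},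
      (∀ q z, |b q z| ≤ 1) → (∀ q z, |W q z| ≤ W₀ z) → ∀ p ∈ parDom n, ∀ q z,
        |gaussKer n M W b p q z| ≤ W₀ z.1 * (C * ((1 + ‖z.2‖) ^ (n + 1))⁻¹) := by
  obtain ⟨C, hC, h⟩ := gauss_decay_zero n hM
  refine ⟨C * 2 ^ (n + 1), by positivity, fun {Q Z W b W₀} hb hW p hp q z => ?_⟩
  have hp1 : ‖p.1‖ ≤ 1 := by simpa using (Metric.mem_ball.1 hp.1).le
  rw [gaussKer, abs_mul]
  refine mul_le_mul (hW q z.1) ?_ (abs_nonneg _) ((abs_nonneg _).trans (hW q z.1))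
  refine (h (p.2, z.2 + b q z.1 • p.1) hp.2).trans ?_
  rw [mul_assoc]
  exact mul_le_mul_of_nonneg_left (japanese_shift_le n (hb q z.1) hp1) hC

/-- The space-time set on which the Duhamel weights do not vanish. -/
def duhSet : Set (ℝ × (ℝ × ℝ)) := Set.Ioo 0 1 ×ˢ (Set.Ioo 0 1 ×ˢ Set.Ioi 1)

theorem measurableSet_duhSet : MeasurableSet duhSet :=
  measurableSet_Ioo.prod (measurableSet_Ioo.prod measurableSet_Ioi)

/-- The weight of the Duhamel operator, with an exponential damping of rate `Λ`. -/
def duhWeight (n : ℕ) (Λ : ℝ) (q : Euc n × ℝ) (z : ℝ × ℝ) : ℝ :=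
  duhSet.indicator (fun y => √y.1 * y.2.1 ^ (-(1 / 2) : ℝ) * y.2.2 ^ (-(3 / 2) : ℝ) *
    Real.exp (-(Λ * (y.1 * y.2.1)))) (q.2, z)

/-- The shift coefficient of the Duhamel operator. -/
def duhShift (n : ℕ) (q : Euc n × ℝ) (z : ℝ × ℝ) : ℝ :=
  duhSet.indicator (fun y => √(y.2.1 * y.1 / y.2.2)) (q.2, z)

/-- The point of space-time at which the Duhamel operator evaluates its argument. -/
def duhPoint (n : ℕ) (y : (Euc n × ℝ) × ((ℝ × ℝ) × Euc n)) : Euc n × ℝ :=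
  (y.1.1 - √(y.2.1.1 * y.2.1.2 * y.1.2) • y.2.2, y.1.2 * (1 - y.2.1.1))

theorem measurable_duhPoint (n : ℕ) : Measurable (duhPoint n) := by
  unfold duhPoint
  fun_prop

theorem measurable_duhWeight (n : ℕ) (Λ : ℝ) : Measurable (Function.uncurry (duhWeight n Λ)) := by
  refine (Measurable.indicator ?_ measurableSet_duhSet).comp
    (g := duhSet.indicator (fun y => √y.1 * y.2.1 ^ (-(1 / 2) : ℝ) * y.2.2 ^ (-(3 / 2) : ℝ) *
    Real.exp (-(Λ * (y.1 * y.2.1)))))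
    (f := fun y : (Euc n × ℝ) × (ℝ × ℝ) => (y.1.2, y.2)) (by fun_prop)
  fun_prop

theorem measurable_duhShift (n : ℕ) : Measurable (Function.uncurry (duhShift n)) := by
  refine (Measurable.indicator ?_ measurableSet_duhSet).comp
    (g := duhSet.indicator (fun y => √(y.2.1 * y.1 / y.2.2)))
    (f := fun y : (Euc n × ℝ) × (ℝ × ℝ) => (y.1.2, y.2)) (by fun_prop)
  fun_prop

theorem abs_duhShift_le (n : ℕ) (q : Euc n × ℝ) (z : ℝ × ℝ) : |duhShift n q z| ≤ 1 := by
  rw [duhShift, Set.indicator]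
  split_ifs with h
  · obtain ⟨⟨h1, h2⟩, ⟨h3, h4⟩, h5⟩ := h
    simp only [Set.mem_Ioi] at *
    rw [abs_of_nonneg (Real.sqrt_nonneg _)]
    refine Real.sqrt_le_one.2 ((div_le_one (by linarith)).2 ?_)
    nlinarith
  · simp

/-- The dominating weight `λ^{-3/4} ρ^{-3/2}` on `(0,1) × (1,∞)`. -/
def domWeight (z : ℝ × ℝ) : ℝ :=
  (Set.Ioo (0 : ℝ) 1).indicator (fun x => x ^ (-(3 / 4) : ℝ)) z.1 *
    (Set.Ioi (1 : ℝ)).indicator (fun x => x ^ (-(3 / 2) : ℝ)) z.2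

theorem integrable_domWeight : Integrable domWeight := by
  refine Integrable.mul_prod (μ := volume) (ν := volume) ?_ ?_
  · rw [integrable_indicator_iff measurableSet_Ioo, ← integrableOn_Ioc_iff_integrableOn_Ioo,
      ← intervalIntegrable_iff_integrableOn_Ioc_of_le zero_le_one]
    exact intervalIntegral.intervalIntegrable_rpow' (by norm_num)
  · rw [integrable_indicator_iff measurableSet_Ioi]
    exact integrableOn_Ioi_rpow_of_lt (by norm_num) one_pos

theorem domWeight_nonneg (z : ℝ × ℝ) : 0 ≤ domWeight z :=
  mul_nonneg (Set.indicator_nonneg (fun _ hx => Real.rpow_nonneg hx.1.le _) _)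
    (Set.indicator_nonneg (fun _ hx => Real.rpow_nonneg (zero_le_one.trans (le_of_lt hx)) _) _)

theorem abs_duhWeight_le (n : ℕ) {Λ : ℝ} (hΛ : 0 < Λ) (q : Euc n × ℝ) (z : ℝ × ℝ) :
    |duhWeight n Λ q z| ≤ Λ ^ (-(1 / 4) : ℝ) * domWeight z := by
  by_cases h : (q.2, z) ∈ duhSet
  · rw [duhWeight, Set.indicator_of_mem h]
    obtain ⟨⟨h1, h2⟩, h3, h4⟩ := h
    rw [domWeight, Set.indicator_of_mem h3,
      Set.indicator_of_mem h4]
    simp only [Set.mem_Ioi] at h1 h2 h3 h4 ⊢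
    have hz1 : 0 < z.1 := h3.1
    have hz2 : 0 < z.2 := zero_lt_one.trans h4
    rw [abs_of_nonneg (by positivity)]
    have hx : 0 < Λ * (q.2 * z.1) := by positivity
    have he : Real.exp (-(Λ * (q.2 * z.1))) ≤ (Λ * (q.2 * z.1)) ^ (-(1 / 4) : ℝ) := by
      rw [Real.rpow_neg hx.le, Real.exp_neg]
      refine inv_anti₀ (by positivity) ?_
      rcases le_total (Λ * (q.2 * z.1)) 1 with h | h
      · exact (Real.rpow_le_one hx.le h (by norm_num)).trans (Real.one_le_exp hx.le)
      · refine (Real.rpow_le_rpow_of_exponent_le h (by norm_num : (1 / 4 : ℝ) ≤ 1)).trans ?_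
        rw [Real.rpow_one]
        linarith [Real.add_one_le_exp (Λ * (q.2 * z.1))]
    have hq : √q.2 * q.2 ^ (-(1 / 4) : ℝ) ≤ 1 := by
      rw [Real.sqrt_eq_rpow, ← Real.rpow_add h1]
      exact Real.rpow_le_one h1.le h2.le (by norm_num)
    have hl : z.1 ^ (-(1 / 2) : ℝ) * z.1 ^ (-(1 / 4) : ℝ) = z.1 ^ (-(3 / 4) : ℝ) := by
      rw [← Real.rpow_add hz1]
      norm_num
    calc √q.2 * z.1 ^ (-(1 / 2) : ℝ) * z.2 ^ (-(3 / 2) : ℝ) * Real.exp (-(Λ * (q.2 * z.1)))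
        ≤ √q.2 * z.1 ^ (-(1 / 2) : ℝ) * z.2 ^ (-(3 / 2) : ℝ) *
          (Λ * (q.2 * z.1)) ^ (-(1 / 4) : ℝ) := by gcongr
      _ = (√q.2 * q.2 ^ (-(1 / 4) : ℝ)) * (Λ ^ (-(1 / 4) : ℝ) *
          ((z.1 ^ (-(1 / 2) : ℝ) * z.1 ^ (-(1 / 4) : ℝ)) * z.2 ^ (-(3 / 2) : ℝ))) := by
          rw [Real.mul_rpow hΛ.le (by positivity), Real.mul_rpow h1.le hz1.le]
          ring
      _ ≤ _ := by
          rw [hl]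
          exact mul_le_of_le_one_left (by positivity) hq
  · rw [duhWeight, Set.indicator_of_notMem h, abs_zero]
    exact mul_nonneg (by positivity) (domWeight_nonneg z)

theorem abs_duhWeight_zero_le (n : ℕ) (q : Euc n × ℝ) (z : ℝ × ℝ) :
    |duhWeight n 0 q z| ≤ domWeight z := by
  by_cases h : (q.2, z) ∈ duhSet
  · rw [duhWeight, Set.indicator_of_mem h]
    obtain ⟨⟨h1, h2⟩, h3, h4⟩ := h
    rw [domWeight, Set.indicator_of_mem h3,
      Set.indicator_of_mem h4]
    simp only [Set.mem_Ioi] at h1 h2 h3 h4 ⊢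
    have hz1 : 0 < z.1 := h3.1
    have hz2 : 0 < z.2 := zero_lt_one.trans h4
    rw [abs_of_nonneg (by positivity)]
    simp only [zero_mul, neg_zero, Real.exp_zero, mul_one]
    gcongr ?_ * _
    refine (mul_le_of_le_one_left (by positivity) (Real.sqrt_le_one.2 h2.le)).trans ?_
    exact Real.rpow_le_rpow_of_exponent_ge hz1 h3.2.le (by norm_num)
  · rw [duhWeight, Set.indicator_of_notMem h, abs_zero]
    exact domWeight_nonneg z

variable {n : ℕ}

/-- The Duhamel operator with amplitude `M` and damping rate `Λ`. -/
def duhOp (M : ℝ × Euc n → ℝ) (Λ : ℝ) (p : Euc n × ℝ) : BM (Euc n × ℝ) →L[ℝ] BM (Euc n × ℝ) :=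
  kerOp ((volume : Measure (ℝ × ℝ)).prod (volume : Measure (Euc n))) (duhPoint n)
    (measurable_duhPoint n) (gaussKer n M (duhWeight n Λ) (duhShift n) p)

theorem smoothKer_duh {M : ℝ × Euc n → ℝ} (hM : M.HasTemperateGrowth) :
    SmoothKer ((volume : Measure (ℝ × ℝ)).prod (volume : Measure (Euc n))) (parDom n)
      (gaussKer n M (duhWeight n 0) (duhShift n)) :=
  gaussKer_smoothKer n hM (measurable_duhWeight n 0) (measurable_duhShift n) (abs_duhShift_le n)
    integrable_domWeight (abs_duhWeight_zero_le n)

theorem smoothKer_duh_pos {M : ℝ × Euc n → ℝ} (hM : M.HasTemperateGrowth) {Λ : ℝ} (hΛ : 0 < Λ) :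
    SmoothKer ((volume : Measure (ℝ × ℝ)).prod (volume : Measure (Euc n))) (parDom n)
      (gaussKer n M (duhWeight n Λ) (duhShift n)) :=
  gaussKer_smoothKer n hM (measurable_duhWeight n Λ) (measurable_duhShift n) (abs_duhShift_le n)
    (integrable_domWeight.const_mul _) (abs_duhWeight_le n hΛ)

theorem contDiffOn_duhOp {M : ℝ × Euc n → ℝ} (hM : M.HasTemperateGrowth) :
    ContDiffOn ℝ ((⊤ : ℕ∞) : WithTop ℕ∞) (duhOp M 0) (parDom n) :=
  (smoothKer_duh hM).contDiffOn_kerOp (measurable_duhPoint n) (isOpen_parDom n)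

theorem norm_duhOp_le {M : ℝ × Euc n → ℝ} (hM : M.HasTemperateGrowth) :
    ∃ C : ℝ, 0 ≤ C ∧ ∀ Λ : ℝ, 0 < Λ → ∀ p ∈ parDom n, ‖duhOp M Λ p‖ ≤ C * Λ ^ (-(1 / 4) : ℝ) := by
  obtain ⟨C, hC, h⟩ := norm_gaussKer_le n hM
  refine ⟨∫ z : (ℝ × ℝ) × Euc n, domWeight z.1 * (C * ((1 + ‖z.2‖) ^ (n + 1))⁻¹),
    integral_nonneg fun z => mul_nonneg (domWeight_nonneg _) (by positivity),
    fun Λ hΛ p hp => ?_⟩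
  rw [← integral_mul_const]
  refine norm_kerOp_le ((smoothKer_duh_pos hM hΛ).meas p) ?_ ?_ fun q z => ?_
  · exact (integrable_domWeight.mul_prod ((integrable_japanese n).const_mul C)).mul_const _
  · exact fun z => mul_nonneg (mul_nonneg (domWeight_nonneg _) (by positivity)) (by positivity)
  · refine (h (abs_duhShift_le n) (abs_duhWeight_le n hΛ) p hp q z).trans_eq ?_
    ring

/-- The multiplier `exp (Λ τ)`, with `τ` truncated to `[0,1]`. -/
def expMul (n : ℕ) (Λ : ℝ) : BM (Euc n × ℝ) :=
  BM.mk' (fun q => Real.exp (Λ * max 0 (min q.2 1))) (by fun_prop) (Real.exp |Λ|) fun q => by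
    rw [abs_of_pos (Real.exp_pos _)]
    refine Real.exp_le_exp.2 ((le_abs_self _).trans ?_)
    rw [abs_mul]
    refine mul_le_of_le_one_right (abs_nonneg _) ?_
    rw [abs_of_nonneg (le_max_left _ _)]
    exact max_le zero_le_one (min_le_right _ _)

theorem expMul_mul_neg (n : ℕ) (Λ : ℝ) : expMul n Λ * expMul n (-Λ) = 1 := by
  ext q
  simp only [expMul, BM.mul_fn, BM.mk'_fn, BM.one_fn, ← Real.exp_add]
  simp

theorem duhOp_conj {M : ℝ × Euc n → ℝ} (hM : M.HasTemperateGrowth) {Λ : ℝ} (hΛ : 0 < Λ)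
    {p : Euc n × ℝ} (hp : p ∈ parDom n) (f : BM (Euc n × ℝ)) :
    duhOp M 0 p (expMul n Λ * f) = expMul n Λ * duhOp M Λ p f := by
  ext q
  rw [duhOp, kerOp_fn ((smoothKer_duh hM).goodKer hp), BM.mul_fn, duhOp,
    kerOp_fn ((smoothKer_duh_pos hM hΛ).goodKer hp), ← integral_const_mul]
  refine integral_congr_ae (ae_of_all _ fun z => ?_)
  simp only [gaussKer, duhWeight, BM.mul_fn]
  by_cases h : (q.2, z.1) ∈ duhSet
  · rw [Set.indicator_of_mem h, Set.indicator_of_mem h]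
    obtain ⟨⟨h1, h2⟩, ⟨h3, h4⟩, -⟩ := h
    simp only at h1 h2 h3 h4 ⊢
    have e1 : (expMul n Λ).fn (duhPoint n (q, z)) = Real.exp (Λ * (q.2 * (1 - z.1.1))) := by
      simp only [expMul, BM.mk'_fn, duhPoint]
      rw [min_eq_left (by nlinarith), max_eq_right (by nlinarith)]
    have e2 : (expMul n Λ).fn q = Real.exp (Λ * q.2) := by
      simp only [expMul, BM.mk'_fn]
      rw [min_eq_left (by nlinarith), max_eq_right (by nlinarith)]
    have e3 : Real.exp (Λ * (q.2 * (1 - z.1.1))) =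
        Real.exp (Λ * q.2) * Real.exp (-(Λ * (q.2 * z.1.1))) := by
      rw [← Real.exp_add]
      ring_nf
    rw [e1, e2, e3]
    simp only [zero_mul, neg_zero, Real.exp_zero]
    ring
  · rw [Set.indicator_of_notMem h, Set.indicator_of_notMem h]
    ring

end Volterra

section FixedPoint

variable {n : ℕ}

/-- The weight of the heat operator: the indicator of `0 < τ < 1`. -/
def heatWeight (n : ℕ) (q : Euc n × ℝ) (_ : Unit) : ℝ :=
  (Set.Ioo (0 : ℝ) 1).indicator (fun _ => 1) q.2

/-- The shift coefficient of the heat operator. -/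
def heatShift (n : ℕ) (q : Euc n × ℝ) (_ : Unit) : ℝ :=
  (Set.Ioo (0 : ℝ) 1).indicator (fun τ => √τ) q.2

/-- The point of space at which the heat operator evaluates its argument. -/
def heatPoint (n : ℕ) (y : (Euc n × ℝ) × (Unit × Euc n)) : Euc n := y.1.1 - √y.1.2 • y.2.2

theorem measurable_heatPoint (n : ℕ) : Measurable (heatPoint n) := by
  unfold heatPoint
  fun_prop

/-- The amplitude of the heat kernel. -/
def heatAmp (n : ℕ) (x : ℝ × Euc n) : ℝ := (4 * π) ^ (-(n : ℝ) / 2) * x.1 ^ n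

theorem heatAmp_hasTemperateGrowth (n : ℕ) : (heatAmp n).HasTemperateGrowth :=
  (Function.HasTemperateGrowth.const _).mul
    ((ContinuousLinearMap.fst ℝ ℝ (Euc n)).hasTemperateGrowth.pow n)

theorem smoothKer_heat (n : ℕ) :
    SmoothKer ((Measure.dirac ()).prod (volume : Measure (Euc n))) (parDom n)
      (gaussKer n (heatAmp n) (heatWeight n) (heatShift n)) := by
  refine gaussKer_smoothKer n (heatAmp_hasTemperateGrowth n) (W₀ := fun _ => 1) ?_ ?_
    (fun q z => ?_) (integrable_const _) fun q z => ?_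
  · exact (measurable_const.indicator measurableSet_Ioo).comp measurable_fst.snd
  · exact (Measurable.indicator (f := fun τ : ℝ => √τ) (by fun_prop) measurableSet_Ioo).comp
      measurable_fst.snd
  · rw [heatShift, Set.indicator]
    split_ifs with h
    · rw [abs_of_nonneg (Real.sqrt_nonneg _)]
      exact Real.sqrt_le_one.2 h.2.le
    · simp
  · rw [heatWeight, Set.indicator]
    split_ifs <;> simp

/-- The rescaled heat semigroup. -/
def heatOp (p : Euc n × ℝ) : BM (Euc n) →L[ℝ] BM (Euc n × ℝ) :=
  kerOp ((Measure.dirac ()).prod (volume : Measure (Euc n))) (heatPoint n) (measurable_heatPoint n)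
    (gaussKer n (heatAmp n) (heatWeight n) (heatShift n) p)

theorem contDiffOn_heatOp :
    ContDiffOn ℝ ((⊤ : ℕ∞) : WithTop ℕ∞) (heatOp (n := n)) (parDom n) :=
  (smoothKer_heat n).contDiffOn_kerOp (measurable_heatPoint n) (isOpen_parDom n)

/-- Vector fields on space-time with bounded measurable components. -/
abbrev VF (n : ℕ) : Type := Fin n → BM (Euc n × ℝ)

/-- Multiplication of a vector field by a function. -/
def mulVF (g : BM (Euc n × ℝ)) : VF n →L[ℝ] VF n :=
  ContinuousLinearMap.pi fun i =>
    (ContinuousLinearMap.mul ℝ (BM (Euc n × ℝ)) g).comp (ContinuousLinearMap.proj i)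

@[simp] theorem mulVF_apply (g : BM (Euc n × ℝ)) (d : VF n) (i : Fin n) :
    mulVF g d i = g * d i := rfl

/-- The linearised Duhamel operator. -/
def linDuh (M : Fin n → Fin n → Fin n → ℝ × Euc n → ℝ) (Λ : ℝ) (p : Euc n × ℝ)
    (m : BM (Euc n × ℝ)) (a b : VF n) : VF n →L[ℝ] VF n :=
  ContinuousLinearMap.pi fun i => ∑ j, ∑ k,
    (ContinuousLinearMap.mul ℝ (BM (Euc n × ℝ)) m).comp ((duhOp (M i j k) Λ p).comp
      ((ContinuousLinearMap.mul ℝ (BM (Euc n × ℝ)) (a k)).comp (ContinuousLinearMap.proj j) +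
        (ContinuousLinearMap.mul ℝ (BM (Euc n × ℝ)) (b j)).comp (ContinuousLinearMap.proj k)))

theorem linDuh_apply (M : Fin n → Fin n → Fin n → ℝ × Euc n → ℝ) (Λ : ℝ) (p : Euc n × ℝ)
    (m : BM (Euc n × ℝ)) (a b d : VF n) (i : Fin n) :
    linDuh M Λ p m a b d i =
      ∑ j, ∑ k, m * duhOp (M i j k) Λ p (a k * d j + b j * d k) := by
  simp [linDuh, mul_add]

variable {M : Fin n → Fin n → Fin n → ℝ × Euc n → ℝ}

theorem linDuh_conj (hM : ∀ i j k, (M i j k).HasTemperateGrowth) {Λ : ℝ} (hΛ : 0 < Λ)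
    {p : Euc n × ℝ} (hp : p ∈ parDom n) (m : BM (Euc n × ℝ)) (a b d : VF n) :
    linDuh M 0 p m a b (mulVF (expMul n Λ) d) = mulVF (expMul n Λ) (linDuh M Λ p m a b d) := by
  ext1 i
  rw [mulVF_apply, linDuh_apply, linDuh_apply, Finset.mul_sum]
  refine Finset.sum_congr rfl fun j _ => ?_
  rw [Finset.mul_sum]
  refine Finset.sum_congr rfl fun k _ => ?_
  rw [mul_left_comm, ← duhOp_conj (hM i j k) hΛ hp]
  congr 2
  simp only [mulVF_apply]
  ring

theorem norm_linDuh_le {Λ : ℝ} {p : Euc n × ℝ} {c : ℝ} (hc : 0 ≤ c)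
    (h : ∀ i j k, ‖duhOp (M i j k) Λ p‖ ≤ c) (m : BM (Euc n × ℝ)) (a b : VF n) :
    ‖linDuh M Λ p m a b‖ ≤ n * (n * (‖m‖ * (c * (‖a‖ + ‖b‖)))) := by
  refine ContinuousLinearMap.opNorm_le_bound _ (by positivity) fun d => ?_
  rw [pi_norm_le_iff_of_nonneg (by positivity)]
  intro i
  rw [linDuh_apply]
  have hjk : ∀ j k, ‖m * duhOp (M i j k) Λ p (a k * d j + b j * d k)‖ ≤
      ‖m‖ * (c * (‖a‖ + ‖b‖)) * ‖d‖ := by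
    intro j k
    refine (norm_mul_le _ _).trans ?_
    rw [mul_assoc, mul_assoc]
    refine mul_le_mul_of_nonneg_left ?_ (norm_nonneg _)
    refine ((duhOp (M i j k) Λ p).le_opNorm _).trans ?_
    refine mul_le_mul (h i j k) ?_ (norm_nonneg _) hc
    rw [add_mul]
    refine (norm_add_le _ _).trans (add_le_add ((norm_mul_le _ _).trans ?_)
      ((norm_mul_le _ _).trans ?_))
    · exact mul_le_mul (norm_le_pi_norm a k) (norm_le_pi_norm d j) (norm_nonneg _) (norm_nonneg _)
    · exact mul_le_mul (norm_le_pi_norm b j) (norm_le_pi_norm d k) (norm_nonneg _) (norm_nonneg _)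
  refine (norm_sum_le _ _).trans ((Finset.sum_le_sum fun j _ =>
    (norm_sum_le _ _).trans (Finset.sum_le_sum fun k _ => hjk j k)).trans_eq ?_)
  simp
  ring

theorem isUnit_one_add_linDuh (hM : ∀ i j k, (M i j k).HasTemperateGrowth)
    {p : Euc n × ℝ} (hp : p ∈ parDom n) (m : BM (Euc n × ℝ)) (a b : VF n) :
    IsUnit (1 + linDuh M 0 p m a b) := by
  choose C hC hle using fun i j k => norm_duhOp_le (hM i j k)
  set c := ∑ i, ∑ j, ∑ k, C i j k with hc
  have hCc : ∀ i j k, C i j k ≤ c := fun i j k => by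
    have h1 : C i j k ≤ ∑ k, C i j k :=
      Finset.single_le_sum (f := fun k => C i j k) (fun k _ => hC i j k) (Finset.mem_univ k)
    have h2 : ∑ k, C i j k ≤ ∑ j, ∑ k, C i j k :=
      Finset.single_le_sum (f := fun j => ∑ k, C i j k)
        (fun j _ => Finset.sum_nonneg fun k _ => hC i j k) (Finset.mem_univ j)
    have h3 : ∑ j, ∑ k, C i j k ≤ c :=
      Finset.single_le_sum (f := fun i => ∑ j, ∑ k, C i j k)
        (fun i _ => Finset.sum_nonneg fun j _ => Finset.sum_nonneg fun k _ => hC i j k)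
        (Finset.mem_univ i)
    linarith
  have hc0 : 0 ≤ c := Finset.sum_nonneg fun i _ => Finset.sum_nonneg fun j _ =>
    Finset.sum_nonneg fun k _ => hC i j k
  have hlim : Tendsto (fun Λ : ℝ => (n * (n * (‖m‖ * ((c * Λ ^ (-(1 / 4) : ℝ)) *
      (‖a‖ + ‖b‖)))) : ℝ)) atTop (𝓝 0) := by
    have h1 := tendsto_rpow_neg_atTop (y := 1 / 4) (by norm_num)
    have h2 := (((((h1.const_mul c).mul_const (‖a‖ + ‖b‖)).const_mul ‖m‖).const_mul
      (n : ℝ)).const_mul (n : ℝ))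
    simpa using h2
  obtain ⟨Λ, hlt, hΛ⟩ := ((hlim.eventually (gt_mem_nhds zero_lt_one)).and
    (eventually_gt_atTop 0)).exists
  have hsmall : ‖-linDuh M Λ p m a b‖ < 1 := by
    rw [norm_neg]
    refine (norm_linDuh_le (by positivity) (fun i j k => ?_) m a b).trans_lt hlt
    exact (hle i j k Λ hΛ p hp).trans (mul_le_mul_of_nonneg_right (hCc i j k) (by positivity))
  have hmulVF : ∀ g h : BM (Euc n × ℝ), g * h = 1 → mulVF g * mulVF h = 1 := by
    intro g h hgh
    ext1 d
    ext1 i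
    change g * (h * d i) = d i
    rw [← mul_assoc, hgh, one_mul]
  let E : (VF n →L[ℝ] VF n)ˣ :=
    ⟨mulVF (expMul n Λ), mulVF (expMul n (-Λ)), hmulVF _ _ (expMul_mul_neg n Λ),
      hmulVF _ _ (by rw [mul_comm]; exact expMul_mul_neg n Λ)⟩
  have hcomm : linDuh M 0 p m a b * E = E * linDuh M Λ p m a b := by
    ext1 d
    exact linDuh_conj hM hΛ hp m a b d
  have hfin : 1 + linDuh M 0 p m a b = E * (1 - -linDuh M Λ p m a b) * E⁻¹ := by
    rw [sub_neg_eq_add, mul_add, mul_one, add_mul, ← hcomm, mul_assoc, Units.mul_inv, mul_one]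
  rw [hfin]
  exact (E.isUnit.mul (Units.oneSub _ hsmall).isUnit).mul E⁻¹.isUnit

/-- The change of parameters `(h, r) ↦ (h, r^{-1/2})`. -/
def parMap (n : ℕ) (p : Euc n × ℝ) : Euc n × ℝ := (p.1, p.2 ^ (-(1 / 2) : ℝ))

theorem parMap_base (n : ℕ) : parMap n (0, 1) = (0, 1) := by simp [parMap]

theorem base_mem_parDom (n : ℕ) : ((0, 1) : Euc n × ℝ) ∈ parDom n :=
  ⟨by simp, by norm_num, by norm_num⟩

theorem contDiffAt_parMap (n : ℕ) :
    ContDiffAt ℝ ((⊤ : ℕ∞) : WithTop ℕ∞) (parMap n) (0, 1) :=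
  contDiffAt_fst.prodMk (contDiffAt_snd.rpow_const_of_ne one_ne_zero)

theorem eventually_parMap_mem (n : ℕ) : ∀ᶠ p in 𝓝 ((0, 1) : Euc n × ℝ), parMap n p ∈ parDom n := by
  refine (contDiffAt_parMap n).continuousAt.eventually_mem ?_
  rw [parMap_base]
  exact (isOpen_parDom n).mem_nhds (base_mem_parDom n)

/-- The fixed-point map of the rescaled Navier–Stokes equations. -/
def nsMap (M : Fin n → Fin n → Fin n → ℝ × Euc n → ℝ)
    (x : ((Euc n × ℝ) × (Fin n → BM (Euc n))) × VF n) : VF n := fun i =>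
  x.2 i - heatOp (parMap n x.1.1) (x.1.2 i) +
    ∑ j, ∑ k, duhOp (M i j k) 0 (parMap n x.1.1) (x.2 k * x.2 j)

theorem contDiffAt_nsMap (hM : ∀ i j k, (M i j k).HasTemperateGrowth)
    (w : Fin n → BM (Euc n)) (v : VF n) :
    ContDiffAt ℝ ((⊤ : ℕ∞) : WithTop ℕ∞) (nsMap M) (((0, 1), w), v) := by
  have hpar : ContDiffAt ℝ ((⊤ : ℕ∞) : WithTop ℕ∞)
      (fun x : ((Euc n × ℝ) × (Fin n → BM (Euc n))) × VF n => parMap n x.1.1) (((0, 1), w), v) :=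
    ContDiffAt.comp (((0, 1), w), v) (contDiffAt_parMap n)
      (contDiffAt_fst.comp (((0, 1), w), v) contDiffAt_fst)
  have hnhds : parDom n ∈ 𝓝 (parMap n (0, 1)) := by
    rw [parMap_base]
    exact (isOpen_parDom n).mem_nhds (base_mem_parDom n)
  have hmem : parMap n (0, 1) ∈ parDom n := by
    rw [parMap_base]
    exact base_mem_parDom n
  have hv : ∀ i, ContDiffAt ℝ ((⊤ : ℕ∞) : WithTop ℕ∞)
      (fun x : ((Euc n × ℝ) × (Fin n → BM (Euc n))) × VF n => x.2 i) (((0, 1), w), v) := fun i =>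
    contDiffAt_pi.1 contDiffAt_snd i
  have hw : ∀ i, ContDiffAt ℝ ((⊤ : ℕ∞) : WithTop ℕ∞)
      (fun x : ((Euc n × ℝ) × (Fin n → BM (Euc n))) × VF n => x.1.2 i) (((0, 1), w), v) := fun i =>
    contDiffAt_pi.1 (contDiffAt_snd.comp (((0, 1), w), v) contDiffAt_fst) i
  rw [contDiffAt_pi]
  intro i
  refine ((hv i).sub (ContDiffAt.clm_apply ?_ (hw i))).add
    (ContDiffAt.sum fun j _ => ContDiffAt.sum fun k _ =>
      ContDiffAt.clm_apply ?_ ((hv k).mul (hv j)))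
  · exact ContDiffAt.comp (g := heatOp) (((0, 1), w), v) (contDiffOn_heatOp.contDiffAt hnhds) hpar
  · exact ContDiffAt.comp (g := duhOp (M i j k) 0) (((0, 1), w), v)
      ((contDiffOn_duhOp (hM i j k)).contDiffAt hnhds) hpar

theorem hasFDerivAt_nsMap_right (M : Fin n → Fin n → Fin n → ℝ × Euc n → ℝ)
    (x : (Euc n × ℝ) × (Fin n → BM (Euc n))) (v : VF n) :
    HasFDerivAt (fun v => nsMap M (x, v)) (1 + linDuh M 0 (parMap n x.1) 1 v v) v := by
  rw [hasFDerivAt_pi']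
  intro i
  have hp : ∀ i, HasFDerivAt (fun v : VF n => v i) (ContinuousLinearMap.proj i) v := fun i =>
    (ContinuousLinearMap.proj (R := ℝ) (φ := fun _ : Fin n => BM (Euc n × ℝ)) i).hasFDerivAt
  have h1 := ((hp i).sub_const (heatOp (parMap n x.1) (x.2 i))).add
    (HasFDerivAt.fun_sum (u := Finset.univ) fun j _ =>
      HasFDerivAt.fun_sum (u := Finset.univ) fun k _ =>
      (duhOp (M i j k) 0 (parMap n x.1)).hasFDerivAt.comp v ((hp k).mul (hp j)))
  refine h1.congr_fderiv ?_
  refine ContinuousLinearMap.ext fun d => ?_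
  simp only [linDuh, ContinuousLinearMap.coe_comp, Function.comp_apply, add_apply,
    ContinuousLinearMap.proj_apply, ContinuousLinearMap.coe_pi', sum_apply,
    smul_apply, smul_eq_mul, ContinuousLinearMap.mul_apply', one_mul, Pi.add_apply,
    one_apply_eq_self]

theorem exists_local_solution (hM : ∀ i j k, (M i j k).HasTemperateGrowth)
    (w : Fin n → BM (Euc n)) (v : VF n) (h0 : nsMap M (((0, 1), w), v) = 0) :
    ∃ V : (Euc n × ℝ) × (Fin n → BM (Euc n)) → VF n,
      ContDiffAt ℝ ((⊤ : ℕ∞) : WithTop ℕ∞) V ((0, 1), w) ∧ V ((0, 1), w) = v ∧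
        ∀ᶠ x in 𝓝 (((0, 1), w) : (Euc n × ℝ) × (Fin n → BM (Euc n))), nsMap M (x, V x) = 0 := by
  have hc := contDiffAt_nsMap hM w v
  have hd : fderiv ℝ (nsMap M) (((0, 1), w), v) ∘L .inr ℝ _ _ =
      1 + linDuh M 0 (parMap n (0, 1)) 1 v v := by
    have h1 := (hc.differentiableAt (by simp)).hasFDerivAt.comp v (hasFDerivAt_prodMk_right _ v)
    exact h1.unique (hasFDerivAt_nsMap_right M _ v)
  have hinv : (fderiv ℝ (nsMap M) (((0, 1), w), v) ∘L .inr ℝ _ _).IsInvertible := by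
    rw [hd, parMap_base]
    obtain ⟨U, hU⟩ := isUnit_one_add_linDuh hM (base_mem_parDom n) 1 v v
    exact ⟨ContinuousLinearEquiv.unitsEquiv ℝ (VF n) U, hU⟩
  refine ⟨hc.implicitFunction (by simp) hinv, hc.contDiffAt_implicitFunction (by simp) hinv,
    hc.implicitFunction_apply_self (by simp) hinv, ?_⟩
  simpa only [h0] using hc.eventually_apply_implicitFunction (by simp) hinv

/-- The indicator of `{τ < θ}` as a bounded measurable function. -/
def cutoff (n : ℕ) (θ : ℝ) : BM (Euc n × ℝ) :=
  BM.mk' (fun q => (Set.Iio θ).indicator (fun _ => 1) q.2)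
    ((measurable_const.indicator measurableSet_Iio).comp measurable_snd) 1 fun q => by
      rw [Set.indicator]
      split_ifs <;> simp

theorem duhOp_cutoff {A : ℝ × Euc n → ℝ} (hA : A.HasTemperateGrowth) {p : Euc n × ℝ}
    (hp : p ∈ parDom n) {θ : ℝ} {f g : BM (Euc n × ℝ)}
    (hfg : ∀ q : Euc n × ℝ, q.2 < θ → f.fn q = g.fn q) {q : Euc n × ℝ} (hq : q.2 < θ) :
    (duhOp A 0 p f).fn q = (duhOp A 0 p g).fn q := by
  rw [duhOp, kerOp_fn ((smoothKer_duh hA).goodKer hp), kerOp_fn ((smoothKer_duh hA).goodKer hp)]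
  refine integral_congr_ae (ae_of_all _ fun z => ?_)
  simp only [gaussKer, duhWeight]
  by_cases h : (q.2, z.1) ∈ duhSet
  · rw [hfg]
    obtain ⟨⟨h1, h2⟩, ⟨h3, h4⟩, -⟩ := h
    simp only [duhPoint] at *
    nlinarith
  · rw [Set.indicator_of_notMem h, zero_mul, zero_mul, zero_mul]

theorem nsMap_unique (hM : ∀ i j k, (M i j k).HasTemperateGrowth)
    {x : (Euc n × ℝ) × (Fin n → BM (Euc n))} (hx : parMap n x.1 ∈ parDom n) {v₁ v₂ : VF n} {θ : ℝ}
    (h : ∀ i, ∀ q : Euc n × ℝ, q.2 < θ → (nsMap M (x, v₁) i).fn q = (nsMap M (x, v₂) i).fn q)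
    (i : Fin n) {q : Euc n × ℝ} (hq : q.2 < θ) : (v₁ i).fn q = (v₂ i).fn q := by
  set m := cutoff n θ with hm
  have hm1 : ∀ q : Euc n × ℝ, q.2 < θ → m.fn q = 1 := fun q hq => by
    simp [hm, cutoff, Set.indicator_of_mem (show q.2 ∈ Set.Iio θ from hq)]
  have hm0 : ∀ q : Euc n × ℝ, ¬ q.2 < θ → m.fn q = 0 := fun q hq => by
    simp [hm, cutoff, Set.indicator_of_notMem (show q.2 ∉ Set.Iio θ from hq)]
  set d : VF n := mulVF m (v₁ - v₂) with hd
  have hd0 : (1 + linDuh M 0 (parMap n x.1) m v₁ v₂) d = 0 := by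
    ext i q
    rw [add_apply, Pi.add_apply, linDuh_apply, one_apply_eq_self, BM.add_fn, hd,
      mulVF_apply, BM.mul_fn, BM.sum_fn]
    simp only [BM.sum_fn, BM.mul_fn]
    by_cases hq : q.2 < θ
    · have key : ∀ j k, (duhOp (M i j k) 0 (parMap n x.1)
          (v₁ k * mulVF m (v₁ - v₂) j + v₂ j * mulVF m (v₁ - v₂) k)).fn q =
          (duhOp (M i j k) 0 (parMap n x.1) (v₁ k * v₁ j)).fn q -
            (duhOp (M i j k) 0 (parMap n x.1) (v₂ k * v₂ j)).fn q := by
        intro j k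
        rw [← BM.sub_fn, ← map_sub]
        refine duhOp_cutoff (hM i j k) hx (fun q hq => ?_) hq
        simp only [BM.add_fn, BM.mul_fn, mulVF_apply, BM.sub_fn, Pi.sub_apply, hm1 q hq]
        ring
      have h1 := h i q hq
      simp only [nsMap, BM.add_fn, BM.sub_fn, BM.sum_fn] at h1
      simp only [key, hm1 q hq, one_mul, Pi.sub_apply, BM.sub_fn, Finset.sum_sub_distrib,
        Pi.zero_apply, BM.zero_fn]
      linarith
    · simp [hm0 q hq]
  have hz : d = 0 := by
    have hu := isUnit_one_add_linDuh hM hx m v₁ v₂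
    obtain ⟨U, hU⟩ := hu
    have : (U⁻¹ : (VF n →L[ℝ] VF n)ˣ).val ((1 + linDuh M 0 (parMap n x.1) m v₁ v₂) d) = d := by
      rw [← hU]
      exact congrArg (fun T : VF n →L[ℝ] VF n => T d) U.inv_mul
    rw [← this, hd0, map_zero]
  have := congrArg (fun d : VF n => (d i).fn q) hz
  simp only [hd, mulVF_apply, BM.mul_fn, hm1 q hq, one_mul, Pi.sub_apply, BM.sub_fn,
    Pi.zero_apply, BM.zero_fn] at this
  linarith

end FixedPoint

section FundamentalSolution

/-- The heat kernel as a function of the distance to the origin. -/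
def heatRad (n : ℕ) (r t : ℝ) : ℝ :=
  (4 * π * t) ^ (-(n : ℝ) / 2) * Real.exp (-r ^ 2 / (4 * t))

theorem heatRad_nonneg (n : ℕ) (r : ℝ) {t : ℝ} (ht : 0 < t) : 0 ≤ heatRad n r t :=
  mul_nonneg (Real.rpow_nonneg (by positivity) _) (Real.exp_pos _).le

theorem measurable_heatRad (n : ℕ) : Measurable fun y : ℝ × ℝ => heatRad n y.1 y.2 := by
  unfold heatRad
  fun_prop

theorem integrableOn_rpow_mul_exp_neg_inv {a c : ℝ} (ha : 0 < a) (hc : 0 < c) :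
    IntegrableOn (fun s : ℝ => s ^ (-(1 + a)) * Real.exp (-c / s)) (Set.Ioi 0) := by
  have hm : Measurable (fun s : ℝ => s ^ (-(1 + a)) * Real.exp (-c / s)) := by fun_prop
  obtain ⟨m, hm1⟩ := exists_nat_ge (1 + a)
  rw [← Set.Ioc_union_Ioi_eq_Ioi zero_le_one]
  refine IntegrableOn.union ?_ ?_
  · have hb : IntegrableOn (fun _ : ℝ => (m.factorial : ℝ) / c ^ m) (Set.Ioc 0 1) := by simp
    refine Integrable.mono' hb hm.aestronglyMeasurable ?_
    filter_upwards [ae_restrict_mem measurableSet_Ioc] with s hs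
    rw [Real.norm_eq_abs, abs_of_nonneg (mul_nonneg (Real.rpow_nonneg hs.1.le _)
      (Real.exp_pos _).le)]
    have h1 : s ^ (-(1 + a)) ≤ (s⁻¹) ^ m := by
      rw [← Real.rpow_natCast, Real.inv_rpow hs.1.le, ← Real.rpow_neg hs.1.le]
      exact Real.rpow_le_rpow_of_exponent_ge hs.1 hs.2 (by linarith)
    have h2 : (c / s) ^ m / m.factorial ≤ Real.exp (c / s) :=
      Real.pow_div_factorial_le_exp _ (div_nonneg hc.le hs.1.le) m
    rw [neg_div, Real.exp_neg, ← div_eq_mul_inv, div_le_iff₀ (Real.exp_pos _)]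
    refine h1.trans ?_
    have h3 : (s⁻¹) ^ m = (m.factorial : ℝ) / c ^ m * ((c / s) ^ m / m.factorial) := by
      have : (m.factorial : ℝ) ≠ 0 := by positivity
      rw [inv_pow, div_pow]
      field_simp
    rw [h3]
    gcongr
  · have hb := integrableOn_Ioi_rpow_of_lt (a := -(1 + a)) (by linarith) (zero_lt_one' ℝ)
    refine Integrable.mono' hb hm.aestronglyMeasurable ?_
    filter_upwards [ae_restrict_mem measurableSet_Ioi] with s hs
    have hs0 : 0 < s := zero_lt_one.trans hs
    rw [Real.norm_eq_abs, abs_of_nonneg (mul_nonneg (Real.rpow_nonneg hs0.le _)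
      (Real.exp_pos _).le)]
    refine mul_le_of_le_one_right (Real.rpow_nonneg hs0.le _) (Real.exp_le_one_iff.2 ?_)
    rw [neg_div]
    exact neg_nonpos.2 (div_nonneg hc.le hs0.le)

/-- The radial derivative of the heat kernel. -/
theorem hasDerivAt_heatRad (n : ℕ) (r s : ℝ) :
    HasDerivAt (fun r => heatRad n r s) (-(r / (2 * s)) * heatRad n r s) r := by
  have h : HasDerivAt (fun r : ℝ => -r ^ 2 / (4 * s)) (-(2 * r) / (4 * s)) r := by
    simpa using ((hasDerivAt_pow 2 r).neg).div_const (4 * s)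
  refine (h.exp.const_mul ((4 * π * s) ^ (-(n : ℝ) / 2))).congr_deriv ?_
  rw [heatRad]
  rw [show -(2 * r) / (4 * s) = -(r / (2 * s)) by
    rw [neg_div, show 4 * s = 2 * (2 * s) by ring, mul_div_mul_left _ _ two_ne_zero]]
  ring

theorem div_mul_heatRad_le (n : ℕ) {r s c R : ℝ} (hs : 0 < s) (hc : 0 ≤ c) (hcr : c ≤ r)
    (hrR : r ≤ R) :
    |-(r / (2 * s)) * heatRad n r s| ≤ R / 2 * (4 * π) ^ (-(n : ℝ) / 2) *
      (s ^ (-(1 + (n : ℝ) / 2)) * Real.exp (-(c ^ 2 / 4) / s)) := by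
  have hr0 : 0 ≤ r := hc.trans hcr
  have hR0 : 0 ≤ R := hr0.trans hrR
  rw [abs_mul, abs_neg, abs_of_nonneg (div_nonneg hr0 (by positivity)),
    abs_of_nonneg (heatRad_nonneg n r hs), heatRad, Real.mul_rpow (by positivity) hs.le]
  have h1 : s ^ (-(1 + (n : ℝ) / 2)) = s⁻¹ * s ^ (-(n : ℝ) / 2) := by
    rw [neg_add, Real.rpow_add hs, Real.rpow_neg_one, neg_div]
  have h2 : Real.exp (-r ^ 2 / (4 * s)) ≤ Real.exp (-(c ^ 2 / 4) / s) := by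
    refine Real.exp_le_exp.2 ?_
    rw [show -(c ^ 2 / 4) / s = -c ^ 2 / (4 * s) by field_simp]
    gcongr
  rw [h1]
  calc r / (2 * s) * ((4 * π) ^ (-(n : ℝ) / 2) * s ^ (-(n : ℝ) / 2) * Real.exp (-r ^ 2 / (4 * s)))
      ≤ R / (2 * s) * ((4 * π) ^ (-(n : ℝ) / 2) * s ^ (-(n : ℝ) / 2) *
        Real.exp (-(c ^ 2 / 4) / s)) := by gcongr
    _ = _ := by field_simp

theorem integrableOn_heatRad_sub {n : ℕ} (hn : 2 ≤ n) {r r' : ℝ} (hr : 0 < r) (hr' : 0 < r') :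
    IntegrableOn (fun s => heatRad n r s - heatRad n r' s) (Set.Ioi 0) := by
  have hn0 : (0 : ℝ) < n / 2 := by positivity
  set c := min r r'
  set R := max r r'
  have hc : 0 < c := lt_min hr hr'
  have hb := (((integrableOn_rpow_mul_exp_neg_inv hn0 (c := c ^ 2 / 4) (by positivity)).const_mul
    (R / 2 * (4 * π) ^ (-(n : ℝ) / 2))).mul_const |r - r'|)
  refine Integrable.mono' hb ?_ ?_
  · exact (((measurable_heatRad n).comp (measurable_const.prodMk measurable_id)).sub
      ((measurable_heatRad n).comp (measurable_const.prodMk measurable_id))).aestronglyMeasurable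
  · filter_upwards [ae_restrict_mem measurableSet_Ioi] with s hs
    refine (convex_Icc c R).norm_image_sub_le_of_norm_hasDerivWithin_le
      (f := fun r => heatRad n r s)
      (fun x _ => (hasDerivAt_heatRad n x s).hasDerivWithinAt)
      (fun x hx => div_mul_heatRad_le n hs hc.le hx.1 hx.2)
      ⟨min_le_right _ _, le_max_right _ _⟩ ⟨min_le_left _ _, le_max_left _ _⟩

theorem heatRad_scale (n : ℕ) {r s : ℝ} (hr : 0 < r) (hs : 0 < s) :
    heatRad n r (r ^ 2 * s) = r ^ (-(n : ℝ)) * heatRad n 1 s := by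
  rw [heatRad, heatRad, show 4 * π * (r ^ 2 * s) = r ^ 2 * (4 * π * s) by ring,
    Real.mul_rpow (by positivity) (by positivity), ← Real.rpow_natCast r 2, ← Real.rpow_mul hr.le]
  rw [mul_assoc]
  congr 2
  · push_cast
    ring
  · congr 1
    rw [Real.rpow_natCast]
    field_simp

/-- The renormalised time integral of the heat kernel. -/
def heatPot (n : ℕ) (r : ℝ) : ℝ := ∫ s in Set.Ioi 0, (heatRad n r s - heatRad n 1 s)

theorem hasDerivAt_heatPot {n : ℕ} (hn : 2 ≤ n) {r : ℝ} (hr : 0 < r) :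
    HasDerivAt (heatPot n)
      (-((∫ s in Set.Ioi 0, 1 / (2 * s) * heatRad n 1 s) * r ^ (1 - (n : ℝ)))) r := by
  have hn0 : (0 : ℝ) < n / 2 := by positivity
  have hmeas : ∀ r, Measurable fun s => heatRad n r s := fun r =>
    (measurable_heatRad n).comp (measurable_const.prodMk measurable_id)
  have hmain := hasDerivAt_integral_of_dominated_loc_of_deriv_le
    (μ := volume.restrict (Set.Ioi (0 : ℝ))) (s := Set.Ioo (r / 2) (2 * r)) (x₀ := r)
    (F := fun r s => heatRad n r s - heatRad n 1 s)
    (F' := fun r s => -(r / (2 * s)) * heatRad n r s)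
    (bound := fun s => (2 * r) / 2 * (4 * π) ^ (-(n : ℝ) / 2) *
      (s ^ (-(1 + (n : ℝ) / 2)) * Real.exp (-((r / 2) ^ 2 / 4) / s)))
    (Ioo_mem_nhds (by linarith) (by linarith))
    (Eventually.of_forall fun x => ((hmeas x).sub (hmeas 1)).aestronglyMeasurable)
    (integrableOn_heatRad_sub hn hr one_pos)
    ((Measurable.mul (by fun_prop) (hmeas r)).aestronglyMeasurable)
    (by
      filter_upwards [ae_restrict_mem measurableSet_Ioi] with s hs x hx
      exact div_mul_heatRad_le n hs (by positivity) hx.1.le hx.2.le)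
    ((integrableOn_rpow_mul_exp_neg_inv hn0 (by positivity)).const_mul _)
    (by
      filter_upwards [] with s x hx
      exact (hasDerivAt_heatRad n x s).sub_const _)
  refine hmain.2.congr_deriv ?_
  have hsc := integral_comp_mul_left_Ioi (fun s => -(r / (2 * s)) * heatRad n r s) 0
    (b := r ^ 2) (by positivity)
  rw [mul_zero, smul_eq_mul] at hsc
  have h2 : ∫ s in Set.Ioi (0 : ℝ), -(r / (2 * (r ^ 2 * s))) * heatRad n r (r ^ 2 * s) =
      -(r⁻¹ * r ^ (-(n : ℝ))) * ∫ s in Set.Ioi 0, 1 / (2 * s) * heatRad n 1 s := by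
    rw [← integral_const_mul]
    refine setIntegral_congr_fun measurableSet_Ioi fun s hs => ?_
    simp only [heatRad_scale n hr hs]
    have : s ≠ 0 := ne_of_gt hs
    field_simp
  have h3 : ∫ s in Set.Ioi (0 : ℝ), -(r / (2 * s)) * heatRad n r s =
      r ^ 2 * ∫ s in Set.Ioi (0 : ℝ), -(r / (2 * (r ^ 2 * s))) * heatRad n r (r ^ 2 * s) := by
    rw [hsc, ← mul_assoc, mul_inv_cancel₀ (by positivity), one_mul]
  rw [h3, h2, sub_eq_add_neg, Real.rpow_add hr, Real.rpow_one]
  field_simp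

theorem heatPot_const_pos {n : ℕ} (hn : 2 ≤ n) :
    0 < ∫ s in Set.Ioi 0, 1 / (2 * s) * heatRad n 1 s := by
  have hn0 : (0 : ℝ) < n / 2 := by positivity
  have hpos : ∀ s ∈ Set.Ioi (0 : ℝ), 0 < 1 / (2 * s) * heatRad n 1 s := fun s hs => by
    have : 0 < s := hs
    unfold heatRad
    positivity
  rw [setIntegral_pos_iff_support_of_nonneg_ae]
  · have : Set.Ioi (0 : ℝ) ⊆ Function.support (fun s => 1 / (2 * s) * heatRad n 1 s) :=
      fun s hs => (hpos s hs).ne'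
    rw [Set.inter_eq_right.2 this]
    simp
  · filter_upwards [ae_restrict_mem measurableSet_Ioi] with s hs using (hpos s hs).le
  · have hb := ((integrableOn_rpow_mul_exp_neg_inv hn0 (c := 1 ^ 2 / 4) (by positivity)).const_mul
      (1 / 2 * (4 * π) ^ (-(n : ℝ) / 2)))
    refine Integrable.mono' hb ?_ ?_
    · exact (Measurable.mul (by fun_prop) ((measurable_heatRad n).comp
        (measurable_const.prodMk measurable_id))).aestronglyMeasurable
    · filter_upwards [ae_restrict_mem measurableSet_Ioi] with s hs
      have := div_mul_heatRad_le n (c := 1) (R := 1) (r := 1) hs zero_le_one le_rfl le_rfl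
      rwa [neg_mul, abs_neg] at this

/-- The fundamental solution is, up to affine normalisation, the renormalised time integral of
the heat kernel. -/
theorem exists_lapFund_eq {n : ℕ} (hn : 2 ≤ n) :
    ∃ A c : ℝ, ∀ y : Euc n, y ≠ 0 → lapFund n y = A + c * heatPot n ‖y‖ := by
  set c₁ := ∫ s in Set.Ioi 0, 1 / (2 * s) * heatRad n 1 s with hc₁
  have hc₁0 : 0 < c₁ := heatPot_const_pos hn
  obtain ⟨g, κ, hg, hgd⟩ : ∃ (g : ℝ → ℝ) (κ : ℝ), (∀ y : Euc n, lapFund n y = g ‖y‖) ∧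
      ∀ r, 0 < r → HasDerivAt g (κ * r ^ (1 - (n : ℝ))) r := by
    by_cases h2 : n = 2
    · refine ⟨fun r => (2 * π)⁻¹ * Real.log r, (2 * π)⁻¹, fun y => by rw [lapFund, if_pos h2],
        fun r hr => ?_⟩
      refine ((Real.hasDerivAt_log hr.ne').const_mul _).congr_deriv ?_
      rw [h2]
      norm_num [Real.rpow_neg_one]
    · refine ⟨fun r => -((((n : ℝ) - 2) * (2 * π ^ ((n : ℝ) / 2) / Real.Gamma ((n : ℝ) / 2)))⁻¹) *
        r ^ (2 - (n : ℝ)),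
        -((((n : ℝ) - 2) * (2 * π ^ ((n : ℝ) / 2) / Real.Gamma ((n : ℝ) / 2)))⁻¹) * (2 - (n : ℝ)),
        fun y => by rw [lapFund, if_neg h2], fun r hr => ?_⟩
      refine ((Real.hasDerivAt_rpow_const (p := 2 - (n : ℝ)) (Or.inl hr.ne')).const_mul _).congr_deriv
        ?_
      rw [← mul_assoc, show 2 - (n : ℝ) - 1 = 1 - n by ring]
  have hconst : ∀ r, 0 < r → g r + κ / c₁ * heatPot n r = g 1 + κ / c₁ * heatPot n 1 := by
    intro r hr
    have hd : ∀ r, 0 < r → HasDerivAt (fun r => g r + κ / c₁ * heatPot n r) 0 r := fun r hr => by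
      refine ((hgd r hr).add ((hasDerivAt_heatPot hn hr).const_mul (κ / c₁))).congr_deriv ?_
      rw [← hc₁]
      field_simp
      ring
    refine (convex_Ioi (0 : ℝ)).is_const_of_fderivWithin_eq_zero (𝕜 := ℝ)
      (f := fun r => g r + κ / c₁ * heatPot n r)
      (fun x hx => (hd x hx).differentiableAt.differentiableWithinAt) (fun x hx => ?_) hr
      (Set.mem_Ioi.2 one_pos)
    have h0 := (hd x hx).hasFDerivAt.hasFDerivWithinAt (s := Set.Ioi 0)
    rw [h0.fderivWithin (isOpen_Ioi.uniqueDiffWithinAt hx)]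
    simp
  refine ⟨g 1 + κ / c₁ * heatPot n 1, -(κ / c₁), fun y hy => ?_⟩
  rw [hg, ← hconst ‖y‖ (norm_pos_iff.2 hy)]
  ring

end FundamentalSolution

section HeatSemigroup

theorem heatKer_nonneg (n : ℕ) (x : Euc n) {t : ℝ} (ht : 0 < t) : 0 ≤ heatKer n x t :=
  heatRad_nonneg n ‖x‖ ht

theorem heatKer_le (n : ℕ) (x : Euc n) {t : ℝ} (ht : 0 < t) :
    heatKer n x t ≤ (4 * π * t) ^ (-(n : ℝ) / 2) := by
  refine mul_le_of_le_one_right (Real.rpow_nonneg (by positivity) _) (Real.exp_le_one_iff.2 ?_)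
  exact div_nonpos_of_nonpos_of_nonneg (neg_nonpos.2 (by positivity)) (by positivity)

theorem measurable_heatKer (n : ℕ) : Measurable fun y : Euc n × ℝ => heatKer n y.1 y.2 := by
  unfold heatKer
  fun_prop

theorem continuous_heatKer (n : ℕ) (t : ℝ) : Continuous fun y : Euc n => heatKer n y t := by
  unfold heatKer
  fun_prop

theorem integrable_heatKer (n : ℕ) {t : ℝ} (ht : 0 < t) :
    Integrable fun y : Euc n => heatKer n y t := by
  refine Integrable.const_mul ?_ _
  have h := GaussianFourier.integrable_cexp_neg_mul_sq_norm_add (V := Euc n) (b := (1 / (4 * t) : ℝ))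
    (by rw [Complex.ofReal_re]; positivity) 0 0
  refine h.re.congr (Eventually.of_forall fun y => ?_)
  simp only [zero_mul, add_zero]
  rw [show (-(((1 / (4 * t) : ℝ)) : ℂ) * (‖y‖ : ℂ) ^ 2) = ((-‖y‖ ^ 2 / (4 * t) : ℝ) : ℂ) by
    push_cast; ring, ← Complex.ofReal_exp]
  exact Complex.ofReal_re _

theorem integral_heatKer (n : ℕ) {t : ℝ} (ht : 0 < t) : ∫ y : Euc n, heatKer n y t = 1 := by
  have h := GaussianFourier.integral_rexp_neg_mul_sq_norm (V := Euc n) (b := 1 / (4 * t))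
    (by positivity)
  unfold heatKer
  rw [integral_const_mul]
  simp_rw [show ∀ y : Euc n, -‖y‖ ^ 2 / (4 * t) = -(1 / (4 * t)) * ‖y‖ ^ 2 from fun y => by ring]
  rw [h, finrank_euclideanSpace_fin, show π / (1 / (4 * t)) = 4 * π * t by field_simp,
    ← Real.rpow_add (by positivity), neg_div, neg_add_cancel, Real.rpow_zero]

theorem integrable_heatKer_sub (n : ℕ) (x : Euc n) {t : ℝ} (ht : 0 < t) :
    Integrable fun y : Euc n => heatKer n (x - y) t :=
  (integrable_heatKer n ht).comp_sub_left x

theorem integral_heatKer_sub (n : ℕ) (x : Euc n) {t : ℝ} (ht : 0 < t) :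
    ∫ y : Euc n, heatKer n (x - y) t = 1 := by
  rw [integral_sub_left_eq_self (fun y => heatKer n y t) volume x, integral_heatKer n ht]

theorem heatKer_mul_heatKer (n : ℕ) (x y : Euc n) {s t : ℝ} (hs : 0 < s) (ht : 0 < t) :
    heatKer n y s * heatKer n (x - y) t =
      heatKer n x (s + t) * heatKer n ((s / (s + t)) • x - y) (s * t / (s + t)) := by
  have hst : 0 < s + t := add_pos hs ht
  have h1 : (4 * π * s) ^ (-(n : ℝ) / 2) * (4 * π * t) ^ (-(n : ℝ) / 2) =
      (4 * π * (s + t)) ^ (-(n : ℝ) / 2) * (4 * π * (s * t / (s + t))) ^ (-(n : ℝ) / 2) := by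
    rw [← Real.mul_rpow (by positivity) (by positivity),
      ← Real.mul_rpow (by positivity) (by positivity)]
    congr 1
    field_simp
  have h2 : Real.exp (-‖y‖ ^ 2 / (4 * s)) * Real.exp (-‖x - y‖ ^ 2 / (4 * t)) =
      Real.exp (-‖x‖ ^ 2 / (4 * (s + t))) *
        Real.exp (-‖(s / (s + t)) • x - y‖ ^ 2 / (4 * (s * t / (s + t)))) := by
    rw [← Real.exp_add, ← Real.exp_add]
    congr 1
    rw [norm_sub_sq_real, norm_sub_sq_real, norm_smul, real_inner_smul_left, Real.norm_eq_abs,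
      abs_of_pos (div_pos hs hst)]
    field_simp
    ring
  unfold heatKer
  linear_combination (Real.exp (-‖y‖ ^ 2 / (4 * s)) * Real.exp (-‖x - y‖ ^ 2 / (4 * t))) * h1 +
    ((4 * π * (s + t)) ^ (-(n : ℝ) / 2) * (4 * π * (s * t / (s + t))) ^ (-(n : ℝ) / 2)) * h2

theorem integral_heatKer_mul_heatKer (n : ℕ) (x : Euc n) {s t : ℝ} (hs : 0 < s) (ht : 0 < t) :
    ∫ y, heatKer n y s * heatKer n (x - y) t = heatKer n x (s + t) := by
  simp_rw [heatKer_mul_heatKer n x _ hs ht]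
  rw [integral_const_mul, integral_heatKer_sub n _ (by positivity), mul_one]

end HeatSemigroup

section Potential

theorem abs_heatRad_sub_le (n : ℕ) (r : ℝ) {s : ℝ} (hs : 0 < s) :
    |heatRad n r s - heatRad n 1 s| ≤
      (4 * π) ^ (-(n : ℝ) / 2) * ((r ^ 2 + 1) * s ^ (-(1 + (n : ℝ) / 2))) := by
  have h1 : s ^ (-(1 + (n : ℝ) / 2)) = s⁻¹ * s ^ (-(n : ℝ) / 2) := by
    rw [neg_add, Real.rpow_add hs, Real.rpow_neg_one, neg_div]
  have key : ∀ r : ℝ, 0 ≤ 1 - Real.exp (-r ^ 2 / (4 * s)) ∧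
      1 - Real.exp (-r ^ 2 / (4 * s)) ≤ r ^ 2 * s⁻¹ := fun r => by
    constructor
    · rw [sub_nonneg, Real.exp_le_one_iff]
      exact div_nonpos_of_nonpos_of_nonneg (neg_nonpos.2 (by positivity)) (by positivity)
    · have h := Real.add_one_le_exp (-r ^ 2 / (4 * s))
      have h2 : r ^ 2 / (4 * s) ≤ r ^ 2 * s⁻¹ := by
        rw [← div_eq_mul_inv]
        gcongr
        linarith
      rw [neg_div] at h ⊢
      linarith
  rw [heatRad, heatRad, ← mul_sub, abs_mul, abs_of_nonneg (Real.rpow_nonneg (by positivity) _),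
    Real.mul_rpow (by positivity) hs.le, h1]
  have h3 : |Real.exp (-r ^ 2 / (4 * s)) - Real.exp (-1 ^ 2 / (4 * s))| ≤ (r ^ 2 + 1) * s⁻¹ := by
    obtain ⟨a1, a2⟩ := key r
    obtain ⟨b1, b2⟩ := key 1
    rw [abs_le]
    constructor <;> nlinarith [mul_nonneg (sq_nonneg r) (inv_nonneg.2 hs.le), inv_nonneg.2 hs.le]
  calc _ ≤ (4 * π) ^ (-(n : ℝ) / 2) * s ^ (-(n : ℝ) / 2) * ((r ^ 2 + 1) * s⁻¹) := by gcongr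
    _ = _ := by ring

theorem integrable_sq_mul_heatKer_sub (n : ℕ) (x : Euc n) {t : ℝ} (ht : 0 < t) :
    Integrable fun y : Euc n => ‖y‖ ^ 2 * heatKer n (x - y) t := by
  have h0 : Integrable fun y : Euc n => ‖y‖ ^ 2 * heatKer n y t := by
    refine Integrable.mono' ((integrable_heatKer n (t := 2 * t) (by positivity)).const_mul
      (8 * t * 2 ^ ((n : ℝ) / 2))) ?_ (Eventually.of_forall fun y => ?_)
    · exact ((continuous_norm.pow 2).mul (continuous_heatKer n t)).aestronglyMeasurable
    · rw [Real.norm_eq_abs, abs_of_nonneg (mul_nonneg (by positivity) (heatKer_nonneg n y ht))]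
      have h1 : (4 * π * t) ^ (-(n : ℝ) / 2) =
          2 ^ ((n : ℝ) / 2) * (4 * π * (2 * t)) ^ (-(n : ℝ) / 2) := by
        rw [show 4 * π * (2 * t) = 2 * (4 * π * t) by ring,
          Real.mul_rpow (x := 2) (y := 4 * π * t) (by positivity) (by positivity), ← mul_assoc,
          ← Real.rpow_add (by positivity), neg_div, add_neg_cancel, Real.rpow_zero, one_mul]
      have h2 : ‖y‖ ^ 2 * Real.exp (-‖y‖ ^ 2 / (4 * t)) ≤
          8 * t * Real.exp (-‖y‖ ^ 2 / (4 * (2 * t))) := by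
        have h3 := Real.add_one_le_exp (‖y‖ ^ 2 / (8 * t))
        have h4 : ‖y‖ ^ 2 ≤ 8 * t * Real.exp (‖y‖ ^ 2 / (8 * t)) := by
          have : ‖y‖ ^ 2 = 8 * t * (‖y‖ ^ 2 / (8 * t)) := by field_simp
          rw [this]
          gcongr
          rw [← this]
          linarith
        calc _ ≤ 8 * t * Real.exp (‖y‖ ^ 2 / (8 * t)) * Real.exp (-‖y‖ ^ 2 / (4 * t)) := by gcongr
          _ = _ := by
            rw [mul_assoc, ← Real.exp_add]
            congr 2
            field_simp
            ring
      unfold heatKer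
      rw [h1]
      calc _ = 2 ^ ((n : ℝ) / 2) * (4 * π * (2 * t)) ^ (-(n : ℝ) / 2) *
            (‖y‖ ^ 2 * Real.exp (-‖y‖ ^ 2 / (4 * t))) := by ring
        _ ≤ 2 ^ ((n : ℝ) / 2) * (4 * π * (2 * t)) ^ (-(n : ℝ) / 2) *
            (8 * t * Real.exp (-‖y‖ ^ 2 / (4 * (2 * t)))) := by gcongr
        _ = _ := by ring
  have h1 := (h0.comp_sub_left x)
  refine Integrable.mono' ((h1.const_mul 2).add ((integrable_heatKer_sub n x ht).const_mul
    (2 * ‖x‖ ^ 2))) ?_ (Eventually.of_forall fun y => ?_)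
  · exact ((continuous_norm.pow 2).mul ((continuous_heatKer n t).comp
      (continuous_const.sub continuous_id))).aestronglyMeasurable
  · have hp := heatKer_nonneg n (x - y) ht
    rw [Real.norm_eq_abs, abs_of_nonneg (mul_nonneg (by positivity) hp)]
    have h2 : ‖y‖ ^ 2 ≤ 2 * ‖x - y‖ ^ 2 + 2 * ‖x‖ ^ 2 := by
      have := norm_le_norm_add_norm_sub' y x
      rw [norm_sub_rev] at this
      nlinarith [sq_nonneg (‖x - y‖ - ‖x‖), norm_nonneg y, norm_nonneg x, norm_nonneg (x - y)]
    calc _ ≤ (2 * ‖x - y‖ ^ 2 + 2 * ‖x‖ ^ 2) * heatKer n (x - y) t := by gcongr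
      _ = _ := by simp only [Pi.add_apply]; ring

theorem integrable_heatRad_mul_heatKer (n : ℕ) (x : Euc n) {s t : ℝ} (hs : 0 < s) (ht : 0 < t) :
    Integrable fun y : Euc n => heatRad n ‖y‖ s * heatKer n (x - y) t := by
  refine Integrable.bdd_mul (c := (4 * π * s) ^ (-(n : ℝ) / 2)) (integrable_heatKer_sub n x ht)
    (continuous_heatKer n s).aestronglyMeasurable (Eventually.of_forall fun y => ?_)
  change |heatKer n y s| ≤ _
  rw [abs_of_nonneg (heatKer_nonneg n y hs)]
  exact heatKer_le n y hs

theorem integrable_potential {n : ℕ} (hn : 2 ≤ n) (x : Euc n) {t : ℝ} (ht : 0 < t) :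
    Integrable (fun z : Euc n × ℝ =>
      (heatRad n ‖z.1‖ z.2 - heatRad n 1 z.2) * heatKer n (x - z.1) t)
      (volume.prod (volume.restrict (Set.Ioi 0))) := by
  have hn0 : (0 : ℝ) < n / 2 := by positivity
  have hm : Measurable (fun z : Euc n × ℝ =>
      (heatRad n ‖z.1‖ z.2 - heatRad n 1 z.2) * heatKer n (x - z.1) t) := by
    unfold heatRad heatKer
    fun_prop
  have hci := fun s (hs : 0 < s) => integrable_heatRad_mul_heatKer n x hs ht
  have hi : ∀ s, 0 < s → Integrable fun y : Euc n =>
      (heatRad n ‖y‖ s - heatRad n 1 s) * heatKer n (x - y) t := fun s hs => by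
    simp_rw [sub_mul]
    exact (hci s hs).sub ((integrable_heatKer_sub n x ht).const_mul _)
  rw [integrable_prod_iff' hm.aestronglyMeasurable]
  refine ⟨?_, ?_⟩
  · filter_upwards [ae_restrict_mem measurableSet_Ioi] with s hs using hi s hs
  have hmm : AEStronglyMeasurable (fun s => ∫ y : Euc n,
      ‖(heatRad n ‖y‖ s - heatRad n 1 s) * heatKer n (x - y) t‖) volume :=
    (hm.norm.stronglyMeasurable.integral_prod_left').aestronglyMeasurable
  change IntegrableOn (fun s => ∫ y : Euc n,
    ‖(heatRad n ‖y‖ s - heatRad n 1 s) * heatKer n (x - y) t‖) (Set.Ioi 0) volume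
  rw [← Set.Ioc_union_Ioi_eq_Ioi zero_le_one]
  refine IntegrableOn.union ?_ ?_
  · have hb := (((integrableOn_rpow_mul_exp_neg_inv hn0 (c := 1 / 4) (by positivity)).mono_set
      (Set.Ioc_subset_Ioi_self : Set.Ioc (0 : ℝ) 1 ⊆ Set.Ioi 0)).const_mul
      ((4 * π) ^ (-(n : ℝ) / 2))).add
      (integrable_const ((4 * π * t) ^ (-(n : ℝ) / 2)))
    refine Integrable.mono' hb hmm.restrict ?_
    filter_upwards [ae_restrict_mem measurableSet_Ioc] with s hs
    have hs0 : 0 < s := hs.1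
    rw [Real.norm_eq_abs, abs_of_nonneg (integral_nonneg fun y => norm_nonneg _)]
    have h1 : ∫ y : Euc n, ‖(heatRad n ‖y‖ s - heatRad n 1 s) * heatKer n (x - y) t‖ ≤
        ∫ y : Euc n, (heatRad n ‖y‖ s * heatKer n (x - y) t
          + heatRad n 1 s * heatKer n (x - y) t) := by
      refine integral_mono (hi s hs0).norm
        ((hci s hs0).add ((integrable_heatKer_sub n x ht).const_mul _)) fun y => ?_
      simp only [norm_mul, Real.norm_eq_abs, abs_of_nonneg (heatKer_nonneg n (x - y) ht),
        ← add_mul]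
      refine mul_le_mul_of_nonneg_right ?_ (heatKer_nonneg n (x - y) ht)
      have a := heatRad_nonneg n ‖y‖ hs0
      have b := heatRad_nonneg n 1 hs0
      rw [abs_le]
      constructor <;> linarith
    refine h1.trans ?_
    rw [integral_add (hci s hs0) ((integrable_heatKer_sub n x ht).const_mul _), integral_const_mul,
      integral_heatKer_sub n x ht, mul_one, add_comm]
    have h2 : heatRad n 1 s ≤ (4 * π) ^ (-(n : ℝ) / 2) *
        (s ^ (-(1 + (n : ℝ) / 2)) * Real.exp (-(1 / 4) / s)) := by
      have h1 : s ^ (-(n : ℝ) / 2) ≤ s ^ (-(1 + (n : ℝ) / 2)) :=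
        Real.rpow_le_rpow_of_exponent_ge hs0 hs.2 (by linarith)
      rw [heatRad, Real.mul_rpow (by positivity) hs0.le, mul_assoc,
        show -1 ^ 2 / (4 * s) = -(1 / 4) / s by field_simp]
      gcongr
    have h3 : ∫ y : Euc n, heatRad n ‖y‖ s * heatKer n (x - y) t ≤
        (4 * π * t) ^ (-(n : ℝ) / 2) := by
      refine (integral_heatKer_mul_heatKer n x hs0 ht).trans_le
        ((heatKer_le n x (add_pos hs0 ht)).trans ?_)
      refine Real.rpow_le_rpow_of_nonpos (by positivity) ?_ (by linarith)
      gcongr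
      linarith
    exact add_le_add h2 h3
  · have hb := (integrableOn_Ioi_rpow_of_lt (a := -(1 + (n : ℝ) / 2)) (by linarith)
      (zero_lt_one' ℝ)).const_mul
      ((4 * π) ^ (-(n : ℝ) / 2) * ∫ y : Euc n, (‖y‖ ^ 2 * heatKer n (x - y) t
        + heatKer n (x - y) t))
    refine Integrable.mono' hb hmm.restrict ?_
    filter_upwards [ae_restrict_mem measurableSet_Ioi] with s hs
    have hs0 : 0 < s := zero_lt_one.trans hs
    rw [Real.norm_eq_abs, abs_of_nonneg (integral_nonneg fun y => norm_nonneg _), mul_right_comm,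
      ← integral_const_mul]
    refine integral_mono (hi s hs0).norm (((integrable_sq_mul_heatKer_sub n x ht).add
      (integrable_heatKer_sub n x ht)).const_mul _) fun y => ?_
    simp only [norm_mul, Real.norm_eq_abs, abs_of_nonneg (heatKer_nonneg n (x - y) ht)]
    refine (mul_le_mul_of_nonneg_right (abs_heatRad_sub_le n ‖y‖ hs0)
      (heatKer_nonneg n (x - y) ht)).trans_eq ?_
    ring

theorem exists_genPhi_eq {n : ℕ} (hn : 2 ≤ n) : ∃ A c : ℝ, ∀ (x : Euc n) (t : ℝ), 0 < t →
    genPhi n x t = A + c * ∫ s in Set.Ioi 0, (heatKer n x (t + s) - heatRad n 1 s) := by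
  obtain ⟨A, c, h⟩ := exists_lapFund_eq hn
  refine ⟨A, c, fun x t ht => ?_⟩
  have : Nonempty (Fin n) := ⟨⟨0, by omega⟩⟩
  have hne : ∀ᵐ y : Euc n, y ≠ 0 := by
    have : (volume : Measure (Euc n)) {0} = 0 := measure_singleton 0
    exact compl_mem_ae_iff.2 this
  have hpot := integrable_potential hn x ht
  have h1 : genPhi n x t = ∫ y : Euc n, (A * heatKer n (x - y) t + c *
      ∫ s in Set.Ioi 0, (heatRad n ‖y‖ s - heatRad n 1 s) * heatKer n (x - y) t) := by
    refine integral_congr_ae ?_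
    filter_upwards [hne] with y hy
    rw [h y hy, heatPot, integral_mul_const]
    ring
  rw [h1, integral_add ((integrable_heatKer_sub n x ht).const_mul A)
    (hpot.integral_prod_left.const_mul c), integral_const_mul, integral_const_mul,
    integral_heatKer_sub n x ht, mul_one, integral_integral_swap hpot]
  congr 2
  refine setIntegral_congr_fun measurableSet_Ioi fun s hs => ?_
  have hs0 : 0 < s := hs
  have hci := integrable_heatRad_mul_heatKer n x hs0 ht
  simp_rw [sub_mul]
  rw [integral_sub hci ((integrable_heatKer_sub n x ht).const_mul _), integral_const_mul,
    integral_heatKer_sub n x ht, mul_one]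
  congr 1
  exact (integral_heatKer_mul_heatKer n x hs0 ht).trans (by rw [add_comm])

end Potential

section PartialDerivatives

variable {n : ℕ}

/-- The function `g` is differentiable at `x` with partial derivatives `g' a`. -/
def HasPd (g : Euc n → ℝ) (g' : Fin n → ℝ) (x : Euc n) : Prop :=
  HasFDerivAt g (∑ a, g' a • (EuclideanSpace.proj a : Euc n →L[ℝ] ℝ)) x

theorem HasPd.pd {g : Euc n → ℝ} {g' : Fin n → ℝ} {x : Euc n} (h : HasPd g g' x) (a : Fin n) :
    pd n a g x = g' a := by
  rw [_root_.pd, HasFDerivAt.fderiv h]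
  simp [sum_apply, smul_apply]

theorem HasPd.congr_deriv {g : Euc n → ℝ} {g' h' : Fin n → ℝ} {x : Euc n} (h : HasPd g g' x)
    (e : ∀ a, g' a = h' a) : HasPd g h' x := by
  rwa [funext e] at h

theorem HasPd.congr_fun {g h : Euc n → ℝ} {g' : Fin n → ℝ} {x : Euc n} (hg : HasPd g g' x)
    (e : ∀ y, h y = g y) : HasPd h g' x := by
  rwa [funext e]

theorem HasPd.const_mul {g : Euc n → ℝ} {g' : Fin n → ℝ} {x : Euc n} (h : HasPd g g' x) (c : ℝ) :
    HasPd (fun x => c * g x) (fun a => c * g' a) x := by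
  refine (HasFDerivAt.const_mul h c).congr_fderiv ?_
  rw [Finset.smul_sum]
  simp only [smul_smul]

theorem HasPd.add {g h : Euc n → ℝ} {g' h' : Fin n → ℝ} {x : Euc n} (hg : HasPd g g' x)
    (hh : HasPd h h' x) : HasPd (fun x => g x + h x) (fun a => g' a + h' a) x := by
  refine (HasFDerivAt.add hg hh).congr_fderiv ?_
  rw [← Finset.sum_add_distrib]
  simp only [add_smul]

theorem HasPd.mul {g h : Euc n → ℝ} {g' h' : Fin n → ℝ} {x : Euc n} (hg : HasPd g g' x)
    (hh : HasPd h h' x) :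
    HasPd (fun x => g x * h x) (fun a => g x * h' a + h x * g' a) x := by
  refine (HasFDerivAt.mul hg hh).congr_fderiv ?_
  rw [Finset.smul_sum, Finset.smul_sum, ← Finset.sum_add_distrib]
  simp only [add_smul, smul_smul]

theorem hasPd_const (c : ℝ) (x : Euc n) : HasPd (fun _ => c) (fun _ => 0) x := by
  refine (hasFDerivAt_const c x).congr_fderiv ?_
  simp

theorem HasPd.sum {ι : Type*} (s : Finset ι) {g : ι → Euc n → ℝ} {g' : ι → Fin n → ℝ} {x : Euc n}
    (h : ∀ m ∈ s, HasPd (g m) (g' m) x) :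
    HasPd (fun x => ∑ m ∈ s, g m x) (fun a => ∑ m ∈ s, g' m a) x := by
  refine (HasFDerivAt.fun_sum h).congr_fderiv ?_
  rw [Finset.sum_comm]
  simp only [Finset.sum_smul]

/-- The Kronecker symbol. -/
def kdel (a b : Fin n) : ℝ := if a = b then 1 else 0

theorem abs_kdel_le (a b : Fin n) : |kdel a b| ≤ 1 := by
  unfold kdel
  split_ifs <;> simp

theorem hasPd_coord (b : Fin n) (x : Euc n) : HasPd (fun x => x b) (fun a => kdel b a) x := by
  refine ((EuclideanSpace.proj b : Euc n →L[ℝ] ℝ).hasFDerivAt (x := x)).congr_fderiv ?_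
  simp [kdel]

theorem hasPd_heatKer (t : ℝ) (x : Euc n) :
    HasPd (fun x => heatKer n x t) (fun a => heatKer n x t * -(x a / (2 * t))) x := by
  have h1 : HasFDerivAt (fun x : Euc n => -‖x‖ ^ 2 / (4 * t))
      ((-1 / (4 * t)) • (2 • innerSL ℝ x)) x := by
    refine (((hasStrictFDerivAt_norm_sq x).hasFDerivAt).const_mul (-1 / (4 * t))).congr_of_eventuallyEq
      (Eventually.of_forall fun y => ?_)
    simp only
    ring
  refine ((h1.exp).const_mul ((4 * π * t) ^ (-(n : ℝ) / 2))).congr_fderiv ?_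
  refine ContinuousLinearMap.ext fun v => ?_
  simp only [smul_apply, sum_apply, innerSL_apply_apply, PiLp.inner_apply, PiLp.proj_apply, smul_eq_mul,
    heatKer, nsmul_eq_mul, Finset.mul_sum, RCLike.inner_apply, conj_trivial]
  refine Finset.sum_congr rfl fun a _ => ?_
  field_simp
  ring

theorem hasPd_integral {f : Euc n → ℝ → ℝ} {f' : Fin n → Euc n → ℝ → ℝ} {t : ℝ} (ht : 0 < t)
    (hf : ∀ x s, 0 < s → HasPd (fun x => f x s) (fun a => f' a x s) x)
    (hi : ∀ x, IntegrableOn (f x) (Set.Ioi 0))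
    (hm' : ∀ a x, AEStronglyMeasurable (f' a x) (volume.restrict (Set.Ioi 0)))
    (hb : ∀ R : ℝ, ∃ C : ℝ, ∀ a x s, ‖x‖ ≤ R → 0 < s → |f' a x s| ≤ C * (t + s) ^ (-2 : ℝ))
    (x : Euc n) :
    HasPd (fun x => ∫ s in Set.Ioi 0, f x s) (fun a => ∫ s in Set.Ioi 0, f' a x s) x ∧
      ∀ a, IntegrableOn (f' a x) (Set.Ioi 0) := by
  obtain ⟨C, hC⟩ := hb (‖x‖ + 1)
  have hint : IntegrableOn (fun s : ℝ => (t + s) ^ (-2 : ℝ)) (Set.Ioi 0) := by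
    simpa only [add_comm] using integrableOn_add_rpow_Ioi_of_lt (a := -2) (m := t) (c := 0)
      (by norm_num) (by linarith)
  have hfi : ∀ a, IntegrableOn (f' a x) (Set.Ioi 0) := fun a => by
    refine Integrable.mono' (hint.const_mul C) (hm' a x) ?_
    filter_upwards [ae_restrict_mem measurableSet_Ioi] with s hs
    exact hC a x s (by linarith) hs
  refine ⟨?_, hfi⟩
  have hmain := hasFDerivAt_integral_of_dominated_of_fderiv_le
    (μ := volume.restrict (Set.Ioi (0 : ℝ))) (s := Metric.ball x 1) (x₀ := x)
    (F := fun x s => f x s)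
    (F' := fun x s => ∑ a, f' a x s • (EuclideanSpace.proj a : Euc n →L[ℝ] ℝ))
    (bound := fun s => ∑ a, (C * (t + s) ^ (-2 : ℝ)) *
      ‖(EuclideanSpace.proj a : Euc n →L[ℝ] ℝ)‖)
    (Metric.ball_mem_nhds x one_pos)
    (Eventually.of_forall fun x => (hi x).1) (hi x)
    (Finset.aestronglyMeasurable_fun_sum _ fun a _ => (hm' a x).smul_const _)
    (by
      filter_upwards [ae_restrict_mem measurableSet_Ioi] with s hs y hy
      refine norm_sum_le_of_le _ fun a _ => ?_
      rw [norm_smul]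
      refine mul_le_mul_of_nonneg_right (hC a y s ?_ hs) (norm_nonneg _)
      have := norm_le_norm_add_norm_sub' y x
      rw [Metric.mem_ball, dist_eq_norm] at hy
      linarith)
    (integrable_finsetSum _ fun a _ => (hint.const_mul C).mul_const _)
    (by
      filter_upwards [ae_restrict_mem measurableSet_Ioi] with s hs y hy
      exact hf y s hs)
  refine hmain.congr_fderiv ?_
  rw [integral_finsetSum _ fun a _ => (hfi a).smul_const _]
  simp only [integral_smul_const]

end PartialDerivatives

section OseenKernel

variable {n : ℕ}

/-- The polynomial factor of the first derivatives of the heat kernel. -/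
def heatPd₁ (a : Fin n) (x : Euc n) (t : ℝ) : ℝ := -(x a / (2 * t))

/-- The polynomial factor of the second derivatives of the heat kernel. -/
def heatPd₂ (a b : Fin n) (x : Euc n) (t : ℝ) : ℝ := x a * x b / (4 * t ^ 2) - kdel a b / (2 * t)

/-- The polynomial factor of the third derivatives of the heat kernel. -/
def heatPd₃ (a b c : Fin n) (x : Euc n) (t : ℝ) : ℝ :=
  -(x a * x b * x c) / (8 * t ^ 3) +
    (kdel a b * x c + kdel b c * x a + kdel a c * x b) / (4 * t ^ 2)

theorem hasPd_heatKer_heatPd₁ (a : Fin n) (x : Euc n) {t : ℝ} (ht : 0 < t) :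
    HasPd (fun x => heatKer n x t * heatPd₁ a x t) (fun b => heatKer n x t * heatPd₂ a b x t) x := by
  have h : HasPd (fun x => heatPd₁ a x t) (fun b => -(1 / (2 * t)) * kdel a b) x := by
    refine HasPd.congr_fun ((hasPd_coord a x).const_mul (-(1 / (2 * t)))) fun y => ?_
    rw [heatPd₁]
    ring
  refine ((hasPd_heatKer t x).mul h).congr_deriv fun b => ?_
  rw [heatPd₁, heatPd₂]
  field_simp
  ring

theorem hasPd_heatKer_heatPd₂ (a b : Fin n) (x : Euc n) {t : ℝ} (ht : 0 < t) :
    HasPd (fun x => heatKer n x t * heatPd₂ a b x t)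
      (fun c => heatKer n x t * heatPd₃ a b c x t) x := by
  have h : HasPd (fun x => heatPd₂ a b x t)
      (fun c => 1 / (4 * t ^ 2) * (x a * kdel b c + x b * kdel a c) + 0) x := by
    refine HasPd.congr_fun ((((hasPd_coord a x).mul (hasPd_coord b x)).const_mul
      (1 / (4 * t ^ 2))).add (hasPd_const (-(kdel a b / (2 * t))) x)) fun y => ?_
    rw [heatPd₂]
    ring
  refine ((hasPd_heatKer t x).mul h).congr_deriv fun c => ?_
  rw [heatPd₂, heatPd₃]
  field_simp
  ring

theorem abs_heatPd₁_le (a : Fin n) (x : Euc n) {t R s : ℝ} (ht : 0 < t) (hx : ‖x‖ ≤ R)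
    (hts : t ≤ s) : |heatPd₁ a x s| ≤ R * s⁻¹ := by
  have hs : 0 < s := ht.trans_le hts
  have hR : 0 ≤ R := (norm_nonneg x).trans hx
  have ha := (PiLp.norm_apply_le x a).trans hx
  rw [Real.norm_eq_abs] at ha
  rw [heatPd₁, abs_neg, abs_div, abs_of_pos (show 0 < 2 * s by positivity), ← div_eq_mul_inv]
  gcongr
  linarith

theorem abs_heatPd₂_le (a b : Fin n) (x : Euc n) {t R s : ℝ} (ht : 0 < t) (hx : ‖x‖ ≤ R)
    (hts : t ≤ s) : |heatPd₂ a b x s| ≤ (R * R / t + 1) * s⁻¹ := by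
  have hs : 0 < s := ht.trans_le hts
  have hR : 0 ≤ R := (norm_nonneg x).trans hx
  have hc : ∀ a, |x a| ≤ R := fun a => (PiLp.norm_apply_le x a).trans hx
  have h1 : |x a * x b / (4 * s ^ 2)| ≤ R * R / (t * s) := by
    rw [abs_div, abs_mul, abs_of_pos (show 0 < 4 * s ^ 2 by positivity)]
    refine div_le_div₀ (by positivity) ?_ (by positivity) (by nlinarith)
    exact mul_le_mul (hc a) (hc b) (abs_nonneg _) hR
  have h2 : |kdel a b / (2 * s)| ≤ 1 / s := by
    rw [abs_div, abs_of_pos (show 0 < 2 * s by positivity)]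
    gcongr
    · exact abs_kdel_le a b
    · linarith
  refine (abs_sub _ _).trans ((add_le_add h1 h2).trans_eq ?_)
  field_simp

theorem abs_heatPd₃_le (a b c : Fin n) (x : Euc n) {t R s : ℝ} (ht : 0 < t) (hx : ‖x‖ ≤ R)
    (hts : t ≤ s) : |heatPd₃ a b c x s| ≤ (R * R * R / t ^ 2 + 3 * R / t) * s⁻¹ := by
  have hs : 0 < s := ht.trans_le hts
  have hR : 0 ≤ R := (norm_nonneg x).trans hx
  have hc : ∀ a, |x a| ≤ R := fun a => (PiLp.norm_apply_le x a).trans hx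
  have hk : ∀ a b c : Fin n, |kdel a b * x c| ≤ R := fun a b c => by
    rw [abs_mul, ← one_mul R]
    exact mul_le_mul (abs_kdel_le a b) (hc c) (abs_nonneg _) zero_le_one
  have h1 : |-(x a * x b * x c) / (8 * s ^ 3)| ≤ R * R * R / (t ^ 2 * s) := by
    rw [abs_div, abs_neg, abs_mul, abs_mul, abs_of_pos (show 0 < 8 * s ^ 3 by positivity)]
    refine div_le_div₀ (by positivity) ?_ (by positivity) ?_
    · gcongr
      · exact hc a
      · exact hc b
      · exact hc c
    · have : t ^ 2 * s ≤ s ^ 2 * s := by gcongr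
      nlinarith [pow_pos hs 3]
  have h2 : |(kdel a b * x c + kdel b c * x a + kdel a c * x b) / (4 * s ^ 2)| ≤
      3 * R / (t * s) := by
    rw [abs_div, abs_of_pos (show 0 < 4 * s ^ 2 by positivity)]
    refine div_le_div₀ (by positivity) ?_ (by positivity) (by nlinarith)
    refine (abs_add_three _ _ _).trans ?_
    linarith [hk a b c, hk b c a, hk a c b]
  refine (abs_add_le _ _).trans ((add_le_add h1 h2).trans_eq ?_)
  field_simp

theorem heatKer_le_inv (hn : 2 ≤ n) (x : Euc n) {t s : ℝ} (ht : 0 < t) (hts : t ≤ s) :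
    |heatKer n x s| ≤ (4 * π) ^ (-(n : ℝ) / 2) * t ^ (1 - (n : ℝ) / 2) * s⁻¹ := by
  have hs : 0 < s := ht.trans_le hts
  have hn' : (2 : ℝ) ≤ n := by exact_mod_cast hn
  rw [abs_of_nonneg (heatKer_nonneg n x hs)]
  refine (heatKer_le n x hs).trans ?_
  rw [Real.mul_rpow (by positivity) hs.le, mul_assoc,
    show -(n : ℝ) / 2 = (1 - (n : ℝ) / 2) + -1 by ring, Real.rpow_add hs, Real.rpow_neg_one]
  gcongr ?_ * (?_ * _)
  exact Real.rpow_le_rpow_of_nonpos ht hts (by linarith)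

theorem abs_heatKer_mul_le (hn : 2 ≤ n) (x : Euc n) {t s p E : ℝ} (ht : 0 < t) (hs : 0 < s)
    (hp : |p| ≤ E * (t + s)⁻¹) :
    |heatKer n x (t + s) * p| ≤
      ((4 * π) ^ (-(n : ℝ) / 2) * t ^ (1 - (n : ℝ) / 2) * E) * (t + s) ^ (-2 : ℝ) := by
  have hts : 0 < t + s := by positivity
  rw [abs_mul, show (-2 : ℝ) = -1 + -1 by norm_num, Real.rpow_add hts, Real.rpow_neg_one]
  refine (mul_le_mul (heatKer_le_inv hn x ht (by linarith : t ≤ t + s)) hp (abs_nonneg _)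
    (by positivity)).trans_eq ?_
  ring

/-- The polynomial factor of the time derivative of the Oseen kernel. -/
def oseenPoly (i j k : Fin n) (x : Euc n) (t : ℝ) : ℝ :=
  -(kdel i j * ∑ m, heatPd₃ m m k x t) + heatPd₃ j i k x t

theorem exists_Kten_eq (hn : 2 ≤ n) : ∃ c : ℝ, ∀ (i j k : Fin n) (x : Euc n) (t : ℝ), 0 < t →
    Kten n i j k x t =
      c * ∫ s in Set.Ioi 0, heatKer n x (t + s) * oseenPoly i j k x (t + s) := by
  obtain ⟨A, c, hΦ⟩ := exists_genPhi_eq hn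
  refine ⟨c, fun i j k x t ht => ?_⟩
  have hΦ' : (fun x => genPhi n x t) = fun x =>
      A + c * ∫ s in Set.Ioi 0, (heatKer n x (t + s) - heatRad n 1 s) := funext fun x => hΦ x t ht
  have hpos : ∀ {s : ℝ}, 0 < s → 0 < t + s := fun hs => add_pos ht hs
  have hmk : ∀ x, Measurable fun s => heatKer n x (t + s) := fun x =>
    (measurable_heatKer n).comp (measurable_const.prodMk (measurable_const_add t))
  have h0 : ∀ x : Euc n, IntegrableOn (fun s => heatKer n x (t + s) - heatRad n 1 s)
      (Set.Ioi 0) := fun x => by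
    have h := (integrable_potential hn x ht).integral_prod_right
    refine Integrable.congr h ?_
    filter_upwards [ae_restrict_mem measurableSet_Ioi] with s hs
    have hs0 : 0 < s := hs
    simp_rw [sub_mul]
    rw [integral_sub (integrable_heatRad_mul_heatKer n x hs0 ht)
      ((integrable_heatKer_sub n x ht).const_mul _), integral_const_mul,
      integral_heatKer_sub n x ht, mul_one]
    congr 1
    exact (integral_heatKer_mul_heatKer n x hs0 ht).trans (by rw [add_comm])
  have h1 := hasPd_integral (f := fun x s => heatKer n x (t + s) - heatRad n 1 s)
    (f' := fun a x s => heatKer n x (t + s) * heatPd₁ a x (t + s)) ht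
    (fun x s hs => (HasPd.congr_fun ((hasPd_heatKer (t + s) x).add
      (hasPd_const (-heatRad n 1 s) x)) fun y => sub_eq_add_neg _ _).congr_deriv fun a =>
      add_zero _) h0
    (fun a x => ((hmk x).mul (by unfold heatPd₁; fun_prop)).aestronglyMeasurable)
    (fun R => ⟨_, fun a x s hx hs => abs_heatKer_mul_le hn x ht hs
      (abs_heatPd₁_le a x ht hx (by linarith))⟩)
  have h2 := fun b => hasPd_integral
    (f := fun x s => heatKer n x (t + s) * heatPd₁ b x (t + s))
    (f' := fun a x s => heatKer n x (t + s) * heatPd₂ b a x (t + s)) ht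
    (fun x s hs => hasPd_heatKer_heatPd₁ b x (hpos hs)) (fun x => (h1 x).2 b)
    (fun a x => ((hmk x).mul (by unfold heatPd₂; fun_prop)).aestronglyMeasurable)
    (fun R => ⟨_, fun a x s hx hs => abs_heatKer_mul_le hn x ht hs
      (abs_heatPd₂_le b a x ht hx (by linarith))⟩)
  have h3 := fun b a => hasPd_integral
    (f := fun x s => heatKer n x (t + s) * heatPd₂ b a x (t + s))
    (f' := fun d x s => heatKer n x (t + s) * heatPd₃ b a d x (t + s)) ht
    (fun x s hs => hasPd_heatKer_heatPd₂ b a x (hpos hs)) (fun x => (h2 b x).2 a)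
    (fun d x => ((hmk x).mul (by unfold heatPd₃; fun_prop)).aestronglyMeasurable)
    (fun R => ⟨_, fun d x s hx hs => abs_heatKer_mul_le hn x ht hs
      (abs_heatPd₃_le b a d x ht hx (by linarith))⟩)
  have e1 : ∀ b, pd n b (fun x => genPhi n x t) = fun x =>
      c * ∫ s in Set.Ioi 0, heatKer n x (t + s) * heatPd₁ b x (t + s) := fun b => by
    funext x
    rw [hΦ', ((hasPd_const A x).add ((h1 x).1.const_mul c)).pd b, zero_add]
  have e2 : ∀ a b, pd n a (pd n b (fun x => genPhi n x t)) = fun x =>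
      c * ∫ s in Set.Ioi 0, heatKer n x (t + s) * heatPd₂ b a x (t + s) := fun a b => by
    funext x
    rw [e1, ((h2 b x).1.const_mul c).pd a]
  have e3 : (fun x => Kmat n i j x t) = fun x =>
      -(kdel i j) * ∑ m, (c * ∫ s in Set.Ioi 0, heatKer n x (t + s) * heatPd₂ m m x (t + s)) +
        c * ∫ s in Set.Ioi 0, heatKer n x (t + s) * heatPd₂ j i x (t + s) := by
    funext x
    rw [Kmat, lap]
    simp_rw [e2]
    unfold kdel
    split_ifs <;> simp
  rw [Kten, e3, (((HasPd.sum Finset.univ fun m _ => (h3 m m x).1.const_mul c).const_mul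
    (-(kdel i j))).add ((h3 j i x).1.const_mul c)).pd k]
  rw [← Finset.mul_sum, ← integral_finsetSum _ fun m _ => (h3 m m x).2 k, mul_left_comm, ← mul_add,
    ← integral_const_mul, ← integral_add]
  · congr 2
    funext s
    rw [oseenPoly, ← Finset.mul_sum]
    ring
  · exact (integrable_finsetSum _ fun m _ => (h3 m m x).2 k).const_mul _
  · exact (h3 j i x).2 k

end OseenKernel

section ChangeOfVariables

variable {n : ℕ} {Z : Type*} [MeasurableSpace Z]

theorem integral_comp_sub_smul (f : Euc n → ℝ) (a : Euc n) {b : ℝ} (hb : 0 < b) :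
    ∫ ξ, b ^ n * f (a - b • ξ) = ∫ y, f y := by
  rw [integral_const_mul, Measure.integral_comp_smul volume (fun y => f (a - y)) b,
    integral_sub_left_eq_self f volume a, finrank_euclideanSpace_fin, smul_eq_mul,
    abs_of_pos (by positivity), ← mul_assoc, mul_inv_cancel₀ (by positivity), one_mul]

theorem integrable_comp_sub_smul_iff (f : Euc n → ℝ) (a : Euc n) {b : ℝ} (hb : 0 < b) :
    (Integrable fun ξ => b ^ n * f (a - b • ξ)) ↔ Integrable f := by
  rw [integrable_const_mul_iff (IsUnit.mk0 _ (by positivity)),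
    integrable_comp_smul_iff volume (fun y => f (a - y)) hb.ne', integrable_comp_sub_left f a]

theorem integrable_prod_comp_sub_smul {ζ : Measure Z} [SFinite ζ] {F : Z × Euc n → ℝ}
    (hF : Measurable F) {a : Z → Euc n} {b : Z → ℝ} (hb : ∀ᵐ z ∂ζ, 0 < b z)
    (hint : Integrable (fun z : Z × Euc n => b z.1 ^ n * F (z.1, a z.1 - b z.1 • z.2))
      (ζ.prod volume)) :
    Integrable F (ζ.prod volume) ∧ ∫ z, F z ∂(ζ.prod volume) =
      ∫ z : Z × Euc n, b z.1 ^ n * F (z.1, a z.1 - b z.1 • z.2) ∂(ζ.prod volume) := by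
  obtain ⟨h1, h2⟩ := (integrable_prod_iff hint.1).1 hint
  have hFi : Integrable F (ζ.prod volume) := by
    refine (integrable_prod_iff hF.aestronglyMeasurable).2 ⟨?_, h2.congr ?_⟩
    · filter_upwards [hb, h1] with z hz h
      exact (integrable_comp_sub_smul_iff (fun y => F (z, y)) (a z) hz).1 h
    · filter_upwards [hb] with z hz
      rw [← integral_comp_sub_smul (fun y => ‖F (z, y)‖) (a z) hz]
      simp only [norm_mul, norm_pow, Real.norm_eq_abs, abs_of_pos hz]
  refine ⟨hFi, ?_⟩
  rw [integral_prod _ hFi, integral_prod _ hint]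
  refine integral_congr_ae ?_
  filter_upwards [hb] with z hz
  exact (integral_comp_sub_smul (fun y => F (z, y)) (a z) hz).symm

theorem setIntegral_Ioo_eq_smul (f : ℝ → ℝ) {t : ℝ} (ht : 0 < t) :
    ∫ s in Set.Ioo 0 t, f s = t * ∫ l in Set.Ioo (0 : ℝ) 1, f (t * (1 - l)) := by
  rw [← integral_Ioc_eq_integral_Ioo, ← integral_Ioc_eq_integral_Ioo,
    ← intervalIntegral.integral_of_le ht.le, ← intervalIntegral.integral_of_le zero_le_one,
    intervalIntegral.integral_comp_sub_left (fun l => f (t * l)) 1, sub_self, sub_zero,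
    intervalIntegral.mul_integral_comp_mul_left, mul_zero, mul_one]

theorem setIntegral_Ioi_add_eq_mul (f : ℝ → ℝ) {t : ℝ} (ht : 0 < t) :
    ∫ s in Set.Ioi 0, f (t + s) = t * ∫ ρ in Set.Ioi (1 : ℝ), f (t * ρ) := by
  rw [integral_comp_mul_left_Ioi f 1 ht, mul_one, smul_eq_mul, ← mul_assoc,
    mul_inv_cancel₀ ht.ne', one_mul, ← integral_indicator measurableSet_Ioi,
    ← integral_indicator measurableSet_Ioi,
    ← integral_add_left_eq_self (fun x => (Set.Ioi t).indicator f x) t]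
  refine integral_congr_ae (Eventually.of_forall fun s => ?_)
  simp [Set.indicator]

end ChangeOfVariables

section DuhamelTransform

variable {n : ℕ}

theorem heatKer_smul (x : Euc n) {b t : ℝ} (hb : 0 < b) (ht : 0 < t) :
    heatKer n (b • x) (t * b ^ 2) = (b ^ n)⁻¹ * heatKer n x t := by
  rw [heatKer, heatKer, show 4 * π * (t * b ^ 2) = b ^ 2 * (4 * π * t) by ring,
    Real.mul_rpow (by positivity) (by positivity), norm_smul, Real.norm_eq_abs, mul_pow, sq_abs,
    ← Real.rpow_natCast b 2, ← Real.rpow_mul hb.le, ← Real.rpow_natCast b n, ← Real.rpow_neg hb.le,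
    mul_assoc]
  congr 2
  · push_cast
    ring
  · congr 1
    rw [Real.rpow_natCast]
    field_simp

theorem heatPd₃_smul (i j k : Fin n) (x : Euc n) {b t : ℝ} (hb : 0 < b) (ht : 0 < t) :
    heatPd₃ i j k (b • x) (t * b ^ 2) = (b ^ 3)⁻¹ * heatPd₃ i j k x t := by
  simp only [heatPd₃, PiLp.smul_apply, smul_eq_mul]
  field_simp

theorem oseenPoly_smul (i j k : Fin n) (x : Euc n) {b t : ℝ} (hb : 0 < b) (ht : 0 < t) :
    oseenPoly i j k (b • x) (t * b ^ 2) = (b ^ 3)⁻¹ * oseenPoly i j k x t := by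
  simp only [oseenPoly, heatPd₃_smul _ _ _ x hb ht, ← Finset.mul_sum]
  ring

theorem measurable_oseenPoly (i j k : Fin n) :
    Measurable fun z : Euc n × ℝ => oseenPoly i j k z.1 z.2 := by
  unfold oseenPoly heatPd₃
  fun_prop

/-- The amplitude of the Oseen kernel in parabolic coordinates. -/
def oseenAmp (c : ℝ) (i j k : Fin n) (x : ℝ × Euc n) : ℝ :=
  c * (4 * π) ^ (-(n : ℝ) / 2) * x.1 ^ (n - 1) * oseenPoly i j k (x.1 • x.2) 1

theorem oseenAmp_hasTemperateGrowth (c : ℝ) (i j k : Fin n) :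
    (oseenAmp c i j k).HasTemperateGrowth := by
  have h1 : (fun x : ℝ × Euc n => x.1).HasTemperateGrowth :=
    (ContinuousLinearMap.fst ℝ ℝ (Euc n)).hasTemperateGrowth
  have hco : ∀ a : Fin n, (fun x : ℝ × Euc n => (x.1 • x.2) a).HasTemperateGrowth := fun a =>
    h1.mul ((EuclideanSpace.proj a : Euc n →L[ℝ] ℝ).comp
      (ContinuousLinearMap.snd ℝ ℝ (Euc n))).hasTemperateGrowth
  have hP : ∀ i j k : Fin n,
      (fun x : ℝ × Euc n => heatPd₃ i j k (x.1 • x.2) 1).HasTemperateGrowth := fun i j k => by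
    have := ((((hco i).mul (hco j)).mul (hco k)).mul
      (Function.HasTemperateGrowth.const (-(1 / 8) : ℝ))).add
      (((((hco k).mul (Function.HasTemperateGrowth.const (kdel i j))).add
        ((hco i).mul (Function.HasTemperateGrowth.const (kdel j k)))).add
        ((hco j).mul (Function.HasTemperateGrowth.const (kdel i k)))).mul
        (Function.HasTemperateGrowth.const (1 / 4 : ℝ)))
    refine (funext fun x => ?_ : (fun x : ℝ × Euc n => heatPd₃ i j k (x.1 • x.2) 1) = _) ▸ this
    rw [heatPd₃]
    simp only [Pi.add_apply, Pi.mul_apply]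
    ring
  refine (((Function.HasTemperateGrowth.const _).mul (h1.pow (n - 1)))).mul ?_
  refine (((Function.HasTemperateGrowth.const (kdel i j)).mul ?_).neg).add (hP j i k)
  exact Function.HasTemperateGrowth.sum fun m _ => hP m m k

theorem Kten_eq_integral {c : ℝ} (hc : ∀ (i j k : Fin n) (x : Euc n) (t : ℝ), 0 < t →
      Kten n i j k x t =
        c * ∫ s in Set.Ioi 0, heatKer n x (t + s) * oseenPoly i j k x (t + s))
    (i j k : Fin n) (x : Euc n) {t : ℝ} (ht : 0 < t) :
    Kten n i j k x t =
      c * (t * ∫ ρ in Set.Ioi (1 : ℝ), heatKer n x (t * ρ) * oseenPoly i j k x (t * ρ)) := by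
  rw [hc i j k x t ht,
    setIntegral_Ioi_add_eq_mul (fun s => heatKer n x s * oseenPoly i j k x s) ht]

theorem oseen_profile (c : ℝ) (hn : 2 ≤ n) (i j k : Fin n) (η : Euc n) {α t₀ τ l ρ : ℝ} (hα : 0 < α)
    (ht₀ : 0 < t₀) (hτ : 0 < τ) (hl : 0 < l) (hρ : 0 < ρ) :
    √(t₀ * (l * ρ * τ)) ^ n * (c * (t₀ / α ^ 2 * τ) * (t₀ / α ^ 2 * τ * l) *
      (heatKer n (√(t₀ * (l * ρ * τ)) • η) (t₀ / α ^ 2 * τ * l * ρ) *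
        oseenPoly i j k (√(t₀ * (l * ρ * τ)) • η) (t₀ / α ^ 2 * τ * l * ρ))) =
      √t₀ * (√τ * l ^ (-(1 / 2) : ℝ) * ρ ^ (-(3 / 2) : ℝ) *
        (Real.exp (gaussExp n (α, η)) * oseenAmp c i j k (α, η))) := by
  set b := √(t₀ * (l * ρ * τ)) with hb
  have hbpos : 0 < b := Real.sqrt_pos.2 (by positivity)
  have hb2 : b ^ 2 = t₀ * (l * ρ * τ) := Real.sq_sqrt (by positivity)
  have hbf : b = √t₀ * √l * √ρ * √τ := by
    rw [hb, Real.sqrt_mul ht₀.le, Real.sqrt_mul (by positivity), Real.sqrt_mul hl.le]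
    ring
  have e1 : b • η = (b / α) • (α • η) := by
    rw [smul_smul, div_mul_cancel₀ _ hα.ne']
  have e2 : t₀ / α ^ 2 * τ * l * ρ = 1 * (b / α) ^ 2 := by
    rw [div_pow, hb2]
    ring
  have e3 : heatKer n (α • η) 1 = (4 * π) ^ (-(n : ℝ) / 2) * Real.exp (gaussExp n (α, η)) := by
    rw [heatKer, gaussExp, norm_smul, Real.norm_eq_abs, mul_pow, sq_abs, mul_one, mul_one]
    congr 2
    exact neg_div _ _
  rw [e2, e1, heatKer_smul _ (div_pos hbpos hα) one_pos,
    oseenPoly_smul _ _ _ _ (div_pos hbpos hα) one_pos, e3, oseenAmp]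
  simp only
  obtain ⟨m, rfl⟩ : ∃ m, n = m + 1 := ⟨n - 1, by omega⟩
  have hl2 : l ^ (-(1 / 2) : ℝ) = (√l)⁻¹ := by
    rw [Real.rpow_neg hl.le, Real.sqrt_eq_rpow]
  have hρ2 : ρ ^ (-(3 / 2) : ℝ) = (√ρ)⁻¹ ^ 3 := by
    rw [Real.sqrt_eq_rpow, ← Real.rpow_neg hρ.le, ← Real.rpow_natCast, ← Real.rpow_mul hρ.le]
    norm_num
  have hst : √t₀ ^ 2 = t₀ := Real.sq_sqrt ht₀.le
  have hsτ : √τ ^ 2 = τ := Real.sq_sqrt hτ.le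
  have hsl : √l ^ 2 = l := Real.sq_sqrt hl.le
  have p1 : 0 < √t₀ := Real.sqrt_pos.2 ht₀
  have p2 : 0 < √τ := Real.sqrt_pos.2 hτ
  have p3 : 0 < √l := Real.sqrt_pos.2 hl
  have p4 : 0 < √ρ := Real.sqrt_pos.2 hρ
  have hpow : (b ^ (m + 1)) ≠ 0 := by positivity
  rw [hl2, hρ2, div_pow, div_pow, add_tsub_cancel_right]
  have key : c * (t₀ / α ^ 2 * τ) * (t₀ / α ^ 2 * τ * l) * (b ^ 3)⁻¹ =
      c * √t₀ * √τ * (√l)⁻¹ * (√ρ)⁻¹ ^ 3 / α ^ 4 := by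
    rw [hbf]
    nth_rewrite 1 2 [← hst]
    nth_rewrite 1 2 [← hsτ]
    nth_rewrite 1 [← hsl]
    field_simp
  have hαm : α ^ (m + 1) * α ^ 3 = α ^ m * α ^ 4 := by ring
  set P := oseenPoly i j k (α • η) 1
  set E := Real.exp (gaussExp (m + 1) (α, η))
  set Q := (4 * π) ^ (-((m + 1 : ℕ) : ℝ) / 2)
  calc _ = (c * (t₀ / α ^ 2 * τ) * (t₀ / α ^ 2 * τ * l) * (b ^ 3)⁻¹) *
        (b ^ (m + 1) * (b ^ (m + 1))⁻¹) * (α ^ (m + 1) * α ^ 3) * Q * E * P := by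
        rw [inv_div, inv_div]
        ring
    _ = _ := by
        rw [key, mul_inv_cancel₀ hpow, hαm]
        field_simp

end DuhamelTransform

section DuhamelFormula

variable {n : ℕ}

theorem integral_prod_assoc {A B Y : Type*} [MeasurableSpace A] [MeasurableSpace B]
    [MeasurableSpace Y] {μ : Measure A} {ν : Measure B} {κ : Measure Y} [SFinite μ] [SFinite ν]
    [SFinite κ] {F : (A × B) × Y → ℝ} (hF : Integrable F ((μ.prod ν).prod κ)) :
    (∀ᵐ a ∂μ, Integrable (fun y => ∫ b, F ((a, b), y) ∂ν) κ) ∧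
      Integrable (fun a => ∫ y, ∫ b, F ((a, b), y) ∂ν ∂κ) μ ∧
      ∫ z, F z ∂((μ.prod ν).prod κ) = ∫ a, ∫ y, ∫ b, F ((a, b), y) ∂ν ∂κ ∂μ := by
  have hmp := (measurePreserving_prodAssoc μ ν κ).symm
  have hI : Integrable (fun z : A × (B × Y) => F ((z.1, z.2.1), z.2.2)) (μ.prod (ν.prod κ)) :=
    (hmp.integrable_comp_emb (MeasurableEquiv.measurableEmbedding _)).2 hF
  have hint : ∫ z, F z ∂((μ.prod ν).prod κ) =
      ∫ z : A × (B × Y), F ((z.1, z.2.1), z.2.2) ∂(μ.prod (ν.prod κ)) :=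
    (hmp.integral_comp (MeasurableEquiv.measurableEmbedding _) F).symm
  have hae := hI.prod_right_ae
  have hswap : ∀ᵐ a ∂μ, ∫ z : B × Y, F ((a, z.1), z.2) ∂(ν.prod κ) =
      ∫ y, ∫ b, F ((a, b), y) ∂ν ∂κ := by
    filter_upwards [hae] with a ha
    exact integral_prod_symm _ ha
  refine ⟨?_, hI.integral_prod_left.congr hswap, ?_⟩
  · filter_upwards [hae] with a ha
    exact ha.integral_prod_right
  · rw [hint, integral_prod _ hI]
    exact integral_congr_ae hswap

theorem duhOp_fn {M : ℝ × Euc n → ℝ} (hM : M.HasTemperateGrowth) {p : Euc n × ℝ}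
    (hp : p ∈ parDom n) (f : BM (Euc n × ℝ)) (q : Euc n × ℝ) :
    let μ : Measure ((ℝ × ℝ) × Euc n) := (((volume.restrict (Set.Ioo 0 1)).prod
      (volume.restrict (Set.Ioi 1))).prod volume)
    let G := fun z => gaussKer n M (duhWeight n 0) (duhShift n) p q z * f.fn (duhPoint n (q, z))
    Integrable G μ ∧ (duhOp M 0 p f).fn q = ∫ z, G z ∂μ := by
  intro μ G
  have hk := (smoothKer_duh hM).goodKer hp
  have hG : Integrable G ((volume : Measure (ℝ × ℝ)).prod volume) :=
    hk.integrable_mul (measurable_duhPoint n) f q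
  have hμ : μ = ((volume : Measure (ℝ × ℝ)).prod volume).restrict
      ((Set.Ioo 0 1 ×ˢ Set.Ioi 1) ×ˢ Set.univ) := by
    rw [← Measure.prod_restrict, Measure.volume_eq_prod, ← Measure.prod_restrict,
      Measure.restrict_univ]
  rw [hμ]
  refine ⟨hG.restrict, ?_⟩
  rw [setIntegral_eq_integral_of_forall_compl_eq_zero]
  · exact kerOp_fn hk f q
  · intro z hz
    have : (q.2, z.1) ∉ duhSet := fun h => hz ⟨h.2, Set.mem_univ _⟩
    simp only [G, gaussKer, duhWeight, Set.indicator_of_notMem this, zero_mul]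

theorem duhOp_eq {c : ℝ} (hc : ∀ (i j k : Fin n) (x : Euc n) (t : ℝ), 0 < t →
      Kten n i j k x t =
        c * ∫ s in Set.Ioi 0, heatKer n x (t + s) * oseenPoly i j k x (t + s))
    (hn : 2 ≤ n) (i j k : Fin n) {h : Euc n} {α t₀ τ : ℝ} (hp : (h, α) ∈ parDom n) (ht₀ : 0 < t₀)
    (hτ : τ ∈ Set.Ioo (0 : ℝ) 1) (X : Euc n) (f : BM (Euc n × ℝ)) {g : Euc n → ℝ → ℝ}
    (hg : Measurable fun z : Euc n × ℝ => g z.1 z.2)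
    (hfg : ∀ Y, ∀ σ ∈ Set.Ioo 0 τ,
      f.fn (Y, σ) = t₀ * g (√t₀ • (Y + σ • h)) (t₀ / α ^ 2 * σ)) :
    let x' := √t₀ • (X + τ • h)
    let t' := t₀ / α ^ 2 * τ
    (∀ᵐ l ∂(volume.restrict (Set.Ioo (0 : ℝ) 1)),
      Integrable fun y => Kten n i j k (x' - y) (t' * l) * g y (t' * (1 - l))) ∧
    IntegrableOn (fun l => ∫ y, Kten n i j k (x' - y) (t' * l) * g y (t' * (1 - l)))
      (Set.Ioo 0 1) ∧
    (duhOp (oseenAmp c i j k) 0 (h, α) f).fn (X, τ) = √t₀ * (t' * ∫ l in Set.Ioo (0 : ℝ) 1,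
      ∫ y, Kten n i j k (x' - y) (t' * l) * g y (t' * (1 - l))) := by
  intro x' t'
  have hα : 0 < α := lt_trans (by norm_num) hp.2.1
  have ht' : 0 < t' := mul_pos (by positivity) hτ.1
  have hst : √t₀ * √t₀ = t₀ := Real.mul_self_sqrt ht₀.le
  have hs0 : 0 < √t₀ := Real.sqrt_pos.2 ht₀
  obtain ⟨hGi, hGe⟩ := duhOp_fn (oseenAmp_hasTemperateGrowth c i j k) hp f (X, τ)
  set μ : Measure (ℝ × ℝ) := (volume.restrict (Set.Ioo 0 1)).prod (volume.restrict (Set.Ioi 1))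
    with hμ
  set G := fun z : (ℝ × ℝ) × Euc n =>
    gaussKer n (oseenAmp c i j k) (duhWeight n 0) (duhShift n) (h, α) (X, τ) z *
      f.fn (duhPoint n ((X, τ), z)) with hG
  let F : (ℝ × ℝ) × Euc n → ℝ := fun z => c * t' * (t' * z.1.1) *
    (heatKer n (x' - z.2) (t' * z.1.1 * z.1.2) * oseenPoly i j k (x' - z.2) (t' * z.1.1 * z.1.2)) *
    g z.2 (t' * (1 - z.1.1))
  let b : ℝ × ℝ → ℝ := fun z => √(t₀ * (z.1 * z.2 * τ))
  let a : ℝ × ℝ → Euc n := fun z => √t₀ • (X + (τ * (1 - z.1)) • h)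
  have hmem : ∀ᵐ z ∂μ, z.1 ∈ Set.Ioo (0 : ℝ) 1 ∧ z.2 ∈ Set.Ioi (1 : ℝ) := by
    rw [hμ, Measure.prod_restrict]
    exact (ae_restrict_mem (measurableSet_Ioo.prod measurableSet_Ioi)).mono fun z hz => hz
  have hF : Measurable F := by
    have h1 := (measurable_heatKer n).comp (f := fun z : (ℝ × ℝ) × Euc n =>
      (x' - z.2, t' * z.1.1 * z.1.2)) (by fun_prop)
    have h2 := (measurable_oseenPoly i j k).comp (f := fun z : (ℝ × ℝ) × Euc n =>
      (x' - z.2, t' * z.1.1 * z.1.2)) (by fun_prop)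
    have h3 := hg.comp (f := fun z : (ℝ × ℝ) × Euc n => (z.2, t' * (1 - z.1.1))) (by fun_prop)
    exact ((by fun_prop : Measurable fun z : (ℝ × ℝ) × Euc n => c * t' * (t' * z.1.1)).mul
      (h1.mul h2)).mul h3
  have hb : ∀ᵐ z ∂μ, 0 < b z := hmem.mono fun z hz => by
    have := hz.1.1
    have : 0 < z.2 := one_pos.trans hz.2
    have := hτ.1
    exact Real.sqrt_pos.2 (by positivity)
  have hpt : ∀ᵐ z ∂(μ.prod (volume : Measure (Euc n))),
      b z.1 ^ n * F (z.1, a z.1 - b z.1 • z.2) = (√t₀)⁻¹ * G z := by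
    filter_upwards [Measure.quasiMeasurePreserving_fst.ae hmem] with z hz
    obtain ⟨⟨l, ρ⟩, ξ⟩ := z
    obtain ⟨hl, hρ⟩ := hz
    simp only at hl hρ
    have hρ0 : 0 < ρ := one_pos.trans hρ
    have hl0 := hl.1
    have hτ0 := hτ.1
    have hS : ((X, τ).2, (l, ρ)) ∈ duhSet := ⟨hτ, hl, hρ⟩
    set η := ξ + √(l * τ / ρ) • h with hη
    have hbs : √(t₀ * (l * ρ * τ)) = √t₀ * √(l * ρ * τ) := Real.sqrt_mul ht₀.le _
    have hbl : √(t₀ * (l * ρ * τ)) * √(l * τ / ρ) = √t₀ * (l * τ) := by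
      rw [hbs, mul_assoc, ← Real.sqrt_mul (by positivity),
        show l * ρ * τ * (l * τ / ρ) = (l * τ) ^ 2 by field_simp, Real.sqrt_sq (by positivity)]
    have e1 : x' - (a (l, ρ) - b (l, ρ) • ξ) = √(t₀ * (l * ρ * τ)) • η := by
      simp only [x', a, b, hη]
      rw [smul_add (√(t₀ * (l * ρ * τ))), smul_smul, hbl]
      module
    have e2 : a (l, ρ) - b (l, ρ) • ξ =
        √t₀ • ((X - √(l * ρ * τ) • ξ) + (τ * (1 - l)) • h) := by
      simp only [a, b, hbs]
      module
    have e3 : f.fn (duhPoint n ((X, τ), ((l, ρ), ξ))) =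
        t₀ * g (a (l, ρ) - b (l, ρ) • ξ) (t' * (1 - l)) := by
      rw [e2, duhPoint, hfg _ (τ * (1 - l)) ⟨mul_pos hτ0 (by linarith [hl.2]), by nlinarith⟩,
        ← mul_assoc (t₀ / α ^ 2)]
    simp only [F, e1, hG, e3]
    have := oseen_profile c hn i j k η hα ht₀ hτ0 hl0 hρ0
    rw [gaussKer, duhWeight, duhShift, Set.indicator_of_mem hS, Set.indicator_of_mem hS]
    simp only [zero_mul, neg_zero, Real.exp_zero, mul_one, ← hη]
    rw [← mul_assoc, this]
    nth_rewrite 3 [← hst]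
    field_simp
  obtain ⟨hFi, hFe⟩ := integrable_prod_comp_sub_smul hF hb
    ((hGi.const_mul (√t₀)⁻¹).congr (hpt.mono fun z hz => hz.symm))
  rw [integral_congr_ae hpt, integral_const_mul, ← hGe] at hFe
  obtain ⟨h1, h2, h3⟩ := integral_prod_assoc hFi
  have hinner : ∀ l, 0 < l → ∀ y, ∫ ρ in Set.Ioi 1, F ((l, ρ), y) =
      t' * (Kten n i j k (x' - y) (t' * l) * g y (t' * (1 - l))) := fun l hl y => by
    rw [Kten_eq_integral hc i j k (x' - y) (mul_pos ht' hl)]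
    simp only [F]
    rw [integral_mul_const, integral_const_mul]
    ring
  have hae : ∀ᵐ l ∂(volume.restrict (Set.Ioo (0 : ℝ) 1)), l ∈ Set.Ioo (0 : ℝ) 1 :=
    ae_restrict_mem measurableSet_Ioo
  have hinner' : ∀ᵐ l ∂(volume.restrict (Set.Ioo (0 : ℝ) 1)),
      (∫ y, ∫ ρ in Set.Ioi 1, F ((l, ρ), y)) =
        t' * ∫ y, Kten n i j k (x' - y) (t' * l) * g y (t' * (1 - l)) := by
    filter_upwards [hae] with l hl
    rw [← integral_const_mul]
    exact integral_congr_ae (Eventually.of_forall fun y => hinner l hl.1 y)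
  refine ⟨?_, ?_, ?_⟩
  · filter_upwards [hae, h1] with l hl hi
    rw [← integrable_const_mul_iff (IsUnit.mk0 _ ht'.ne')]
    exact hi.congr (Eventually.of_forall fun y => hinner l hl.1 y)
  · rw [IntegrableOn, ← integrable_const_mul_iff (IsUnit.mk0 _ ht'.ne')]
    exact h2.congr hinner'
  · rw [h3, integral_congr_ae hinner', integral_const_mul] at hFe
    rw [hFe, ← mul_assoc, mul_inv_cancel₀ hs0.ne', one_mul]

theorem heatOp_eq {h : Euc n} {α t₀ τ : ℝ} (hp : (h, α) ∈ parDom n) (ht₀ : 0 < t₀)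
    (hτ : τ ∈ Set.Ioo (0 : ℝ) 1) (X : Euc n) (f : BM (Euc n)) {g : Euc n → ℝ}
    (hfg : ∀ Y, f.fn Y = √t₀ * g (√t₀ • Y)) :
    (heatOp (h, α) f).fn (X, τ) =
      √t₀ * ∫ y, heatKer n (√t₀ • (X + τ • h) - y) (t₀ / α ^ 2 * τ) * g y := by
  have hα : 0 < α := lt_trans (by norm_num) hp.2.1
  have hτ0 := hτ.1
  have hs0 : 0 < √t₀ := Real.sqrt_pos.2 ht₀
  have hk := (smoothKer_heat n).goodKer hp
  have hb : 0 < √(t₀ * τ) := Real.sqrt_pos.2 (by positivity)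
  have hbs : √(t₀ * τ) = √t₀ * √τ := Real.sqrt_mul ht₀.le _
  rw [heatOp, kerOp_fn hk f (X, τ),
    integral_prod _ (hk.integrable_mul (measurable_heatPoint n) f (X, τ)), integral_dirac,
    ← integral_comp_sub_smul (fun y => heatKer n (√t₀ • (X + τ • h) - y) (t₀ / α ^ 2 * τ) * g y)
      (√t₀ • X) hb, ← integral_const_mul]
  refine integral_congr_ae (Eventually.of_forall fun ξ => ?_)
  simp only [gaussKer, heatWeight, heatShift, heatPoint, Set.indicator_of_mem hτ, hfg,
    one_mul]
  have e1 : √t₀ • (X + τ • h) - (√t₀ • X - √(t₀ * τ) • ξ) =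
      (√(t₀ * τ) / α) • (α • (ξ + √τ • h)) := by
    rw [smul_smul, div_mul_cancel₀ _ hα.ne', smul_add (√(t₀ * τ)), smul_smul, hbs,
      mul_assoc, Real.mul_self_sqrt hτ0.le]
    module
  have e2 : t₀ / α ^ 2 * τ = 1 * (√(t₀ * τ) / α) ^ 2 := by
    rw [div_pow, Real.sq_sqrt (by positivity)]
    ring
  have e3 : √t₀ • (X - √τ • ξ) = √t₀ • X - √(t₀ * τ) • ξ := by
    rw [hbs]
    module
  have e4 : heatKer n (α • (ξ + √τ • h)) 1 =
      (4 * π) ^ (-(n : ℝ) / 2) * Real.exp (gaussExp n (α, ξ + √τ • h)) := by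
    rw [heatKer, gaussExp, norm_smul, Real.norm_eq_abs, mul_pow, sq_abs, mul_one, mul_one]
    congr 2
    exact neg_div _ _
  rw [e1, e2, heatKer_smul _ (div_pos hb hα) one_pos, e3, e4, heatAmp, div_pow]
  have hbn : √(t₀ * τ) ^ n ≠ 0 := by positivity
  field_simp

end DuhamelFormula

section ScaledSolution

variable {n : ℕ}

theorem duhOp_fn_eq_zero {M : ℝ × Euc n → ℝ} (hM : M.HasTemperateGrowth) {p : Euc n × ℝ}
    (hp : p ∈ parDom n) (f : BM (Euc n × ℝ)) {q : Euc n × ℝ} (hq : q.2 ∉ Set.Ioo (0 : ℝ) 1) :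
    (duhOp M 0 p f).fn q = 0 := by
  rw [duhOp, kerOp_fn ((smoothKer_duh hM).goodKer hp)]
  refine integral_eq_zero_of_ae (Eventually.of_forall fun z => ?_)
  have : (q.2, z.1) ∉ duhSet := fun h => hq h.1
  simp only [gaussKer, duhWeight, Set.indicator_of_notMem this, zero_mul, Pi.zero_apply]

theorem heatOp_fn_eq_zero {p : Euc n × ℝ} (hp : p ∈ parDom n) (f : BM (Euc n)) {q : Euc n × ℝ}
    (hq : q.2 ∉ Set.Ioo (0 : ℝ) 1) : (heatOp p f).fn q = 0 := by
  rw [heatOp, kerOp_fn ((smoothKer_heat n).goodKer hp)]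
  refine integral_eq_zero_of_ae (Eventually.of_forall fun z => ?_)
  simp only [gaussKer, heatWeight, Set.indicator_of_notMem hq, zero_mul, Pi.zero_apply]

theorem exists_scaledData {u₀ : Euc n → Euc n} {N : ℝ} (hu₀ : Measurable u₀)
    (hN : ∀ x, ‖u₀ x‖ ≤ N) (t₀ : ℝ) : ∃ w : Fin n → BM (Euc n),
      (∀ i X, (w i).fn X = √t₀ * u₀ (√t₀ • X) i) ∧ ‖w‖ ≤ √t₀ * N := by
  have hb : ∀ i X, |√t₀ * u₀ (√t₀ • X) i| ≤ √t₀ * N := fun i X => by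
    rw [abs_mul, abs_of_nonneg (Real.sqrt_nonneg _)]
    exact mul_le_mul_of_nonneg_left ((PiLp.norm_apply_le _ i).trans (hN _)) (Real.sqrt_nonneg _)
  have hN0 : 0 ≤ √t₀ * N := mul_nonneg (Real.sqrt_nonneg _) ((norm_nonneg _).trans (hN 0))
  have hm : ∀ i, Measurable fun X : Euc n => √t₀ * u₀ (√t₀ • X) i := fun i => by fun_prop
  refine ⟨fun i => BM.mk' (fun X => √t₀ * u₀ (√t₀ • X) i) (hm i) (√t₀ * N) (hb i),
    fun i X => by simp, (pi_norm_le_iff_of_nonneg hN0).2 fun i => BM.norm_le hN0 fun X => ?_⟩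
  simpa using hb i X

/-- The rescaled solution, in coordinates moving with velocity `h`, extended by zero outside its
time interval of existence. -/
theorem exists_scaledSol {u : Euc n → ℝ → Euc n} {U T : ℝ}
    (hu : Measurable (fun q : Euc n × ℝ => u q.1 q.2))
    (hU : ∀ x : Euc n, ∀ t ∈ Set.Ioo (0 : ℝ) T, ‖u x t‖ ≤ U) (hT : 0 < T) {t₀ : ℝ} (ht₀ : 0 < t₀)
    (h : Euc n) {r : ℝ} (hr : 0 < r) : ∃ v : VF n, ∀ i q, (v i).fn q =
      (Set.Ioo 0 (min 1 (T / (t₀ * r)))).indicator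
        (fun τ => √t₀ * u (√t₀ • (q.1 + τ • h)) (t₀ * r * τ) i) q.2 := by
  have hU0 : 0 ≤ U := (norm_nonneg _).trans (hU 0 (T / 2) ⟨by linarith, by linarith⟩)
  have hm : ∀ i, Measurable fun q : Euc n × ℝ => (Set.Ioo 0 (min 1 (T / (t₀ * r)))).indicator
        (fun τ => √t₀ * u (√t₀ • (q.1 + τ • h)) (t₀ * r * τ) i) q.2 := fun i => by
    have h1 := hu.comp (f := fun q : Euc n × ℝ => (√t₀ • (q.1 + q.2 • h), t₀ * r * q.2))
      (by fun_prop)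
    have h2 : Measurable fun q : Euc n × ℝ => √t₀ * u (√t₀ • (q.1 + q.2 • h)) (t₀ * r * q.2) i :=
      (((EuclideanSpace.proj i : Euc n →L[ℝ] ℝ).measurable).comp h1).const_mul _
    exact h2.indicator (measurableSet_Ioo.preimage measurable_snd)
  have hb : ∀ i (q : Euc n × ℝ), |(Set.Ioo 0 (min 1 (T / (t₀ * r)))).indicator
        (fun τ => √t₀ * u (√t₀ • (q.1 + τ • h)) (t₀ * r * τ) i) q.2| ≤ √t₀ * U := fun i q => by
    rw [Set.indicator]
    split_ifs with hq
    · rw [abs_mul, abs_of_nonneg (Real.sqrt_nonneg _)]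
      refine mul_le_mul_of_nonneg_left ((PiLp.norm_apply_le _ i).trans (hU _ _ ⟨?_, ?_⟩))
        (Real.sqrt_nonneg _)
      · have := hq.1
        positivity
      · have := (lt_min_iff.1 hq.2).2
        rw [lt_div_iff₀ (by positivity)] at this
        linarith
    · rw [abs_zero]
      exact mul_nonneg (Real.sqrt_nonneg _) hU0
  exact ⟨fun i => BM.mk' _ (hm i) (√t₀ * U) (hb i), fun i q => by simp⟩

theorem IsMildNS.nsMap_eq_zero {c : ℝ}
    (hc : ∀ (i j k : Fin n) (x : Euc n) (t : ℝ), 0 < t → Kten n i j k x t =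
        c * ∫ s in Set.Ioi 0, heatKer n x (t + s) * oseenPoly i j k x (t + s))
    (hn : 2 ≤ n) {u₀ : Euc n → Euc n} {u : Euc n → ℝ → Euc n} {T : ℝ}
    (hu : Measurable (fun q : Euc n × ℝ => u q.1 q.2)) (hmild : IsMildNS n 0 T u₀ u)
    {t₀ : ℝ} (ht₀ : 0 < t₀) {h : Euc n} {r : ℝ} (hr : 0 < r) (hp : parMap n (h, r) ∈ parDom n)
    {w : Fin n → BM (Euc n)} (hw : ∀ i X, (w i).fn X = √t₀ * u₀ (√t₀ • X) i)
    {v : VF n} (hv : ∀ i q, (v i).fn q = (Set.Ioo 0 (min 1 (T / (t₀ * r)))).indicator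
        (fun τ => √t₀ * u (√t₀ • (q.1 + τ • h)) (t₀ * r * τ) i) q.2)
    (i : Fin n) {q : Euc n × ℝ} (hq : q.2 ∈ Set.Ioo (0 : ℝ) 1 → q.2 < T / (t₀ * r)) :
    (nsMap (oseenAmp c) (((h, r), w), v) i).fn q = 0 := by
  have hM := oseenAmp_hasTemperateGrowth (n := n) c
  obtain ⟨X, τ⟩ := q
  simp only [nsMap, BM.add_fn, BM.sub_fn, BM.sum_fn]
  by_cases hτ : τ ∈ Set.Ioo (0 : ℝ) 1
  · have hα : t₀ / (r ^ (-(1 / 2) : ℝ)) ^ 2 = t₀ * r := by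
      rw [← Real.rpow_natCast, ← Real.rpow_mul hr.le, div_eq_mul_inv, ← Real.rpow_neg hr.le]
      norm_num
    simp only [parMap] at hp ⊢
    replace hq := hq hτ
    have hτθ : τ < min 1 (T / (t₀ * r)) := lt_min hτ.2 hq
    have hτ0 := hτ.1
    have key : ∀ j k, _ := fun j k => duhOp_eq hc hn i j k hp ht₀ hτ X (v k * v j)
      (g := fun y s => u y s k * u y s j)
      ((((EuclideanSpace.proj k : Euc n →L[ℝ] ℝ).measurable).comp hu).mul
        (((EuclideanSpace.proj j : Euc n →L[ℝ] ℝ).measurable).comp hu))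
      (fun Y σ hσ => by
        have hσ' : σ ∈ Set.Ioo 0 (min 1 (T / (t₀ * r))) := ⟨hσ.1, hσ.2.trans hτθ⟩
        simp only [BM.mul_fn, hv, Set.indicator_of_mem hσ', hα]
        linear_combination (u (√t₀ • (Y + σ • h)) (t₀ * r * σ) k *
          u (√t₀ • (Y + σ • h)) (t₀ * r * σ) j) * Real.mul_self_sqrt ht₀.le)
    simp only [hα] at key
    set x' := √t₀ • (X + τ • h)
    set t' := t₀ * r * τ
    have ht' : 0 < t' := by positivity
    have ht'T : t' < T := by
      rw [lt_div_iff₀ (by positivity)] at hq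
      simp only [t']
      linarith
    have hvτ : (v i).fn (X, τ) = √t₀ * u x' t' i := by
      rw [hv]
      exact Set.indicator_of_mem (s := Set.Ioo 0 (min 1 (T / (t₀ * r)))) ⟨hτ0, hτθ⟩ _
    rw [heatOp_eq hp ht₀ hτ X (w i) (g := fun y => u₀ y i) (hw i), hα, hvτ,
      hmild x' t' ⟨ht', ht'T⟩ i, setIntegral_Ioo_eq_smul _ ht']
    have hae : ∀ᵐ l ∂(volume.restrict (Set.Ioo (0 : ℝ) 1)),
        (∫ y, ∑ j, ∑ k, Kten n i j k (x' - y) (t' - t' * (1 - l)) * u y (t' * (1 - l)) k *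
          u y (t' * (1 - l)) j) =
        ∑ j, ∑ k, ∫ y, Kten n i j k (x' - y) (t' * l) *
          (u y (t' * (1 - l)) k * u y (t' * (1 - l)) j) := by
      have := ae_all_iff.2 fun j => ae_all_iff.2 fun k => (key j k).1
      filter_upwards [this] with l hl
      rw [show t' - t' * (1 - l) = t' * l by ring]
      simp only [mul_assoc] at hl ⊢
      rw [integral_finsetSum _ fun j _ => integrable_finsetSum _ fun k _ => hl j k]
      exact Finset.sum_congr rfl fun j _ => integral_finsetSum _ fun k _ => hl j k
    rw [integral_congr_ae hae,
      integral_finsetSum _ fun j _ => integrable_finsetSum _ fun k _ => (key j k).2.1]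
    simp only [integral_finsetSum _ fun k _ => (key _ k).2.1, (key _ _).2.2, sub_zero,
      Finset.mul_sum]
    rw [mul_sub, Finset.mul_sum]
    simp only [Finset.mul_sum]
    exact (fun a b => by ring : ∀ a b : ℝ, a - b - a + b = 0) _ _
  · have hτ' : τ ∉ Set.Ioo 0 (min 1 (T / (t₀ * r))) := fun h =>
      hτ ⟨h.1, h.2.trans_le (min_le_left _ _)⟩
    rw [heatOp_fn_eq_zero hp _ hτ, hv, Set.indicator_of_notMem hτ']
    simp [duhOp_fn_eq_zero (hM i _ _) hp _ (q := (X, τ)) hτ]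

end ScaledSolution

section MixedDerivatives

variable {E F G : Type*} [NormedAddCommGroup E] [NormedSpace ℝ E] [NormedAddCommGroup F]
  [NormedSpace ℝ F] [NormedAddCommGroup G] [NormedSpace ℝ G]

theorem iteratedFDeriv_comp_affine {f : F → G} (L : E →L[ℝ] F) (c : F) {m : ℕ} {p : E}
    (hf : ContDiffAt ℝ m f (L p + c)) :
    iteratedFDeriv ℝ m (fun p => f (L p + c)) p =
      (iteratedFDeriv ℝ m f (L p + c)).compContinuousLinearMap fun _ => L := by
  have hf' : ContDiffAt ℝ m (fun y => f (y + c)) (L p) :=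
    ContDiffAt.comp (g := f) (L p) hf (contDiffAt_id.add contDiffAt_const)
  obtain ⟨s, hs, hso, hps⟩ := eventually_nhds_iff.1 (hf'.eventually (by simp))
  have hon : ContDiffOn ℝ m (fun y => f (y + c)) s := fun y hy => (hs y hy).contDiffWithinAt
  have hpre : IsOpen (L ⁻¹' s) := hso.preimage L.continuous
  have := L.iteratedFDerivWithin_comp_right hon hso.uniqueDiffOn hpre.uniqueDiffOn hps le_rfl
  rw [iteratedFDerivWithin_of_isOpen m hpre hps, iteratedFDerivWithin_of_isOpen m hso hps,
    iteratedFDeriv_comp_add_right] at this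
  exact this

theorem norm_iteratedFDeriv_iteratedDeriv_le (k l : ℕ) : ∀ {φ : E × ℝ → ℝ} {g : E → ℝ → ℝ}
    {c : E × ℝ} {x : E} {t β γ : ℝ}, ContDiffAt ℝ (k + l : ℕ) φ ((β • x, γ * t) + c) →
    (∀ᶠ z in 𝓝 (x, t), g z.1 z.2 = φ ((β • z.1, γ * z.2) + c)) →
    ‖iteratedFDeriv ℝ k (fun y => iteratedDeriv l (g y) t) x‖ ≤
      |β| ^ k * |γ| ^ l * ‖iteratedFDeriv ℝ (k + l) φ ((β • x, γ * t) + c)‖ := by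
  induction l with
  | zero =>
    intro φ g c x t β γ hφ hg
    have h1 : (fun y => iteratedDeriv 0 (g y) t) =ᶠ[𝓝 x]
        fun y => φ ((β • ContinuousLinearMap.inl ℝ E ℝ) y + ((0, γ * t) + c)) := by
      have ht : Tendsto (fun y : E => (y, t)) (𝓝 x) (𝓝 (x, t)) :=
        (Continuous.prodMk_left t).tendsto x
      filter_upwards [ht.eventually hg] with y hy
      rw [iteratedDeriv_zero, hy, ← add_assoc]
      simp
    have h2 : (β • ContinuousLinearMap.inl ℝ E ℝ) x + ((0, γ * t) + c) =
        (β • x, γ * t) + c := by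
      rw [← add_assoc]
      simp
    rw [(Filter.EventuallyEq.iteratedFDeriv ℝ h1 k).eq_of_nhds, iteratedFDeriv_comp_affine _ _ (by rw [h2]; exact hφ), h2]
    refine (ContinuousMultilinearMap.norm_compContinuousLinearMap_le _ _).trans ?_
    rw [pow_zero, mul_one, add_zero, mul_comm, Finset.prod_const, Finset.card_univ, Fintype.card_fin]
    gcongr
    refine (norm_smul_le β (ContinuousLinearMap.inl ℝ E ℝ)).trans ?_
    have := ContinuousLinearMap.norm_inl_le_one ℝ E ℝ
    rw [Real.norm_eq_abs]
    nlinarith [abs_nonneg β]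
  | succ l ih =>
    intro φ g c x t β γ hφ hg
    set p := (β • x, γ * t) + c with hp
    let D : (E × ℝ →L[ℝ] ℝ) →L[ℝ] ℝ := γ • ContinuousLinearMap.apply ℝ ℝ ((0, 1) : E × ℝ)
    have hD : ‖D‖ ≤ |γ| := by
      refine ContinuousLinearMap.opNorm_le_bound _ (abs_nonneg _) fun f => ?_
      have h1 : ‖f (0, 1)‖ ≤ ‖f‖ := by
        refine (f.le_opNorm _).trans ?_
        simp [Prod.norm_def]
      have h2 : D f = γ * f (0, 1) := rfl
      rw [h2, norm_mul, Real.norm_eq_abs]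
      exact mul_le_mul_of_nonneg_left h1 (abs_nonneg _)
    have hφ' : ContDiffAt ℝ (k + l : ℕ) (fderiv ℝ φ) p :=
      hφ.fderiv_right (by norm_cast)
    have hdiff : ∀ᶠ q in 𝓝 p, DifferentiableAt ℝ φ q := by
      have hφ1 : ContDiffAt ℝ 1 φ p := hφ.of_le (by norm_cast; omega)
      filter_upwards [hφ1.eventually (by simp)] with q hq
      exact hq.differentiableAt one_ne_zero
    have hcont : Tendsto (fun z : E × ℝ => (β • z.1, γ * z.2) + c) (𝓝 (x, t)) (𝓝 p) :=
      Continuous.tendsto (by fun_prop) _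
    have hg' : ∀ᶠ z in 𝓝 (x, t), deriv (g z.1) z.2 = (D ∘ fderiv ℝ φ) ((β • z.1, γ * z.2) + c) := by
      filter_upwards [hg.eventually_nhds, hcont.eventually hdiff] with z hz hd
      have ht : Tendsto (fun s : ℝ => (z.1, s)) (𝓝 z.2) (𝓝 z) :=
        (Continuous.prodMk_right z.1).tendsto z.2
      have he : g z.1 =ᶠ[𝓝 z.2] fun s => φ ((β • z.1, γ * s) + c) := ht.eventually hz
      rw [he.deriv_eq]
      have hline : HasDerivAt (fun s : ℝ => ((β • z.1, γ * s) + c : E × ℝ)) (0, γ) z.2 := by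
        have := ((hasDerivAt_const z.2 (β • z.1)).prodMk ((hasDerivAt_id z.2).const_mul γ))
        simpa using this.add_const c
      have := hd.hasFDerivAt.comp_hasDerivAt z.2 hline
      refine this.deriv.trans ?_
      have h3 : ((0, γ) : E × ℝ) = γ • ((0, 1) : E × ℝ) := by simp
      rw [h3, map_smul]
      rfl
    have hcomp : ContDiffAt ℝ (k + l : ℕ) (D ∘ fderiv ℝ φ) p :=
      D.contDiff.contDiffAt.comp p hφ'
    have := ih (g := fun y => deriv (g y)) hcomp hg'
    simp only [iteratedDeriv_succ']
    refine this.trans ?_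
    have h4 := (D.norm_iteratedFDeriv_comp_left hφ' le_rfl).trans
      (mul_le_mul_of_nonneg_right hD (norm_nonneg _))
    rw [norm_iteratedFDeriv_fderiv] at h4
    rw [pow_succ, ← mul_assoc, mul_assoc (_ * _)]
    exact mul_le_mul_of_nonneg_left h4 (by positivity)

end MixedDerivatives

section Smoothing

variable {n : ℕ}

theorem IsMildNS.eval_localSolution {c : ℝ}
    (hc : ∀ (i j k : Fin n) (x : Euc n) (t : ℝ), 0 < t → Kten n i j k x t =
        c * ∫ s in Set.Ioi 0, heatKer n x (t + s) * oseenPoly i j k x (t + s))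
    (hn : 2 ≤ n) {u₀ : Euc n → Euc n} {u : Euc n → ℝ → Euc n} {T U : ℝ}
    (hu : Measurable (fun q : Euc n × ℝ => u q.1 q.2))
    (hU : ∀ x : Euc n, ∀ t ∈ Set.Ioo (0 : ℝ) T, ‖u x t‖ ≤ U) (hmild : IsMildNS n 0 T u₀ u)
    (hT : 0 < T) {t₀ : ℝ} (ht₀ : 0 < t₀)
    {w : Fin n → BM (Euc n)} (hw : ∀ i X, (w i).fn X = √t₀ * u₀ (√t₀ • X) i)
    {p : Euc n × ℝ} {V : VF n} (hp : parMap n p ∈ parDom n) (hr : 0 < p.2)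
    (hV : nsMap (oseenAmp c) ((p, w), V) = 0) {t : ℝ} (ht : t ∈ Set.Ioo 0 t₀) (htT : t * p.2 < T)
    (x : Euc n) (i : Fin n) :
    (V i).fn ((√t₀)⁻¹ • x, t / t₀) = √t₀ * u (x + (t / √t₀) • p.1) (t * p.2) i := by
  obtain ⟨h, r⟩ := p
  simp only at hr htT ⊢
  obtain ⟨v, hv⟩ := exists_scaledSol hu hU hT ht₀ h hr
  have hs : √t₀ ≠ 0 := (Real.sqrt_pos.2 ht₀).ne'
  have hlt : t / t₀ < T / (t₀ * r) := by
    rw [div_lt_div_iff₀ ht₀ (by positivity)]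
    nlinarith
  have h1 := nsMap_unique (oseenAmp_hasTemperateGrowth c) (x := ((h, r), w)) hp (v₁ := V) (v₂ := v)
    (θ := T / (t₀ * r)) (fun j q hq => by
      rw [hmild.nsMap_eq_zero hc hn hu ht₀ hr hp hw hv j fun _ => hq, hV]
      rfl) i (q := ((√t₀)⁻¹ • x, t / t₀)) hlt
  have hmem : t / t₀ ∈ Set.Ioo 0 (min 1 (T / (t₀ * r))) :=
    ⟨div_pos ht.1 ht₀, lt_min ((div_lt_one ht₀).2 ht.2) hlt⟩
  rw [h1, hv, Set.indicator_of_mem hmem]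
  have h2 : √t₀ • ((√t₀)⁻¹ • x + (t / t₀) • h) = x + (t / √t₀) • h := by
    rw [smul_add, smul_inv_smul₀ hs, smul_smul]
    congr 2
    nth_rewrite 2 [← Real.mul_self_sqrt ht₀.le]
    field_simp
  have h3 : t₀ * r * (t / t₀) = t * r := by field_simp
  rw [h2, h3]

theorem IsMildNS.norm_iteratedFDeriv_le {c : ℝ}
    (hc : ∀ (i j k : Fin n) (x : Euc n) (t : ℝ), 0 < t → Kten n i j k x t =
        c * ∫ s in Set.Ioi 0, heatKer n x (t + s) * oseenPoly i j k x (t + s))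
    (hn : 2 ≤ n) {u₀ : Euc n → Euc n} {u : Euc n → ℝ → Euc n} {T U : ℝ}
    (hu : Measurable (fun q : Euc n × ℝ => u q.1 q.2))
    (hU : ∀ x : Euc n, ∀ t ∈ Set.Ioo (0 : ℝ) T, ‖u x t‖ ≤ U) (hmild : IsMildNS n 0 T u₀ u)
    {t₀ : ℝ} (ht₀ : t₀ ∈ Set.Ioc 0 T)
    {w : Fin n → BM (Euc n)} (hw : ∀ i X, (w i).fn X = √t₀ * u₀ (√t₀ • X) i)
    {k l : ℕ} {W : Euc n × ℝ → VF n} (hW : ContDiffAt ℝ (k + l : ℕ) W (0, 1))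
    (hW0 : ∀ᶠ p in 𝓝 ((0, 1) : Euc n × ℝ), nsMap (oseenAmp c) ((p, w), W p) = 0)
    {t : ℝ} (ht : t ∈ Set.Ioo 0 t₀) (x : Euc n) (i : Fin n) :
    ‖iteratedFDeriv ℝ k (fun y => iteratedDeriv l (fun τ => u y τ i) t) x‖ ≤
      (√t₀ / t) ^ k * t⁻¹ ^ l * ((√t₀)⁻¹ * ‖iteratedFDeriv ℝ (k + l) W (0, 1)‖) := by
  have hs : 0 < √t₀ := Real.sqrt_pos.2 ht₀.1
  have htT : t < T := ht.2.trans_le ht₀.2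
  have ht0 : 0 < t := ht.1
  set q : Euc n × ℝ := ((√t₀)⁻¹ • x, t / t₀)
  set L : VF n →L[ℝ] ℝ := (√t₀)⁻¹ • (BM.eval q ∘L ContinuousLinearMap.proj i)
  have hL : ‖L‖ ≤ (√t₀)⁻¹ := by
    refine ContinuousLinearMap.opNorm_le_bound _ (by positivity) fun v => ?_
    have h1 : L v = (√t₀)⁻¹ * (v i).fn q := rfl
    rw [h1, norm_mul, Real.norm_of_nonneg (by positivity : 0 ≤ (√t₀)⁻¹)]
    gcongr
    exact ((v i).abs_fn_le q).trans (norm_le_pi_norm v i)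
  set b : Euc n × ℝ := (-((√t₀ / t) • x), 0)
  have hb : ((√t₀ / t) • x, t⁻¹ * t) + b = (0, 1) := by
    simp [b, inv_mul_cancel₀ ht0.ne']
  have hcont : Tendsto (fun z : Euc n × ℝ => ((√t₀ / t) • z.1, t⁻¹ * z.2) + b) (𝓝 (x, t))
      (𝓝 (0, 1)) := by
    rw [← hb]
    exact Continuous.tendsto (by fun_prop) _
  have hev : ∀ᶠ p in 𝓝 ((0, 1) : Euc n × ℝ), 0 < p.2 ∧ t * p.2 < T :=
    (continuous_snd.tendsto _ |>.eventually (lt_mem_nhds one_pos)).and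
      ((continuous_snd.const_mul t).tendsto _ |>.eventually (gt_mem_nhds (by simpa using htT)))
  have hg : ∀ᶠ z in 𝓝 (x, t), (fun y τ => u y τ i) z.1 z.2 =
      (L ∘ W) (((√t₀ / t) • z.1, t⁻¹ * z.2) + b) := by
    filter_upwards [hcont.eventually hW0, hcont.eventually hev,
      hcont.eventually (eventually_parMap_mem n)] with z h1 h2 h3
    have := hmild.eval_localSolution hc hn hu hU (ht0.trans htT) ht₀.1 hw h3 h2.1 h1 ht h2.2 x i
    have h4 : (L ∘ W) (((√t₀ / t) • z.1, t⁻¹ * z.2) + b) =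
      (√t₀)⁻¹ * (W (((√t₀ / t) • z.1, t⁻¹ * z.2) + b) i).fn q := rfl
    rw [h4, this, inv_mul_cancel_left₀ hs.ne']
    have h5 : x + (t / √t₀) • (((√t₀ / t) • z.1, t⁻¹ * z.2) + b).1 = z.1 := by
      have h6 : t / √t₀ * (√t₀ / t) = 1 := by field_simp
      simp [b, smul_smul, h6]
    have h7 : t * (((√t₀ / t) • z.1, t⁻¹ * z.2) + b).2 = z.2 := by
      simp [b, mul_inv_cancel_left₀ ht0.ne']
    rw [h5, h7]
  have hφ : ContDiffAt ℝ (k + l : ℕ) (L ∘ W) (((√t₀ / t) • x, t⁻¹ * t) + b) := by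
    rw [hb]
    exact L.contDiff.contDiffAt.comp _ hW
  have := norm_iteratedFDeriv_iteratedDeriv_le k l (g := fun y τ => u y τ i) hφ hg
  rw [hb, abs_of_pos (by positivity), abs_of_pos (by positivity)] at this
  refine this.trans ?_
  gcongr
  refine (L.norm_iteratedFDeriv_comp_left hW le_rfl).trans ?_
  gcongr

theorem exists_uniform_localSolution (c : ℝ) (m : ℕ) : ∃ δ > 0, ∃ K : ℝ, 0 ≤ K ∧
    ∀ w : Fin n → BM (Euc n), ‖w‖ < δ → ∃ W : Euc n × ℝ → VF n, ContDiffAt ℝ m W (0, 1) ∧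
      (∀ᶠ p in 𝓝 ((0, 1) : Euc n × ℝ), nsMap (oseenAmp c) ((p, w), W p) = 0) ∧
      ‖iteratedFDeriv ℝ m W (0, 1)‖ ≤ K * ‖w‖ := by
  have hM := oseenAmp_hasTemperateGrowth (n := n) c
  have hz : ∀ p : Euc n × ℝ, nsMap (oseenAmp (n := n) c) ((p, 0), 0) = 0 := fun p => by
    funext i
    simp [nsMap]
  obtain ⟨V, hV, -, hV0⟩ := exists_local_solution hM (0 : Fin n → BM (Euc n)) 0 (hz _)
  set P : (Euc n × ℝ) × (Fin n → BM (Euc n)) := ((0, 1), 0) with hP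
  have haff : ∀ (w : Fin n → BM (Euc n)) (p : Euc n × ℝ),
      ContinuousLinearMap.inl ℝ (Euc n × ℝ) (Fin n → BM (Euc n)) p + (0, w) = (p, w) :=
    fun w p => by simp
  have hw : Tendsto (fun w : Fin n → BM (Euc n) => (((0, 1), w) : (Euc n × ℝ) × _)) (𝓝 0) (𝓝 P) :=
    Continuous.tendsto (by fun_prop) _
  have hVm : ContDiffAt ℝ m V P := hV.of_le (by exact_mod_cast le_top)
  have hVd : ContDiffAt ℝ 1 (iteratedFDeriv ℝ m V) P :=
    hV.iteratedFDeriv_right (i := m) (by exact_mod_cast le_top)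
  obtain ⟨K, s, hs, hK⟩ := hVd.exists_lipschitzOnWith
  have hEv : ∀ᶠ w in 𝓝 (0 : Fin n → BM (Euc n)), ContDiffAt ℝ m V ((0, 1), w) ∧
      (∀ᶠ x in 𝓝 (((0, 1), w) : (Euc n × ℝ) × (Fin n → BM (Euc n))),
        nsMap (oseenAmp c) (x, V x) = 0) ∧ ((0, 1), w) ∈ s :=
    (hw.eventually (hVm.eventually (by simp))).and
      ((hw.eventually hV0.eventually_nhds).and (hw.eventually hs))
  obtain ⟨δ, hδ, hball⟩ := Metric.eventually_nhds_iff.1 hEv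
  have hpart : ∀ w : Fin n → BM (Euc n), ContDiffAt ℝ m V ((0, 1), w) →
      ContDiffAt ℝ m (fun p => V (p, w)) (0, 1) ∧
      iteratedFDeriv ℝ m (fun p => V (p, w)) (0, 1) =
        (iteratedFDeriv ℝ m V ((0, 1), w)).compContinuousLinearMap
          fun _ => ContinuousLinearMap.inl ℝ _ _ := fun w h => by
    have h' := h
    rw [← haff] at h'
    refine ⟨ContDiffAt.comp (g := V) _ h (contDiffAt_id.prodMk contDiffAt_const), ?_⟩
    have := iteratedFDeriv_comp_affine _ _ h'
    simpa only [haff] using this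
  have hzero : iteratedFDeriv ℝ m (fun p => V (p, (0 : Fin n → BM (Euc n)))) (0, 1) = 0 := by
    have hp : Tendsto (fun p : Euc n × ℝ => (p, (0 : Fin n → BM (Euc n)))) (𝓝 (0, 1)) (𝓝 P) :=
      Continuous.tendsto (by fun_prop) _
    have : (fun p => V (p, (0 : Fin n → BM (Euc n)))) =ᶠ[𝓝 (0, 1)] fun _ => 0 := by
      filter_upwards [hp.eventually hV0, eventually_parMap_mem n] with p h1 h2
      funext i
      ext q
      refine nsMap_unique hM (x := (p, 0)) h2 (θ := q.2 + 1) (fun j q' _ => ?_) i (lt_add_one _)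
      rw [h1, hz]
    rw [(Filter.EventuallyEq.iteratedFDeriv ℝ this m).eq_of_nhds]
    simp
  refine ⟨δ, hδ, K, K.2, fun w hwδ => ⟨fun p => V (p, w), ?_⟩⟩
  obtain ⟨h1, h2, h3⟩ := hball (y := w) (by simpa using hwδ)
  have h0s : P ∈ s := mem_of_mem_nhds hs
  have hp : Tendsto (fun p : Euc n × ℝ => (p, w)) (𝓝 (0, 1)) (𝓝 ((0, 1), w)) :=
    Continuous.tendsto (by fun_prop) _
  refine ⟨(hpart w h1).1, hp.eventually h2, ?_⟩
  have hL := hK.norm_sub_le h3 h0s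
  have hdiff : (((0, 1), w) : (Euc n × ℝ) × (Fin n → BM (Euc n))) - P = (0, w) := by simp [hP]
  rw [hdiff] at hL
  have hsub : iteratedFDeriv ℝ m (fun p => V (p, w)) (0, 1) =
      (iteratedFDeriv ℝ m V ((0, 1), w) - iteratedFDeriv ℝ m V P).compContinuousLinearMap
          fun _ => ContinuousLinearMap.inl ℝ _ _ := by
    have h4 := (hpart 0 hVm).2
    rw [hzero] at h4
    rw [(hpart w h1).2]
    ext v
    have h5 := congrArg (fun f => f v) h4
    simp only [ContinuousMultilinearMap.compContinuousLinearMap_apply] at h5 ⊢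
    rw [sub_apply, ← h5]
    simp
  rw [hsub]
  refine (ContinuousMultilinearMap.norm_compContinuousLinearMap_le _ _).trans ?_
  rw [Finset.prod_const]
  refine (mul_le_of_le_one_right (norm_nonneg _) (pow_le_one₀ (norm_nonneg _)
    (ContinuousLinearMap.norm_inl_le_one ℝ _ _))).trans ?_
  simpa [Prod.norm_def] using hL

theorem rpow_mul_scaling (k l : ℕ) {t : ℝ} (ht : 0 < t) (s A : ℝ) :
    t ^ ((k : ℝ) / 2 + l) * ((s / t) ^ k * t⁻¹ ^ l * A) = (s / √t) ^ k * A := by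
  have h1 : t ^ ((k : ℝ) / 2 + l) = √t ^ k * t ^ l := by
    rw [rpow_add ht, rpow_natCast, Real.sqrt_eq_rpow, ← rpow_mul_natCast ht.le]
    ring_nf
  have h2 : √t * (s / t) = s / √t := by
    nth_rewrite 2 [← Real.mul_self_sqrt ht.le]
    have := (Real.sqrt_pos.2 ht).ne'
    field_simp
  have h3 : t ^ l * t⁻¹ ^ l = 1 := by rw [← mul_pow, mul_inv_cancel₀ ht.ne', one_pow]
  calc _ = (√t * (s / t)) ^ k * (t ^ l * t⁻¹ ^ l) * A := by rw [h1, mul_pow]; ring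
    _ = _ := by rw [h2, h3, mul_one]

theorem exists_smoothing_bound (hn : 2 ≤ n) (k l : ℕ) {c : ℝ}
    (hc : ∀ (i j k : Fin n) (x : Euc n) (t : ℝ), 0 < t → Kten n i j k x t =
        c * ∫ s in Set.Ioi 0, heatKer n x (t + s) * oseenPoly i j k x (t + s)) :
    ∃ ε > (0 : ℝ), ∃ C > (0 : ℝ), ∀ (T : ℝ) (u₀ : Euc n → Euc n) (N : ℝ) (u : Euc n → ℝ → Euc n)
      (U : ℝ), Measurable u₀ → (∀ x : Euc n, ‖u₀ x‖ ≤ N) →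
      Measurable (fun q : Euc n × ℝ => u q.1 q.2) →
      (∀ x : Euc n, ∀ t ∈ Set.Ioo (0 : ℝ) T, ‖u x t‖ ≤ U) → IsMildNS n 0 T u₀ u →
      ∀ x : Euc n, ∀ t ∈ Set.Ioo (0 : ℝ) (min T (ε * N⁻¹ ^ 2)), ∀ i : Fin n,
        t ^ ((k : ℝ) / 2 + l) *
          ‖iteratedFDeriv ℝ k (fun y => iteratedDeriv l (fun τ => u y τ i) t) x‖ ≤ C * N := by
  obtain ⟨δ, hδ, K, hK, hloc⟩ := exists_uniform_localSolution (n := n) c (k + l)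
  refine ⟨(δ / 2) ^ 2, by positivity, 2 ^ k * K + 1, by positivity, ?_⟩
  intro T u₀ N u U hu₀ hN hu hU hmild x t ht i
  have hN0 : 0 < N := by
    refine ((norm_nonneg _).trans (hN 0)).lt_of_ne fun h => ?_
    have := ht.1.trans (ht.2.trans_le (min_le_right _ _))
    simp [← h] at this
  set t₀ := min (2 * t) (min T ((δ / 2) ^ 2 * N⁻¹ ^ 2)) with ht₀
  have htt₀ : t < t₀ := lt_min (by linarith [ht.1]) ht.2
  have ht₀0 : 0 < t₀ := ht.1.trans htt₀
  have hs : 0 < √t₀ := Real.sqrt_pos.2 ht₀0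
  obtain ⟨w, hw, hwN⟩ := exists_scaledData hu₀ hN t₀
  have hwδ : ‖w‖ < δ := by
    have h1 : √t₀ ≤ δ / 2 * N⁻¹ := by
      refine Real.sqrt_le_iff.2 ⟨by positivity, ?_⟩
      rw [mul_pow]
      exact (min_le_right _ _).trans (min_le_right _ _)
    calc ‖w‖ ≤ √t₀ * N := hwN
      _ ≤ δ / 2 * N⁻¹ * N := by gcongr
      _ < δ := by rw [inv_mul_cancel_right₀ hN0.ne']; linarith
  obtain ⟨W, hW, hW0, hWK⟩ := hloc w hwδ
  have hmain := hmild.norm_iteratedFDeriv_le hc hn hu hU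
    ⟨ht₀0, (min_le_right _ _).trans (min_le_left _ _)⟩ hw hW hW0 ⟨ht.1, htt₀⟩ x i
  refine (mul_le_mul_of_nonneg_left hmain (rpow_nonneg ht.1.le _)).trans ?_
  rw [rpow_mul_scaling k l ht.1]
  have h2 : √t₀ / √t ≤ 2 := by
    rw [div_le_iff₀ (Real.sqrt_pos.2 ht.1)]
    refine Real.sqrt_le_iff.2 ⟨by positivity, ?_⟩
    rw [mul_pow, Real.sq_sqrt ht.1.le]
    linarith [min_le_left (2 * t) (min T ((δ / 2) ^ 2 * N⁻¹ ^ 2)), ht.1]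
  calc _ ≤ 2 ^ k * ((√t₀)⁻¹ * (K * (√t₀ * N))) := by
        gcongr
        exact hWK.trans (mul_le_mul_of_nonneg_left hwN hK)
    _ = 2 ^ k * K * N := by field_simp
    _ ≤ (2 ^ k * K + 1) * N := by gcongr; linarith

theorem IsMildNS.exists_bound_of_le (hn : 2 ≤ n) (k l : ℕ) {c : ℝ}
    (hc : ∀ (i j k : Fin n) (x : Euc n) (t : ℝ), 0 < t → Kten n i j k x t =
        c * ∫ s in Set.Ioi 0, heatKer n x (t + s) * oseenPoly i j k x (t + s))
    {T : ℝ} (hT : 0 < T) {u₀ : Euc n → Euc n} {N : ℝ} {u : Euc n → ℝ → Euc n} {U : ℝ}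
    (hu₀ : Measurable u₀) (hN : ∀ x : Euc n, ‖u₀ x‖ ≤ N)
    (hu : Measurable (fun q : Euc n × ℝ => u q.1 q.2))
    (hU : ∀ x : Euc n, ∀ t ∈ Set.Ioo (0 : ℝ) T, ‖u x t‖ ≤ U) (hmild : IsMildNS n 0 T u₀ u)
    {a : ℝ} (ha : 0 < a) :
    ∃ B : ℝ, ∀ x : Euc n, ∀ t ∈ Set.Ico a T, ∀ i : Fin n, t ^ ((k : ℝ) / 2 + l) *
      ‖iteratedFDeriv ℝ k (fun y => iteratedDeriv l (fun τ => u y τ i) t) x‖ ≤ B := by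
  obtain ⟨w, hw, -⟩ := exists_scaledData hu₀ hN T
  obtain ⟨v, hv⟩ := exists_scaledSol hu hU hT hT 0 one_pos
  have h0 : nsMap (oseenAmp c) (((0, 1), w), v) = 0 := by
    funext i
    ext q
    refine hmild.nsMap_eq_zero hc hn hu hT one_pos ?_ hw hv i fun h => ?_
    · rw [parMap_base]
      exact base_mem_parDom n
    · rw [mul_one, div_self hT.ne']
      exact h.2
  obtain ⟨V, hV, -, hV0⟩ := exists_local_solution (oseenAmp_hasTemperateGrowth c) w v h0
  have hp : Tendsto (fun p : Euc n × ℝ => (p, w)) (𝓝 (0, 1)) (𝓝 ((0, 1), w)) :=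
    Continuous.tendsto (by fun_prop) _
  have hW : ContDiffAt ℝ (k + l : ℕ) (fun p : Euc n × ℝ => V (p, w)) (0, 1) :=
    ContDiffAt.comp (g := V) _ (hV.of_le (by exact_mod_cast le_top))
      (contDiffAt_id.prodMk contDiffAt_const)
  refine ⟨(√T / √a) ^ k *
    ((√T)⁻¹ * ‖iteratedFDeriv ℝ (k + l) (fun p : Euc n × ℝ => V (p, w)) (0, 1)‖),
    fun x t ht i => ?_⟩
  have ht0 : 0 < t := ha.trans_le ht.1
  have hmain := hmild.norm_iteratedFDeriv_le hc hn hu hU ⟨hT, le_rfl⟩ hw hW (hp.eventually hV0)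
    ⟨ht0, ht.2⟩ x i
  refine (mul_le_mul_of_nonneg_left hmain (rpow_nonneg ht0.le _)).trans ?_
  rw [rpow_mul_scaling k l ht0]
  have hsa : 0 < √a := Real.sqrt_pos.2 ha
  gcongr
  exact ht.1

end Smoothing

/-- Proposition 4.1 (smoothing): for a bounded mild solution u on ℝⁿ × (0,T) with
datum u₀ ∈ L^∞, the functions t^{k/2+l} ∇_x^k ∂_t^l u are bounded, and with
T' = min(T, ε(k,l)‖u₀‖_∞⁻²) one has
‖t^{k/2+l} ∇_x^k ∂_t^l u‖_{L^∞(ℝⁿ×(0,T'))} ≤ C(k,l)‖u₀‖_∞. -/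
theorem ns_mild_smoothing (n : ℕ) (hn : 2 ≤ n) (k l : ℕ) :
    ∃ ε > (0:ℝ), ∃ C > (0:ℝ), ∀ (T : ℝ), 0 < T →
      ∀ (u₀ : Euc n → Euc n) (N : ℝ) (u : Euc n → ℝ → Euc n) (U : ℝ),
      Measurable u₀ → (∀ x : Euc n, ‖u₀ x‖ ≤ N) →
      Measurable (fun q : Euc n × ℝ => u q.1 q.2) →
      (∀ x : Euc n, ∀ t ∈ Set.Ioo (0:ℝ) T, ‖u x t‖ ≤ U) →
      IsMildNS n 0 T u₀ u →
      -- t^{k/2+l} ∇_x^k ∂_t^l u is bounded on ℝⁿ × (0,T)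
      ((∃ B : ℝ, ∀ x : Euc n, ∀ t ∈ Set.Ioo (0:ℝ) T, ∀ i : Fin n,
          t ^ ((k : ℝ) / 2 + l) *
            ‖iteratedFDeriv ℝ k (fun y => iteratedDeriv l (fun τ => u y τ i) t) x‖ ≤ B) ∧
        -- the quantitative bound on (0, T') with T' = min(T, ε N⁻²)
        (∀ x : Euc n, ∀ t ∈ Set.Ioo (0:ℝ) (min T (ε * N⁻¹ ^ 2)), ∀ i : Fin n,
          t ^ ((k : ℝ) / 2 + l) *
            ‖iteratedFDeriv ℝ k (fun y => iteratedDeriv l (fun τ => u y τ i) t) x‖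
              ≤ C * N)) := by
  obtain ⟨c, hc⟩ := exists_Kten_eq hn
  obtain ⟨ε, hε, C, hC, hsmall⟩ := exists_smoothing_bound hn k l hc
  refine ⟨ε, hε, C, hC, fun T hT u₀ N u U hu₀ hN hu hU hmild => ⟨?_, ?_⟩⟩
  · have hN0 : 0 < N + 1 := by linarith [(norm_nonneg _).trans (hN 0)]
    have hN' : ∀ x : Euc n, ‖u₀ x‖ ≤ N + 1 := fun x => (hN x).trans (by linarith)
    obtain ⟨B, hB⟩ := hmild.exists_bound_of_le hn k l hc hT hu₀ hN hu hU
      (a := min T (ε * (N + 1)⁻¹ ^ 2)) (lt_min hT (by positivity))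
    refine ⟨max B (C * (N + 1)), fun x t ht i => ?_⟩
    rcases lt_or_ge t (min T (ε * (N + 1)⁻¹ ^ 2)) with h | h
    · exact (hsmall T u₀ (N + 1) u U hu₀ hN' hu hU hmild x t ⟨ht.1, h⟩ i).trans (le_max_right _ _)
    · exact (hB x t ⟨h, ht.2⟩ i).trans (le_max_left _ _)
  · exact hsmall T u₀ N u U hu₀ hN hu hU hmild

end
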